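/- For all integers n ≥ 2, r with 0 ≤ r ≤ n−1 and ε ∈ {1, −1}, there is a unique ℚ(v)-algebra homomorphism Φ_{r,ε;1} : U(ĝl_n) → U(ŝl_{n+1})₁ such that Φ_{r,ε;1}(E_i) = e_i, Φ_{r,ε;1}(F_i) = f_i, and Φ_{r,ε;1}(L_i^{±1}) = l_i^{±1} for all i ∈ ℤ/nℤ (where the images of e_i, f_i, l_i in the quotient U(ŝl_{n+1})₁ are meant); moreover Φ_{r,ε;1} is injective. -/

import Mathlib

noncomputable section

/-- The field ℚ(v) of rational functions over ℚ. -/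
abbrev Qv : Type := RatFunc ℚ

/-- The indeterminate v. -/
def vv : Qv := RatFunc.X

/-- The quantum integer [a] = (v^a - v^{-a})/(v - v⁻¹). -/
def qint (a : ℕ) : Qv := (vv ^ (a : ℤ) - vv ^ (-(a : ℤ))) / (vv - vv⁻¹)

/-- The quantum factorial [a]! = [a][a-1]⋯[1]. -/
def qfact : ℕ → Qv
  | 0 => 1
  | n + 1 => qint (n + 1) * qfact n

/-- Divided power x^{(p)} = x^p / [p]!. -/
def dp {A : Type} [Ring A] [Algebra Qv A] (x : A) (p : ℕ) : A :=
  (qfact p)⁻¹ • x ^ p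

/-- The affine type A Cartan matrix entries c_{ij} = 2δ_{i,j} - δ_{i,j+1} - δ_{i,j-1}. -/
def cartan {m : ℕ} (i j : ZMod m) : ℤ :=
  (if i = j then 2 else 0) - (if i = j + 1 then 1 else 0) - (if i = j - 1 then 1 else 0)

/-- Generators of the quantum affine algebra U(ŝl_m). -/
inductive Gen (m : ℕ) : Type
  | E : ZMod m → Gen m
  | F : ZMod m → Gen m
  | K : ZMod m → Gen m
  | Kinv : ZMod m → Gen m

abbrev FA (m : ℕ) := FreeAlgebra Qv (Gen m)

def fE {m : ℕ} (i : ZMod m) : FA m := FreeAlgebra.ι Qv (Gen.E i)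
def fF {m : ℕ} (i : ZMod m) : FA m := FreeAlgebra.ι Qv (Gen.F i)
def fK {m : ℕ} (i : ZMod m) : FA m := FreeAlgebra.ι Qv (Gen.K i)
def fKinv {m : ℕ} (i : ZMod m) : FA m := FreeAlgebra.ι Qv (Gen.Kinv i)

/-- The defining relations of the quantum affine algebra U(ŝl_m). -/
inductive URel (m : ℕ) : FA m → FA m → Prop
  | KK : ∀ i j, URel m (fK i * fK j) (fK j * fK i)
  | KKinv : ∀ i, URel m (fK i * fKinv i) 1
  | KinvK : ∀ i, URel m (fKinv i * fK i) 1
  | KE : ∀ i j, URel m (fK i * fE j) (vv ^ cartan i j • (fE j * fK i))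
  | KF : ∀ i j, URel m (fK i * fF j) (vv ^ (-cartan i j) • (fF j * fK i))
  | EF : ∀ i j, URel m (fE i * fF j - fF j * fE i)
      (if i = j then (vv - vv⁻¹)⁻¹ • (fK i - fKinv i) else 0)
  | serreE : ∀ i j, i ≠ j →
      URel m (∑ p ∈ Finset.range ((1 - cartan i j).toNat + 1),
        ((-1 : Qv) ^ p) • (dp (fE i) p * fE j * dp (fE i) ((1 - cartan i j).toNat - p))) 0
  | serreF : ∀ i j, i ≠ j →
      URel m (∑ p ∈ Finset.range ((1 - cartan i j).toNat + 1),
        ((-1 : Qv) ^ p) • (dp (fF i) p * fF j * dp (fF i) ((1 - cartan i j).toNat - p))) 0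

/-- The quantum affine algebra U(ŝl_m), presented by generators and relations. -/
abbrev U (m : ℕ) := RingQuot (URel m)

def UE {m : ℕ} (i : ZMod m) : U m := RingQuot.mkAlgHom Qv (URel m) (fE i)
def UF {m : ℕ} (i : ZMod m) : U m := RingQuot.mkAlgHom Qv (URel m) (fF i)
def UK {m : ℕ} (i : ZMod m) : U m := RingQuot.mkAlgHom Qv (URel m) (fK i)
def UKinv {m : ℕ} (i : ZMod m) : U m := RingQuot.mkAlgHom Qv (URel m) (fKinv i)

/-- The element e_r = Ĕ_r Ĕ_{r+1} − v^ε Ĕ_{r+1} Ĕ_r in U(ŝl_{n+1}). -/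
def er (n r : ℕ) (ε : ℤ) : U (n + 1) :=
  UE (r : ZMod (n + 1)) * UE ((r : ZMod (n + 1)) + 1) -
    vv ^ ε • (UE ((r : ZMod (n + 1)) + 1) * UE (r : ZMod (n + 1)))

/-- The element f_r = F̆_{r+1} F̆_r − v^{−ε} F̆_r F̆_{r+1} in U(ŝl_{n+1}). -/
def fr (n r : ℕ) (ε : ℤ) : U (n + 1) :=
  UF ((r : ZMod (n + 1)) + 1) * UF (r : ZMod (n + 1)) -
    vv ^ (-ε) • (UF (r : ZMod (n + 1)) * UF ((r : ZMod (n + 1)) + 1))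

/-- The element k_r = K̆_r K̆_{r+1} in U(ŝl_{n+1}). -/
def kr (n r : ℕ) : U (n + 1) :=
  UK (r : ZMod (n + 1)) * UK ((r : ZMod (n + 1)) + 1)

/-- The image e_i ∈ U(ŝl_{n+1}) of the generator E_i, i ∈ ℤ/nℤ. -/
def eElt (n r : ℕ) (ε : ℤ) (i : ZMod n) : U (n + 1) :=
  if i.val < r then UE ((i.val : ZMod (n + 1)))
  else if i.val = r then er n r ε
  else UE ((i.val + 1 : ℕ) : ZMod (n + 1))

def fElt (n r : ℕ) (ε : ℤ) (i : ZMod n) : U (n + 1) :=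
  if i.val < r then UF ((i.val : ZMod (n + 1)))
  else if i.val = r then fr n r ε
  else UF ((i.val + 1 : ℕ) : ZMod (n + 1))

def kElt (n r : ℕ) (i : ZMod n) : U (n + 1) :=
  if i.val < r then UK ((i.val : ZMod (n + 1)))
  else if i.val = r then kr n r
  else UK ((i.val + 1 : ℕ) : ZMod (n + 1))

def kinvElt (n r : ℕ) (i : ZMod n) : U (n + 1) :=
  if i.val < r then UKinv ((i.val : ZMod (n + 1)))
  else if i.val = r then UKinv (r : ZMod (n + 1)) * UKinv ((r : ZMod (n + 1)) + 1)
  else UKinv ((i.val + 1 : ℕ) : ZMod (n + 1))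

/-- K̆_1 K̆_2 ⋯ K̆_{n+1} in U(ŝl_{n+1}). -/
def prodK (n : ℕ) : U (n + 1) :=
  ((List.range (n + 1)).map (fun s => UK (((s + 1 : ℕ) : ZMod (n + 1))))).prod

/-- The relation identifying K̆_1 ⋯ K̆_{n+1} with 1. -/
inductive Rel1 (n : ℕ) : U (n + 1) → U (n + 1) → Prop
  | central : Rel1 n (prodK n) 1

/-- The level-1 quotient U(ŝl_{n+1})₁ = U(ŝl_{n+1}) / ⟨K̆_1 ⋯ K̆_{n+1} − 1⟩. -/
abbrev U1 (n : ℕ) := RingQuot (Rel1 n)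

/-- The canonical projection U(ŝl_{n+1}) → U(ŝl_{n+1})₁. -/
def toU1 (n : ℕ) : U (n + 1) →ₐ[Qv] U1 n := RingQuot.mkAlgHom Qv (Rel1 n)

/-- l_i = K̆_i ⋯ K̆_r for 1 ≤ i ≤ r and l_i = K̆_{r+1}⁻¹ ⋯ K̆_i⁻¹ for r+1 ≤ i ≤ n,
as an element of U(ŝl_{n+1}). -/
def lElt (n r : ℕ) (i : ℕ) : U (n + 1) :=
  if i ≤ r then ((List.range (r + 1 - i)).map (fun t => UK (((i + t : ℕ) : ZMod (n + 1))))).prod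
  else ((List.range (i - r)).map (fun t => UKinv (((r + 1 + t : ℕ) : ZMod (n + 1))))).prod

/-- l_i⁻¹ = K̆_i⁻¹ ⋯ K̆_r⁻¹ for 1 ≤ i ≤ r and l_i⁻¹ = K̆_{r+1} ⋯ K̆_i for r+1 ≤ i ≤ n. -/
def linvElt (n r : ℕ) (i : ℕ) : U (n + 1) :=
  if i ≤ r then ((List.range (r + 1 - i)).map (fun t => UKinv (((i + t : ℕ) : ZMod (n + 1))))).prod
  else ((List.range (i - r)).map (fun t => UK (((r + 1 + t : ℕ) : ZMod (n + 1))))).prod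

/-- The representative of i ∈ ℤ/nℤ lying in {1, …, n}. -/
def rep1 {n : ℕ} (i : ZMod n) : ℕ := if i.val = 0 then n else i.val

/-- Generators of the quantum affine algebra U(ĝl_n). -/
inductive GenGl (m : ℕ) : Type
  | E : ZMod m → GenGl m
  | F : ZMod m → GenGl m
  | L : ZMod m → GenGl m
  | Linv : ZMod m → GenGl m

abbrev FAgl (m : ℕ) := FreeAlgebra Qv (GenGl m)

def gE {m : ℕ} (i : ZMod m) : FAgl m := FreeAlgebra.ι Qv (GenGl.E i)
def gF {m : ℕ} (i : ZMod m) : FAgl m := FreeAlgebra.ι Qv (GenGl.F i)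
def gL {m : ℕ} (i : ZMod m) : FAgl m := FreeAlgebra.ι Qv (GenGl.L i)
def gLinv {m : ℕ} (i : ZMod m) : FAgl m := FreeAlgebra.ι Qv (GenGl.Linv i)

/-- The defining relations of U(ĝl_m) (Green's quantum affine gl_m). -/
inductive RelGl (m : ℕ) : FAgl m → FAgl m → Prop
  | LL : ∀ i j, RelGl m (gL i * gL j) (gL j * gL i)
  | LLinv : ∀ i, RelGl m (gL i * gLinv i) 1
  | LinvL : ∀ i, RelGl m (gLinv i * gL i) 1
  | LE : ∀ i j, RelGl m (gL i * gE j)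
      (vv ^ (((if i = j then 1 else 0) : ℤ) - ((if i - 1 = j then 1 else 0) : ℤ)) •
        (gE j * gL i))
  | LF : ∀ i j, RelGl m (gL i * gF j)
      (vv ^ (-(((if i = j then 1 else 0) : ℤ) - ((if i - 1 = j then 1 else 0) : ℤ))) •
        (gF j * gL i))
  | EF : ∀ i j, RelGl m (gE i * gF j - gF j * gE i)
      (if i = j then (vv - vv⁻¹)⁻¹ • (gL i * gLinv (i + 1) - gLinv i * gL (i + 1)) else 0)
  | serreE : ∀ i j, i ≠ j →
      RelGl m (∑ p ∈ Finset.range ((1 - cartan i j).toNat + 1),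
        ((-1 : Qv) ^ p) • (dp (gE i) p * gE j * dp (gE i) ((1 - cartan i j).toNat - p))) 0
  | serreF : ∀ i j, i ≠ j →
      RelGl m (∑ p ∈ Finset.range ((1 - cartan i j).toNat + 1),
        ((-1 : Qv) ^ p) • (dp (gF i) p * gF j * dp (gF i) ((1 - cartan i j).toNat - p))) 0

/-- Green's quantum affine gl_m. -/
abbrev Ugl (m : ℕ) := RingQuot (RelGl m)

def GlE {m : ℕ} (i : ZMod m) : Ugl m := RingQuot.mkAlgHom Qv (RelGl m) (gE i)
def GlF {m : ℕ} (i : ZMod m) : Ugl m := RingQuot.mkAlgHom Qv (RelGl m) (gF i)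
def GlL {m : ℕ} (i : ZMod m) : Ugl m := RingQuot.mkAlgHom Qv (RelGl m) (gL i)
def GlLinv {m : ℕ} (i : ZMod m) : Ugl m := RingQuot.mkAlgHom Qv (RelGl m) (gLinv i)

/-- The number `m - 1`, corrected to `m` when `n ∣ m`: the coefficient with which a root vector of
height `m` appears in the sum of brackets of lower root vectors. -/
def affC (n m : ℕ) : ℕ := if n ∣ m then m else m - 1

/-- Root vectors of height `m` (starting at residue `i`) built from Chevalley generators. -/
def rootVec (𝕜 : Type*) [Field 𝕜] {n : ℕ} {L : Type*} [LieRing L] [Module 𝕜 L]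
    (e : ZMod n → L) (m : ℕ) (i : ZMod n) : L :=
  if m = 1 then e i else
    ((affC n m : ℕ) : 𝕜)⁻¹ • ∑ a ∈ (Finset.Ioo 0 m).attach,
      ⁅rootVec 𝕜 e a.1 i, rootVec 𝕜 e (m - a.1) (i + (a.1 : ZMod n))⁆
termination_by m
decreasing_by
  all_goals
    have := Finset.mem_Ioo.1 a.2
    omega

section RootVec

variable {𝕜 : Type*} [Field 𝕜] {n : ℕ} {L : Type*} [LieRing L] [Module 𝕜 L] (e : ZMod n → L)

lemma rootVec_one (i : ZMod n) : rootVec 𝕜 e 1 i = e i := by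
  rw [rootVec]; simp

lemma rootVec_of_ne_one {m : ℕ} (hm : m ≠ 1) (i : ZMod n) :
    rootVec 𝕜 e m i = ((affC n m : ℕ) : 𝕜)⁻¹ • ∑ a ∈ Finset.Ioo 0 m,
      ⁅rootVec 𝕜 e a i, rootVec 𝕜 e (m - a) (i + (a : ZMod n))⁆ := by
  rw [rootVec, if_neg hm, Finset.sum_attach (Finset.Ioo 0 m)
    (fun a => ⁅rootVec 𝕜 e a i, rootVec 𝕜 e (m - a) (i + (a : ZMod n))⁆)]

lemma rootVec_zero (i : ZMod n) : rootVec 𝕜 e 0 i = 0 := by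
  rw [rootVec_of_ne_one e (by norm_num)]; simp

lemma affC_eq {m : ℕ} (hm : 1 ≤ m) :
    (affC n m : ℤ) = m - 1 + if n ∣ m then 1 else 0 := by
  unfold affC; split_ifs <;> omega

lemma affC_ne_zero {m : ℕ} (hm : 2 ≤ m) : affC n m ≠ 0 := by
  unfold affC; split_ifs <;> omega

lemma affC_smul_rootVec [CharZero 𝕜] (hn : 2 ≤ n) (m : ℕ) (i : ZMod n) :
    ((affC n m : ℕ) : 𝕜) • rootVec 𝕜 e m i = ∑ a ∈ Finset.Ioo 0 m,
      ⁅rootVec 𝕜 e a i, rootVec 𝕜 e (m - a) (i + (a : ZMod n))⁆ := by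
  rcases Nat.lt_or_ge m 2 with h | h
  · interval_cases m
    · simp [rootVec_zero]
    · have : affC n 1 = 0 := by
        unfold affC; rw [if_neg]; intro h; have := Nat.le_of_dvd one_pos h; omega
      rw [this]; simp [show Finset.Ioo 0 1 = ∅ from rfl]
  · rw [rootVec_of_ne_one e (by omega), smul_smul, mul_inv_cancel₀, one_smul]
    exact_mod_cast affC_ne_zero h

end RootVec

/-- The classical affine Serre relations in a Lie ring, cyclic type `A`. -/
structure ClassicalSerre {n : ℕ} {L : Type*} [LieRing L] (e : ZMod n → L) : Prop where
  comm : ∀ i j, i + 1 ≠ j → j + 1 ≠ i → ⁅e i, e j⁆ = 0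
  quad_right : 3 ≤ n → ∀ i, ⁅e i, ⁅e i, e (i + 1)⁆⁆ = 0
  quad_left : 3 ≤ n → ∀ i, ⁅e (i + 1), ⁅e (i + 1), e i⁆⁆ = 0
  cubic : n = 2 → ∀ i, ⁅e i, ⁅e i, ⁅e i, e (i + 1)⁆⁆⁆ = 0

section Table

variable {n : ℕ} {L : Type*} [LieRing L] [LieAlgebra ℚ L] {e : ZMod n → L}

local notation "X" => rootVec ℚ e

/-- The bracket rule of root vectors. -/
def BracketRule (e : ZMod n → L) (a b : ℕ) (i j : ZMod n) : Prop :=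
  ⁅rootVec ℚ e a i, rootVec ℚ e b j⁆ =
    (if i + a = j then rootVec ℚ e (a + b) i else 0) -
      (if j + b = i then rootVec ℚ e (a + b) j else 0)

lemma half_bracket_identity (hn : 2 ≤ n) {m a b : ℕ} (hb : 1 ≤ b) (hm : a + b = m)
    (i j : ZMod n)
    (IH : ∀ a' b' i' j', 1 ≤ a' → 1 ≤ b' → a' + b' < m → BracketRule e a' b' i' j') :
    ((affC n a : ℕ) : ℚ) • ⁅X a i, X b j⁆ =
      (if i + a = j then ∑ t ∈ Finset.Ioo 0 a, ⁅X t i, X (m - t) (i + t)⁆ else 0)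
      - (if j + b = i then ∑ t ∈ Finset.Ioo b m, ⁅X t j, X (m - t) (j + t)⁆ else 0)
      - (∑ t ∈ Finset.Ioo 0 a, if i + t = j + b then ⁅X t i, X (m - t) j⁆ else 0)
      + ∑ t ∈ Finset.Ioo b m, if i + t = j + b then ⁅X t i, X (m - t) j⁆ else 0 := by
  have shift : ∀ f : ℕ → L, ∑ t ∈ Finset.Ioo b m, f t = ∑ t ∈ Finset.Ioo 0 a, f (t + b) := by
    intro f
    rw [← Finset.sum_image (f := f) (g := fun t => t + b) (by intro x _ y _ h; simpa using h)]
    congr 1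
    ext x
    simp only [Finset.mem_Ioo, Finset.mem_image]
    constructor
    · intro h; exact ⟨x - b, by omega, by omega⟩
    · rintro ⟨y, hy, rfl⟩; omega
  have key : ∀ t ∈ Finset.Ioo 0 a, ⁅⁅X t i, X (a - t) (i + t)⁆, X b j⁆ =
      (if i + a = j then ⁅X t i, X (m - t) (i + t)⁆ else 0)
      - (if j + b = i then ⁅X (t + b) j, X (m - (t + b)) (j + (t + b : ℕ))⁆ else 0)
      - (if i + t = j + b then ⁅X t i, X (m - t) j⁆ else 0)
      + (if i + (t + b : ℕ) = j + b then ⁅X (t + b) i, X (m - (t + b)) j⁆ else 0) := by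
    intro t ht
    have ht := Finset.mem_Ioo.1 ht
    have h1 := IH (a - t) b (i + t) j (by omega) hb (by omega)
    have h2 := IH t b i j (by omega) hb (by omega)
    have c1 : (i + t + ((a - t : ℕ) : ZMod n)) = i + a := by
      rw [Nat.cast_sub (by omega)]; ring
    have c2 : (i + ((t + b : ℕ) : ZMod n) = j + b) ↔ i + t = j := by
      push_cast; rw [← add_assoc, add_left_inj]
    have c3 : (j + (b : ZMod n) = i + t) ↔ i + t = j + b := eq_comm
    unfold BracketRule at h1 h2
    rw [show a - t + b = m - t by omega] at h1
    rw [c1] at h1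
    rw [lie_lie, h1, h2]
    simp only [c2, c3, lie_sub, show m - (t + b) = a - t by omega]
    have e1 : ⁅X (a - t) (i + t), if i + (t : ZMod n) = j then X (t + b) i else 0⁆ =
        -if i + (t : ZMod n) = j then ⁅X (t + b) i, X (a - t) j⁆ else 0 := by
      split_ifs with h
      · rw [h, lie_skew]
      · simp
    have e2 : ⁅X (a - t) (i + t), if j + (b : ZMod n) = i then X (t + b) j else 0⁆ =
        -if j + (b : ZMod n) = i then ⁅X (t + b) j, X (a - t) (j + (t + b : ℕ))⁆ else 0 := by
      split_ifs with h
      · rw [lie_skew, ← h]; push_cast; congr 2; ring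
      · simp
    have e3 : ∀ (p : Prop) [Decidable p] (x y : L), ⁅x, if p then y else 0⁆ =
        if p then ⁅x, y⁆ else 0 := by
      intro p _ x y; split_ifs <;> simp
    rw [e1, e2, e3, e3]
    abel
  rw [shift, shift, ← smul_lie, affC_smul_rootVec e hn, sum_lie, Finset.sum_congr rfl key]
  by_cases A1 : i + a = j <;> by_cases A2 : j + b = i <;>
    simp [A1, A2, Finset.sum_add_distrib, Finset.sum_sub_distrib, - lie_skew]

lemma sum_Ioo_split {M : Type*} [AddCommMonoid M] (f : ℕ → M) {a m : ℕ} (ha : 1 ≤ a)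
    (hm : a < m) : ∑ t ∈ Finset.Ioo 0 m, f t =
      ∑ t ∈ Finset.Ioo 0 a, f t + f a + ∑ t ∈ Finset.Ioo a m, f t := by
  have : Finset.Ioo 0 m = (insert a (Finset.Ioo 0 a)) ∪ Finset.Ioo a m := by
    ext x; simp only [Finset.mem_Ioo, Finset.mem_union, Finset.mem_insert]; omega
  rw [this, Finset.sum_union, Finset.sum_insert (by simp), add_comm (f a)]
  rw [Finset.disjoint_left]
  intro x; simp only [Finset.mem_Ioo, Finset.mem_insert]; omega

lemma sum_Ioo_reflect {M : Type*} [AddCommMonoid M] (f : ℕ → M) {a b m : ℕ} (hm : a + b = m) :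
    ∑ t ∈ Finset.Ioo 0 b, f t = ∑ t ∈ Finset.Ioo a m, f (m - t) := by
  refine Finset.sum_bij' (fun t _ => m - t) (fun t _ => m - t) ?_ ?_ ?_ ?_ ?_ <;>
    simp only [Finset.mem_Ioo] <;> intro t ht
  · omega
  · omega
  · omega
  · omega
  · rw [show m - (m - t) = t by omega]

lemma sum_Ioo_reflect' {M : Type*} [AddCommMonoid M] (f : ℕ → M) {a b m : ℕ} (hm : a + b = m) :
    ∑ t ∈ Finset.Ioo a m, f t = ∑ t ∈ Finset.Ioo 0 b, f (m - t) := by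
  rw [sum_Ioo_reflect _ hm]
  refine Finset.sum_congr rfl fun t ht => ?_
  have := Finset.mem_Ioo.1 ht
  rw [show m - (m - t) = t by omega]

lemma bracket_identity (hn : 2 ≤ n) {m a b : ℕ} (ha : 1 ≤ a) (hb : 1 ≤ b) (hm : a + b = m)
    (i j : ZMod n)
    (IH : ∀ a' b' i' j', 1 ≤ a' → 1 ≤ b' → a' + b' < m → BracketRule e a' b' i' j') :
    ((affC n a : ℕ) + (affC n b : ℕ) + (if i + a = j then 1 else 0) + (if j + b = i then 1 else 0)
      - (if i + a = j + b then 1 else 0) - (if i = j then 1 else 0) : ℚ) • ⁅X a i, X b j⁆ =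
      (if i + a = j then ((affC n m : ℕ) : ℚ) • X m i else 0)
      - (if j + b = i then ((affC n m : ℕ) : ℚ) • X m j else 0) := by
  have h1 := half_bracket_identity hn hb hm i j IH
  have h2 := half_bracket_identity hn ha (show b + a = m by omega) j i IH
  have hS : ∀ i, ((affC n m : ℕ) : ℚ) • X m i = ∑ t ∈ Finset.Ioo 0 m, ⁅X t i, X (m - t) (i + t)⁆ :=
    affC_smul_rootVec e hn m
  have hSa := fun i => sum_Ioo_split (fun t => ⁅X t i, X (m - t) (i + (t : ZMod n))⁆) ha
    (m := m) (by omega)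
  have hSb := fun i => sum_Ioo_split (fun t => ⁅X t i, X (m - t) (i + (t : ZMod n))⁆) hb
    (m := m) (by omega)
  have hg : ∀ t, t ≤ m → (if j + ((m - t : ℕ) : ZMod n) = i + a then
      ⁅X (m - t) j, X (m - (m - t)) i⁆ else 0) =
      - (if i + t = j + b then ⁅X t i, X (m - t) j⁆ else 0) := by
    intro t ht
    have : (j + ((m - t : ℕ) : ZMod n) = i + a) ↔ i + t = j + b := by
      rw [Nat.cast_sub ht, ← hm]; push_cast
      constructor <;> intro h <;> linear_combination -h
    simp only [this, show m - (m - t) = t by omega]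
    split_ifs
    · rw [lie_skew]
    · simp
  have hA : ∑ t ∈ Finset.Ioo 0 b, (if j + t = i + (a : ZMod n) then ⁅X t j, X (m - t) i⁆ else 0) =
      - ∑ t ∈ Finset.Ioo a m, if i + t = j + (b : ZMod n) then ⁅X t i, X (m - t) j⁆ else 0 := by
    rw [sum_Ioo_reflect _ hm, ← Finset.sum_neg_distrib]
    exact Finset.sum_congr rfl fun t ht => hg t (Finset.mem_Ioo.1 ht).2.le
  have hB : ∑ t ∈ Finset.Ioo a m, (if j + t = i + (a : ZMod n) then ⁅X t j, X (m - t) i⁆ else 0) =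
      - ∑ t ∈ Finset.Ioo 0 b, if i + t = j + (b : ZMod n) then ⁅X t i, X (m - t) j⁆ else 0 := by
    rw [sum_Ioo_reflect' _ hm, ← Finset.sum_neg_distrib]
    refine Finset.sum_congr rfl fun t ht => hg t ?_
    have := Finset.mem_Ioo.1 ht
    omega
  have hga := sum_Ioo_split (fun t => if i + t = j + (b : ZMod n) then ⁅X t i, X (m - t) j⁆ else 0)
    ha (m := m) (by omega)
  have hgb := sum_Ioo_split (fun t => if i + t = j + (b : ZMod n) then ⁅X t i, X (m - t) j⁆ else 0)
    hb (m := m) (by omega)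
  rw [hga] at hgb
  rw [hA, hB, ← lie_skew] at h2
  have hSa := (hS i).trans (hSa i)
  have hSb := (hS j).trans (hSb j)
  generalize ∑ t ∈ Finset.Ioo 0 a, (if i + t = j + (b : ZMod n) then ⁅X t i, X (m - t) j⁆ else 0)
    = g1 at *
  generalize ∑ t ∈ Finset.Ioo a m, (if i + t = j + (b : ZMod n) then ⁅X t i, X (m - t) j⁆ else 0)
    = g2 at *
  generalize ∑ t ∈ Finset.Ioo 0 b, (if i + t = j + (b : ZMod n) then ⁅X t i, X (m - t) j⁆ else 0)
    = g3 at *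
  generalize ∑ t ∈ Finset.Ioo b m, (if i + t = j + (b : ZMod n) then ⁅X t i, X (m - t) j⁆ else 0)
    = g4 at *
  generalize ∑ t ∈ Finset.Ioo 0 a, ⁅X t i, X (m - t) (i + (t : ZMod n))⁆ = s1 at *
  generalize ∑ t ∈ Finset.Ioo a m, ⁅X t i, X (m - t) (i + (t : ZMod n))⁆ = s2 at *
  generalize ∑ t ∈ Finset.Ioo 0 b, ⁅X t j, X (m - t) (j + (t : ZMod n))⁆ = s3 at *
  generalize ∑ t ∈ Finset.Ioo b m, ⁅X t j, X (m - t) (j + (t : ZMod n))⁆ = s4 at *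
  rw [show m - a = b by omega] at hSa hgb
  rw [show m - b = a by omega] at hSb hgb
  have hij : (if i + (b : ZMod n) = j + b then ⁅X b i, X a j⁆ else 0) =
      -(if i = j then ⁅X a i, X b j⁆ else 0) := by
    simp only [add_left_inj]
    split_ifs with h
    · rw [h, lie_skew]
    · simp
  rw [hij] at hgb
  have hSa' : (if i + (a : ZMod n) = j then ((affC n m : ℕ) : ℚ) • X m i else 0) =
      if i + (a : ZMod n) = j then s1 + ⁅X a i, X b j⁆ + s2 else 0 := by
    split_ifs with h
    · rw [hSa, h]
    · rfl
  have hSb' : (if j + (b : ZMod n) = i then ((affC n m : ℕ) : ℚ) • X m j else 0) =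
      if j + (b : ZMod n) = i then s3 - ⁅X a i, X b j⁆ + s4 else 0 := by
    split_ifs with h
    · rw [hSb, h, ← lie_skew, sub_eq_add_neg]
    · rfl
  rw [hSa', hSb']
  split_ifs at * <;> linear_combination (norm := module) h1 - h2 - hgb

lemma affC_cast (n : ℕ) {m : ℕ} (hm : 1 ≤ m) :
    ((affC n m : ℕ) : ℚ) = m - 1 + if n ∣ m then 1 else 0 := by
  have := affC_eq (n := n) hm
  exact_mod_cast this

lemma rootVec_two_of_three_le (hn : 3 ≤ n) (i : ZMod n) : X 2 i = ⁅e i, e (i + 1)⁆ := by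
  have : affC n 2 = 1 := by
    unfold affC; rw [if_neg]; intro h; have := Nat.le_of_dvd two_pos h; omega
  rw [rootVec_of_ne_one e (by norm_num), this, show Finset.Ioo 0 2 = {1} from rfl]
  simp [rootVec_one]

lemma rootVec_two_of_two (hn : n = 2) (i : ZMod n) : X 2 i = (2 : ℚ)⁻¹ • ⁅e i, e (i + 1)⁆ := by
  have : affC n 2 = 2 := by
    unfold affC; rw [if_pos]; rw [hn]
  rw [rootVec_of_ne_one e (by norm_num), this, show Finset.Ioo 0 2 = {1} from rfl]
  simp [rootVec_one]

lemma rootVec_three_of_two (hn : n = 2) (i : ZMod n) :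
    X 3 i = -((2 : ℚ)⁻¹ • ⁅e i, ⁅e i, e (i + 1)⁆⁆) := by
  subst hn
  have : affC 2 3 = 2 := by decide
  have h2 : ∀ i : ZMod 2, i + 1 + 1 = i ∧ i + 2 = i := by decide
  rw [rootVec_of_ne_one e (by norm_num), this, show Finset.Ioo 0 3 = {1, 2} from rfl]
  simp only [Finset.sum_pair (show (1 : ℕ) ≠ 2 by norm_num), rootVec_one, Nat.cast_one,
    rootVec_two_of_two rfl, h2, show 3 - 1 = 2 from rfl, show 3 - 2 = 1 from rfl, Nat.cast_ofNat,
    lie_smul, smul_lie]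
  rw [← lie_skew ⁅e i, e (i + 1)⁆ (e i), ← lie_skew (e (i + 1)) (e i), lie_neg]
  module

lemma bracketRule_of_serre (hn : 2 ≤ n) (hs : ClassicalSerre e) (m : ℕ) :
    ∀ a b i j, 1 ≤ a → 1 ≤ b → a + b = m → BracketRule e a b i j := by
  induction m using Nat.strong_induction_on with
  | _ m IH =>
  intro a b i j ha hb hm
  have key := bracket_identity (e := e) hn ha hb hm i j
    (fun a' b' i' j' ha hb h => IH _ h a' b' i' j' ha hb rfl)
  have hd : ∀ a : ℕ, n ∣ a ↔ (a : ZMod n) = 0 := fun a => (ZMod.natCast_eq_zero_iff a n).symm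
  have hc : ((affC n m : ℕ) : ℚ) ≠ 0 := by exact_mod_cast affC_ne_zero (n := n) (by omega)
  have cancel : ∀ x y : L, ((affC n m : ℕ) : ℚ) • x = ((affC n m : ℕ) : ℚ) • y → x = y :=
    fun x y h => smul_right_injective L hc h
  have hmc : (m : ℚ) = a + b := by rw [← hm]; push_cast; ring
  have hmz : (m : ZMod n) = a + b := by rw [← hm]; push_cast; ring
  unfold BracketRule
  rw [hm]
  rw [affC_cast n ha, affC_cast n hb] at key
  by_cases A1 : i + a = j <;> by_cases A2 : j + b = i
  · have e0 : (a : ZMod n) + b = 0 := by linear_combination A1 + A2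
    have e1 : (i + (a : ZMod n) = j + b) ↔ n ∣ b := by
      rw [hd]; constructor <;> intro h
      · linear_combination A1 - h
      · linear_combination A1 - h
    have e2 : i = j ↔ n ∣ a := by
      rw [hd]; constructor <;> intro h
      · linear_combination A1 - h
      · linear_combination A1 - h
    have e3 : n ∣ m := by rw [hd, hmz, e0]
    apply cancel
    simp only [e1, e2] at key
    simp only [A1, A2, if_true] at key ⊢
    rw [smul_sub, ← key]
    simp only [affC_cast n (show 1 ≤ m by omega), if_pos e3, hmc]
    congr 1; ring
  · have e1 : (i + (a : ZMod n) = j + b) ↔ n ∣ b := by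
      rw [hd]; constructor <;> intro h <;> linear_combination A1 - h
    have e2 : i = j ↔ n ∣ a := by
      rw [hd]; constructor <;> intro h <;> linear_combination A1 - h
    have e3 : ¬ n ∣ m := by
      rw [hd, hmz]; intro h; exact A2 (by linear_combination h - A1)
    apply cancel
    simp only [e1, e2] at key
    simp only [A1, A2, if_true, if_false, sub_zero] at key ⊢
    rw [← key]
    simp only [affC_cast n (show 1 ≤ m by omega), if_neg e3, hmc]
    congr 1; ring
  · have e1 : (i + (a : ZMod n) = j + b) ↔ n ∣ a := by
      rw [hd]; constructor <;> intro h
      · linear_combination h + A2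
      · linear_combination h - A2
    have e2 : i = j ↔ n ∣ b := by
      rw [hd]; constructor <;> intro h
      · linear_combination h + A2
      · linear_combination h - A2
    have e3 : ¬ n ∣ m := by
      rw [hd, hmz]; intro h; exact A1 (by linear_combination h - A2)
    apply cancel
    simp only [e1, e2] at key
    simp only [A1, A2, if_true, if_false, zero_sub] at key ⊢
    rw [smul_neg, ← key]
    simp only [affC_cast n (show 1 ≤ m by omega), if_neg e3, hmc]
    congr 1; ring
  · simp only [A1, A2, if_false, sub_zero] at key ⊢
    by_cases hκ : (m : ℤ) - 2 + (if n ∣ a then 1 else 0) + (if n ∣ b then 1 else 0)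
      - (if i + a = j + b then 1 else 0) - (if i = j then 1 else 0) = 0
    · clear key
      have excl : i = j → ¬ n ∣ a ∧ ¬ n ∣ b := by
        rintro rfl
        rw [hd, hd]
        exact ⟨fun h => A1 (by rw [h, add_zero]), fun h => A2 (by rw [h, add_zero])⟩
      have h0 : ∀ t : ℕ, 1 ≤ t → (t : ZMod n) = 0 → n ≤ t := fun t h1 h2 =>
        Nat.le_of_dvd h1 ((hd t).2 h2)
      by_cases hij : i = j
      · obtain ⟨ea, eb⟩ := excl hij
        rw [if_neg ea, if_neg eb, if_pos hij] at hκ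
        subst hij
        rcases eq_or_ne a b with rfl | hab
        · exact lie_self _
        have : (m = 3 ∧ ¬ (i + (a : ZMod n) = i + b)) ∨ (m = 4 ∧ i + (a : ZMod n) = i + b) := by
          split_ifs at hκ with h
          · exact Or.inr ⟨by omega, h⟩
          · exact Or.inl ⟨by omega, h⟩
        rcases this with ⟨hm3, h⟩ | ⟨hm4, h⟩
        · have hn3 : 3 ≤ n := by
            by_contra hlt
            have hn2 : n = 2 := by omega
            have : n ∣ a ∨ n ∣ b := by rw [hn2]; omega
            tauto
          have hz : ⁅X 1 i, X 2 i⁆ = 0 := by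
            rw [rootVec_two_of_three_le hn3, rootVec_one, hs.quad_right hn3]
          obtain ⟨rfl, rfl⟩ | ⟨rfl, rfl⟩ : (a = 1 ∧ b = 2) ∨ (a = 2 ∧ b = 1) := by omega
          · exact hz
          · rw [← lie_skew, hz, neg_zero]
        · have hn2 : n = 2 := by
            have h2 : ((2 : ℕ) : ZMod n) = 0 := by
              have h := add_left_cancel h
              obtain ⟨rfl, rfl⟩ | ⟨rfl, rfl⟩ : (a = 1 ∧ b = 3) ∨ (a = 3 ∧ b = 1) := by omega
              · push_cast at h ⊢; linear_combination -h
              · push_cast at h ⊢; linear_combination h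
            have := h0 2 (by norm_num) h2
            omega
          have hz : ⁅X 1 i, X 3 i⁆ = 0 := by
            rw [rootVec_three_of_two hn2, rootVec_one, lie_neg, lie_smul, hs.cubic hn2, smul_zero,
              neg_zero]
          obtain ⟨rfl, rfl⟩ | ⟨rfl, rfl⟩ : (a = 1 ∧ b = 3) ∨ (a = 3 ∧ b = 1) := by omega
          · exact hz
          · rw [← lie_skew, hz, neg_zero]
      · rw [if_neg hij] at hκ
        have hm23 : m = 2 ∨ (m = 3 ∧ i + (a : ZMod n) = j + b) := by
          split_ifs at hκ <;> first | exact Or.inl (by omega) | exact Or.inr ⟨by omega, by assumption⟩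
        rcases hm23 with hm2 | ⟨hm3, h⟩
        · obtain ⟨rfl, rfl⟩ : a = 1 ∧ b = 1 := by omega
          rw [rootVec_one, rootVec_one]
          exact hs.comm i j (by simpa using A1) (by simpa using A2)
        · have hab : ¬ (n ∣ a ∨ n ∣ b) := by
            rw [if_pos h] at hκ
            rintro (h | h) <;> rw [if_pos h] at hκ <;> split_ifs at hκ <;> omega
          have hn3 : 3 ≤ n := by
            by_contra hlt
            have hn2 : n = 2 := by omega
            exact hab (by rw [hn2]; omega)
          have hz : ∀ i, ⁅X 1 (i + 1), X 2 i⁆ = 0 := fun i => by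
            rw [rootVec_two_of_three_le hn3, rootVec_one, ← lie_skew (e i), lie_neg,
              hs.quad_left hn3, neg_zero]
          obtain ⟨rfl, rfl⟩ | ⟨rfl, rfl⟩ : (a = 1 ∧ b = 2) ∨ (a = 2 ∧ b = 1) := by omega
          · obtain rfl : i = j + 1 := by push_cast at h; linear_combination h
            exact hz j
          · obtain rfl : j = i + 1 := by push_cast at h; linear_combination -h
            rw [← lie_skew, hz, neg_zero]
    · refine (smul_eq_zero.1 key).resolve_left fun h => hκ ?_
      have : (((m : ℤ) - 2 + (if n ∣ a then 1 else 0) + (if n ∣ b then 1 else 0)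
        - (if i + a = j + b then 1 else 0) - (if i = j then 1 else 0) : ℤ) : ℚ) = 0 := by
        rw [← h]; push_cast; rw [hmc]; ring
      exact_mod_cast this

end Table

section OrderedMonomials

variable {𝕜 T ι : Type*} [Field 𝕜] [Ring T] [Algebra 𝕜 T]

/-- The monomial attached to a multiset, in an arbitrary but fixed order. -/
def ordMon (y : ι → T) (M : Multiset ι) : T := (M.toList.map y).prod

/-- The span of products of at most `k` of the elements `y`. -/
def prodFiltration (𝕜 : Type*) {T ι : Type*} [Field 𝕜] [Ring T] [Algebra 𝕜 T] (y : ι → T) (k : ℕ) :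
    Submodule 𝕜 T :=
  Submodule.span 𝕜 {x | ∃ l : List ι, l.length ≤ k ∧ x = (l.map y).prod}

lemma list_prod_mem_prodFiltration (y : ι → T) {k : ℕ} {l : List ι} (h : l.length ≤ k) :
    (l.map y).prod ∈ prodFiltration 𝕜 y k := Submodule.subset_span ⟨l, h, rfl⟩

lemma mul_mem_prodFiltration (y : ι → T) {k : ℕ} {x z : T}
    (hx : x ∈ Submodule.span 𝕜 (Set.range y)) (hz : z ∈ prodFiltration 𝕜 y k) :
    x * z ∈ prodFiltration 𝕜 y (k + 1) := by
  induction hx using Submodule.span_induction with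
  | zero => rw [zero_mul]; exact zero_mem _
  | add a b _ _ ha hb => rw [add_mul]; exact add_mem ha hb
  | smul c a _ ha => rw [smul_mul_assoc]; exact Submodule.smul_mem _ _ ha
  | mem a ha =>
    obtain ⟨i, rfl⟩ := ha
    induction hz using Submodule.span_induction with
    | zero => rw [mul_zero]; exact zero_mem _
    | add a b _ _ ha hb => rw [mul_add]; exact add_mem ha hb
    | smul c a _ ha => rw [mul_smul_comm]; exact Submodule.smul_mem _ _ ha
    | mem a ha =>
      obtain ⟨l, hl, rfl⟩ := ha
      rw [← List.prod_cons, ← List.map_cons]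
      exact list_prod_mem_prodFiltration y (by simpa using hl)

lemma perm_sub_mem_prodFiltration (y : ι → T)
    (hy : ∀ i j, y i * y j - y j * y i ∈ Submodule.span 𝕜 (Set.range y)) {l l' : List ι}
    (h : l.Perm l') :
    ∀ k, l.length ≤ k + 1 → (l.map y).prod - (l'.map y).prod ∈ prodFiltration 𝕜 y k := by
  induction h with
  | nil => intro k _; simp
  | cons x h ih =>
    intro k hk
    simp only [List.map_cons, List.prod_cons, ← mul_sub]
    rename_i l₁ l₂
    rcases l₁ with _ | ⟨z, l₁⟩
    · simp [List.nil_perm.1 h]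
    · obtain ⟨k, rfl⟩ : ∃ k', k = k' + 1 := ⟨k - 1, by simp at hk; omega⟩
      exact mul_mem_prodFiltration y (Submodule.subset_span ⟨x, rfl⟩) (ih k (by simpa using hk))
  | swap a b l =>
    intro k hk
    obtain ⟨k, rfl⟩ : ∃ k', k = k' + 1 := ⟨k - 1, by simp at hk; omega⟩
    simp only [List.map_cons, List.prod_cons, ← mul_assoc, ← sub_mul]
    exact mul_mem_prodFiltration y (hy b a)
      (list_prod_mem_prodFiltration y (by simp at hk; omega))
  | trans h₁ h₂ ih₁ ih₂ =>
    intro k hk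
    rw [← sub_add_sub_cancel]
    exact add_mem (ih₁ k hk) (ih₂ k (h₁.length_eq ▸ hk))

/-- If the span of `y` is closed under commutators then ordered monomials span all products. -/
lemma prodFiltration_le_span_ordMon (y : ι → T)
    (hy : ∀ i j, y i * y j - y j * y i ∈ Submodule.span 𝕜 (Set.range y)) (k : ℕ) :
    prodFiltration 𝕜 y k ≤ Submodule.span 𝕜 (Set.range (ordMon y)) := by
  induction k with
  | zero =>
    refine Submodule.span_le.2 ?_
    rintro _ ⟨l, hl, rfl⟩
    obtain rfl : l = [] := by simpa using hl
    exact Submodule.subset_span ⟨0, by simp [ordMon]⟩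
  | succ k ih =>
    refine Submodule.span_le.2 ?_
    rintro _ ⟨l, hl, rfl⟩
    have h1 := ih (perm_sub_mem_prodFiltration y hy
      (Multiset.coe_eq_coe.1 (Multiset.coe_toList (l : Multiset ι)).symm) k hl)
    have h2 : ordMon y (l : Multiset ι) ∈ Submodule.span 𝕜 (Set.range (ordMon y)) :=
      Submodule.subset_span ⟨_, rfl⟩
    have := add_mem h1 h2
    rwa [ordMon, sub_add_cancel] at this

lemma prod_mem_span_ordMon {κ : Type*} (y : ι → T)
    (hy : ∀ i j, y i * y j - y j * y i ∈ Submodule.span 𝕜 (Set.range y)) (e : κ → T)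
    (he : ∀ i, e i ∈ Submodule.span 𝕜 (Set.range y)) (w : List κ) :
    (w.map e).prod ∈ Submodule.span 𝕜 (Set.range (ordMon y)) := by
  suffices (w.map e).prod ∈ prodFiltration 𝕜 y w.length from
    prodFiltration_le_span_ordMon y hy _ this
  induction w with
  | nil => exact list_prod_mem_prodFiltration y (l := []) (by simp)
  | cons i w ih =>
    simp only [List.map_cons, List.prod_cons, List.length_cons]
    exact mul_mem_prodFiltration y (he i) ih

end OrderedMonomials

/-- Indices of the PBW root vectors: residue and positive height, where the residue zero is left
out in heights divisible by `n`. -/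
def RootIdx (n : ℕ) : Type := {p : ZMod n × ℕ // 0 < p.2 ∧ (n ∣ p.2 → p.1 ≠ 0)}

/-- The PBW root vectors. -/
def pbwVec (𝕜 : Type*) [Field 𝕜] {n : ℕ} {L : Type*} [LieRing L] [Module 𝕜 L]
    (e : ZMod n → L) (p : RootIdx n) : L :=
  rootVec 𝕜 e p.1.2 p.1.1 - if n ∣ p.1.2 then rootVec 𝕜 e p.1.2 0 else 0

section PbwVec

variable {n : ℕ} {L : Type*} [LieRing L] [LieAlgebra ℚ L] {e : ZMod n → L}

lemma sum_rootVec_eq_zero [NeZero n] (hn : 2 ≤ n) {m : ℕ} (hm : 0 < m) (h : n ∣ m) :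
    ∑ i, rootVec ℚ e m i = 0 := by
  have hc : ((affC n m : ℕ) : ℚ) ≠ 0 := by
    exact_mod_cast affC_ne_zero (n := n) (hn.trans (Nat.le_of_dvd hm h))
  refine smul_right_injective L hc ?_
  simp only [smul_zero, Finset.smul_sum, affC_smul_rootVec e hn]
  rw [Finset.sum_comm]
  set s := ∑ t ∈ Finset.Ioo 0 m, ∑ i, ⁅rootVec ℚ e t i, rootVec ℚ e (m - t) (i + t)⁆ with hs
  have h2 : s = -s := by
    conv_lhs => rw [hs, sum_Ioo_reflect (a := 0) _ (by omega : 0 + m = m)]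
    rw [hs, ← Finset.sum_neg_distrib]
    refine Finset.sum_congr rfl fun t ht => ?_
    have ht := Finset.mem_Ioo.1 ht
    rw [← Finset.sum_neg_distrib, ← Equiv.sum_comp (Equiv.addRight (t : ZMod n))]
    refine Finset.sum_congr rfl fun i _ => ?_
    have : (i + t + ((m - t : ℕ) : ZMod n)) = i := by
      rw [Nat.cast_sub ht.2.le, (ZMod.natCast_eq_zero_iff m n).2 h]; ring
    simp only [Equiv.coe_addRight]
    rw [this, lie_skew, show m - (m - t) = t by omega]
  have h3 : (2 : ℚ) • s = 0 := by
    rw [two_smul]; nth_rw 1 [h2]; exact neg_add_cancel s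
  exact (smul_eq_zero.1 h3).resolve_left (by norm_num)

lemma rootVec_mem_span_pbwVec (hn : 2 ≤ n) {m : ℕ} (hm : 0 < m) (i : ZMod n) :
    rootVec ℚ e m i ∈ Submodule.span ℚ (Set.range (pbwVec ℚ e)) := by
  have : NeZero n := ⟨by omega⟩
  have hdiff : ∀ i, (rootVec ℚ e m i - if n ∣ m then rootVec ℚ e m 0 else 0) ∈
      Submodule.span ℚ (Set.range (pbwVec ℚ e)) := by
    intro i
    by_cases h : n ∣ m ∧ i = 0
    · rw [if_pos h.1, h.2, sub_self]; exact zero_mem _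
    · exact Submodule.subset_span ⟨⟨(i, m), hm, fun h1 h2 => h ⟨h1, h2⟩⟩, rfl⟩
  by_cases h : n ∣ m
  · simp only [if_pos h] at hdiff
    have h0 : rootVec ℚ e m 0 ∈ Submodule.span ℚ (Set.range (pbwVec ℚ e)) := by
      have h1 := Submodule.sum_mem (t := Finset.univ) _ fun i _ => hdiff i
      rw [Finset.sum_sub_distrib, sum_rootVec_eq_zero hn hm h] at h1
      have h2 := Submodule.smul_mem _ (n : ℚ)⁻¹ h1
      simp only [Finset.sum_const, Finset.card_univ, ZMod.card, zero_sub, smul_neg,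
        ← Nat.cast_smul_eq_nsmul ℚ, smul_smul] at h2
      rw [inv_mul_cancel₀ (by exact_mod_cast (by omega : n ≠ 0)), one_smul] at h2
      exact neg_mem_iff.1 h2
    simpa using add_mem (hdiff i) h0
  · simpa [h] using hdiff i

lemma lie_mem_span_pbwVec (hn : 2 ≤ n) (hs : ClassicalSerre e) (p q : RootIdx n) :
    ⁅pbwVec ℚ e p, pbwVec ℚ e q⁆ ∈ Submodule.span ℚ (Set.range (pbwVec ℚ e)) := by
  have key : ∀ a b i j, 0 < a → 0 < b → ⁅rootVec ℚ e a i, rootVec ℚ e b j⁆ ∈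
      Submodule.span ℚ (Set.range (pbwVec ℚ e)) := by
    intro a b i j ha hb
    rw [bracketRule_of_serre hn hs _ a b i j ha hb rfl]
    refine sub_mem ?_ ?_ <;> split_ifs <;>
      first | exact zero_mem _ | exact rootVec_mem_span_pbwVec hn (by omega) _
  unfold pbwVec
  have hp := p.2.1
  have hq := q.2.1
  split_ifs <;> simp only [sub_lie, lie_sub, sub_zero] <;>
    repeat' first | exact key _ _ _ _ hp hq | refine sub_mem ?_ ?_

end PbwVec

attribute [local instance] LieRing.ofAssociativeRing

/-- A `ℚ`-algebra generated by elements satisfying the classical Serre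
relations is spanned by ordered monomials in the PBW root vectors. -/
lemma classical_word_mem_span {n : ℕ} (hn : 2 ≤ n) {T : Type*} [Ring T] [Algebra ℚ T]
    (e : ZMod n → T) (hs : ClassicalSerre e) (w : List (ZMod n)) :
    (w.map e).prod ∈ Submodule.span ℚ (Set.range (ordMon (pbwVec ℚ e))) := by
  refine prod_mem_span_ordMon _ (fun p q => lie_mem_span_pbwVec hn hs p q) e (fun i => ?_) w
  rw [← rootVec_one (𝕜 := ℚ) e i]
  exact rootVec_mem_span_pbwVec hn one_pos i

/-- The quantum Serre relations of cyclic type `A`, with denominators cleared. -/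
structure QuantumSerre {n : ℕ} {A : Type*} [Ring A] [Algebra Qv A] (e : ZMod n → A) : Prop where
  comm : ∀ i j, i + 1 ≠ j → j + 1 ≠ i → e i * e j = e j * e i
  quad : 3 ≤ n → ∀ i j, (i + 1 = j ∨ j + 1 = i) →
    vv • (e i * e i * e j) - (vv ^ 2 + 1) • (e i * e j * e i) + vv • (e j * e i * e i) = 0
  cubic : n = 2 → ∀ i, vv ^ 2 • (e i * e i * e i * e (i + 1))
    - (vv ^ 4 + vv ^ 2 + 1) • (e i * e i * e (i + 1) * e i)
    + (vv ^ 4 + vv ^ 2 + 1) • (e i * e (i + 1) * e i * e i)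
    - vv ^ 2 • (e (i + 1) * e i * e i * e i) = 0

section Specialization

open Polynomial

variable {n : ℕ} {A : Type*} [Ring A] [Algebra ℚ[X] A]

/-- The integral form, graded by an auxiliary variable. -/
def integralForm (e : ZMod n → A) : Subalgebra ℚ[X] A[X] :=
  Algebra.adjoin ℚ[X] (Set.range fun i => monomial 1 (e i))

/-- The ideal of the integral form generated by `X - 1`. -/
def specIdeal (e : ZMod n → A) : Ideal (integralForm e) where
  carrier := {x | ∃ y, x = (X - 1 : ℚ[X]) • y}
  add_mem' := by
    rintro _ _ ⟨a, rfl⟩ ⟨b, rfl⟩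
    exact ⟨a + b, (smul_add _ _ _).symm⟩
  zero_mem' := ⟨0, (smul_zero _).symm⟩
  smul_mem' := by
    rintro c _ ⟨a, rfl⟩
    exact ⟨c * a, by rw [smul_eq_mul, mul_smul_comm]⟩

instance (e : ZMod n → A) : (specIdeal e).IsTwoSided :=
  ⟨by rintro _ c ⟨a, rfl⟩; exact ⟨a * c, by rw [smul_mul_assoc]⟩⟩

/-- The specialization at `v = 1`. -/
abbrev Spec (e : ZMod n → A) : Type _ := integralForm e ⧸ specIdeal e

instance (e : ZMod n → A) : Algebra ℚ (Spec e) := Algebra.compHom _ (C : ℚ →+* ℚ[X])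

lemma rat_smul_spec (e : ZMod n → A) (c : ℚ) (x : Spec e) : c • x = (C c : ℚ[X]) • x := rfl

/-- `x` is a specialization of the homogeneous element `a` of degree `m`. -/
def IsSpec (e : ZMod n → A) (m : ℕ) (a : A) (x : Spec e) : Prop :=
  ∃ z : integralForm e, (z : A[X]) = monomial m a ∧ Ideal.Quotient.mkₐ ℚ[X] (specIdeal e) z = x

variable {e : ZMod n → A}

lemma mk_X_sub_one_smul (z : integralForm e) :
    Ideal.Quotient.mkₐ ℚ[X] (specIdeal e) ((X - 1 : ℚ[X]) • z) = 0 :=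
  Ideal.Quotient.eq_zero_iff_mem.2 ⟨z, rfl⟩

lemma poly_smul_spec (p : ℚ[X]) (x : Spec e) : p • x = p.eval 1 • x := by
  obtain ⟨z, rfl⟩ := Ideal.Quotient.mkₐ_surjective ℚ[X] (specIdeal e) x
  obtain ⟨q, hq⟩ : (X - C 1 : ℚ[X]) ∣ p - C (p.eval 1) := X_sub_C_dvd_sub_C_eval
  rw [rat_smul_spec, ← sub_eq_zero, ← sub_smul, hq, mul_smul, ← map_smul, ← map_smul, C_1,
    mk_X_sub_one_smul]

lemma IsSpec.zero (m : ℕ) : IsSpec e m 0 0 := ⟨0, by simp, map_zero _⟩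

lemma IsSpec.add {m : ℕ} {a b : A} {x y : Spec e} (ha : IsSpec e m a x) (hb : IsSpec e m b y) :
    IsSpec e m (a + b) (x + y) := by
  obtain ⟨z, hz, rfl⟩ := ha
  obtain ⟨w, hw, rfl⟩ := hb
  exact ⟨z + w, by simp [hz, hw], map_add _ _ _⟩

lemma IsSpec.sub {m : ℕ} {a b : A} {x y : Spec e} (ha : IsSpec e m a x) (hb : IsSpec e m b y) :
    IsSpec e m (a - b) (x - y) := by
  obtain ⟨z, hz, rfl⟩ := ha
  obtain ⟨w, hw, rfl⟩ := hb
  exact ⟨z - w, by simp [hz, hw], map_sub _ _ _⟩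

lemma IsSpec.mul {m k : ℕ} {a b : A} {x y : Spec e} (ha : IsSpec e m a x) (hb : IsSpec e k b y) :
    IsSpec e (m + k) (a * b) (x * y) := by
  obtain ⟨z, hz, rfl⟩ := ha
  obtain ⟨w, hw, rfl⟩ := hb
  exact ⟨z * w, by simp [hz, hw, monomial_mul_monomial], map_mul _ _ _⟩

lemma IsSpec.one : IsSpec e 0 1 1 := ⟨1, by simp, map_one _⟩

lemma IsSpec.gen (i : ZMod n) : IsSpec e 1 (e i)
    (Ideal.Quotient.mkₐ ℚ[X] (specIdeal e) ⟨monomial 1 (e i), Algebra.subset_adjoin ⟨i, rfl⟩⟩) :=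
  ⟨_, rfl, rfl⟩

lemma IsSpec.sum {ι : Type*} {m : ℕ} (s : Finset ι) {a : ι → A} {x : ι → Spec e}
    (h : ∀ i ∈ s, IsSpec e m (a i) (x i)) : IsSpec e m (∑ i ∈ s, a i) (∑ i ∈ s, x i) := by
  classical
  induction s using Finset.induction_on with
  | empty => simpa using IsSpec.zero m
  | insert i s hi ih =>
    rw [Finset.sum_insert hi, Finset.sum_insert hi]
    exact (h i (by simp)).add (ih fun j hj => h j (by simp [hj]))

lemma IsSpec.of_zero {m : ℕ} {x : Spec e} (h : IsSpec e m 0 x) : x = 0 := by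
  obtain ⟨z, hz, rfl⟩ := h
  obtain rfl : z = 0 := Subtype.ext (by simpa using hz)
  exact map_zero _

lemma isSpec_list_prod {ι : Type*} (h : ι → ℕ) {a : ι → A} {x : ι → Spec e}
    (hx : ∀ i, IsSpec e (h i) (a i) (x i)) (l : List ι) :
    IsSpec e (l.map h).sum (l.map a).prod (l.map x).prod := by
  induction l with
  | nil => exact IsSpec.one
  | cons i l ih => simpa using (hx i).mul ih

variable (e) in
/-- The `ℚ[X]`-span of the words of length `m`. -/
def wordSpan (m : ℕ) : Submodule ℚ[X] A :=
  Submodule.span ℚ[X] ((fun w : List (ZMod n) => (w.map e).prod) '' {w | w.length = m})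

lemma mul_mem_wordSpan {a b : ℕ} {x y : A} (hx : x ∈ wordSpan e a) (hy : y ∈ wordSpan e b) :
    x * y ∈ wordSpan e (a + b) := by
  have h := Submodule.mul_mem_mul hx hy
  rw [wordSpan, wordSpan, Submodule.span_mul_span] at h
  refine Submodule.span_mono ?_ h
  rintro _ ⟨_, ⟨w, hw, rfl⟩, _, ⟨w', hw', rfl⟩, rfl⟩
  exact ⟨w ++ w', by simp_all, by simp⟩

lemma coeff_mem_wordSpan {z : A[X]} (hz : z ∈ integralForm e) (m : ℕ) :
    z.coeff m ∈ wordSpan e m := by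
  unfold integralForm at hz
  induction hz using Algebra.adjoin_induction generalizing m with
  | mem x hx =>
    obtain ⟨i, rfl⟩ := hx
    rw [coeff_monomial]
    split_ifs with h
    · exact Submodule.subset_span ⟨[i], by simpa using h, by simp⟩
    · exact zero_mem _
  | algebraMap r =>
    rw [Polynomial.algebraMap_apply, coeff_C]
    split_ifs with h
    · rw [Algebra.algebraMap_eq_smul_one]
      exact Submodule.smul_mem _ _ (Submodule.subset_span ⟨[], by simp [h], by simp⟩)
    · exact zero_mem _
  | add x y _ _ hx hy => rw [coeff_add]; exact add_mem (hx m) (hy m)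
  | mul x y _ _ hx hy =>
    rw [coeff_mul]
    refine Submodule.sum_mem _ fun p hp => ?_
    rw [← Finset.HasAntidiagonal.mem_antidiagonal.1 hp]
    exact mul_mem_wordSpan (hx _) (hy _)

variable [Algebra Qv A] [IsScalarTower ℚ[X] Qv A]

lemma IsSpec.smul (p : ℚ[X]) {m : ℕ} {a : A} {x : Spec e} (ha : IsSpec e m a x) :
    IsSpec e m (algebraMap ℚ[X] Qv p • a) (p.eval 1 • x) := by
  obtain ⟨z, hz, rfl⟩ := ha
  refine ⟨p • z, ?_, ?_⟩
  · rw [algebraMap_smul, ← smul_monomial, ← hz]; rfl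
  · rw [map_smul, poly_smul_spec]

attribute [local instance] LieRing.ofAssociativeRing

variable (e) in
/-- The specialized generators. -/
def specGen (i : ZMod n) : Spec e :=
  Ideal.Quotient.mkₐ ℚ[X] (specIdeal e) ⟨monomial 1 (e i), Algebra.subset_adjoin ⟨i, rfl⟩⟩

lemma isSpec_rootVec (m : ℕ) (i : ZMod n) :
    IsSpec e m (rootVec Qv e m i) (rootVec ℚ (specGen e) m i) := by
  induction m using Nat.strong_induction_on generalizing i with
  | _ m IH =>
  by_cases hm : m = 1
  · subst hm; rw [rootVec_one, rootVec_one]; exact IsSpec.gen i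
  · rw [rootVec_of_ne_one _ hm, rootVec_of_ne_one _ hm]
    have h : IsSpec e m (∑ a ∈ Finset.Ioo 0 m,
        ⁅rootVec Qv e a i, rootVec Qv e (m - a) (i + (a : ZMod n))⁆) (∑ a ∈ Finset.Ioo 0 m,
        ⁅rootVec ℚ (specGen e) a i, rootVec ℚ (specGen e) (m - a) (i + (a : ZMod n))⁆) := by
      refine IsSpec.sum _ fun a ha => ?_
      have ha := Finset.mem_Ioo.1 ha
      have h1 := IH a ha.2 i
      have h2 := IH (m - a) (by omega) (i + a)
      have h12 := h1.mul h2
      have h21 := h2.mul h1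
      rw [show a + (m - a) = m by omega] at h12
      rw [show m - a + a = m by omega] at h21
      exact h12.sub h21
    have := h.smul (C ((affC n m : ℕ) : ℚ)⁻¹)
    rw [eval_C] at this
    convert this using 2
    simp

lemma isSpec_pbwVec (p : RootIdx n) :
    IsSpec e p.1.2 (pbwVec Qv e p) (pbwVec ℚ (specGen e) p) := by
  unfold pbwVec
  split_ifs
  · exact (isSpec_rootVec _ _).sub (isSpec_rootVec _ _)
  · simpa using isSpec_rootVec _ _

lemma vv_eq : vv = algebraMap ℚ[X] Qv X := (RatFunc.algebraMap_X).symm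

lemma classicalSerre_specGen (hs : QuantumSerre e) : ClassicalSerre (specGen e) := by
  have g := fun i => IsSpec.gen (e := e) i
  change ∀ i, IsSpec e 1 (e i) (specGen e i) at g
  have quad : 3 ≤ n → ∀ i j, (i + 1 = j ∨ j + 1 = i) →
      ⁅specGen e i, ⁅specGen e i, specGen e j⁆⁆ = 0 := by
    intro h3 i j hij
    have h := hs.quad h3 i j hij
    have k := ((((((g i).mul (g i)).mul (g j)).smul X).sub
      ((((g i).mul (g j)).mul (g i)).smul (X ^ 2 + 1))).add
      ((((g j).mul (g i)).mul (g i)).smul X))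
    simp only [map_add, map_pow, map_one, ← vv_eq, h] at k
    have k := k.of_zero
    simp only [Ring.lie_def, ← k, eval_X, eval_add, eval_pow, eval_one, mul_sub, sub_mul, mul_assoc]
    module
  refine ⟨fun i j h1 h2 => ?_, fun h3 i => quad h3 _ _ (Or.inl rfl),
    fun h3 i => quad h3 _ _ (Or.inr rfl), fun h2 i => ?_⟩
  · have k := ((g i).mul (g j)).sub ((g j).mul (g i))
    rw [hs.comm i j h1 h2, sub_self] at k
    exact k.of_zero
  · have h := hs.cubic h2 i
    have k := ((((((g i).mul (g i)).mul (g i)).mul (g (i + 1))).smul (X ^ 2)).sub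
      (((((g i).mul (g i)).mul (g (i + 1))).mul (g i)).smul (X ^ 4 + X ^ 2 + 1))).add
      (((((g i).mul (g (i + 1))).mul (g i)).mul (g i)).smul (X ^ 4 + X ^ 2 + 1)) |>.sub
      (((((g (i + 1)).mul (g i)).mul (g i)).mul (g i)).smul (X ^ 2))
    simp only [map_add, map_pow, map_one, ← vv_eq, h] at k
    have k := k.of_zero
    simp only [Ring.lie_def, ← k, eval_X, eval_add, eval_pow, eval_one, mul_sub, sub_mul, mul_assoc]
    module

/-- Words in elements satisfying the quantum Serre relations lie in the span of the ordered
monomials in the PBW root vectors. -/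
lemma quantum_word_mem_span_of_isScalarTower (hn : 2 ≤ n) (hs : QuantumSerre e)
    (w : List (ZMod n)) :
    (w.map e).prod ∈ Submodule.span Qv (Set.range (ordMon (pbwVec Qv e))) := by
  set N := (Submodule.span Qv (Set.range (ordMon (pbwVec Qv e)))).restrictScalars ℚ[X] with hN
  have : NeZero n := ⟨by omega⟩
  have hfg : (wordSpan e w.length).FG := by
    refine Submodule.fg_span (Set.Finite.image _ ?_)
    exact List.finite_length_eq _ _
  have hle : wordSpan e w.length ≤
      N ⊔ Ideal.span {(X - 1 : ℚ[X])} • wordSpan e w.length := by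
    refine Submodule.span_le.2 ?_
    rintro _ ⟨u, hu, rfl⟩
    have hu : u.length = w.length := hu
    have key : ∀ x ∈ Submodule.span ℚ (Set.range (ordMon (pbwVec ℚ (specGen e)))),
        ∃ z : integralForm e, Ideal.Quotient.mkₐ ℚ[X] (specIdeal e) z = x ∧
          (z : A[X]).coeff w.length ∈ N := by
      intro x hx
      induction hx using Submodule.span_induction with
      | mem x hx =>
        obtain ⟨M, rfl⟩ := hx
        obtain ⟨z, hz, hzx⟩ := isSpec_list_prod _ (isSpec_pbwVec (e := e)) M.toList
        refine ⟨z, hzx, ?_⟩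
        rw [hz, coeff_monomial]
        split_ifs
        · exact Submodule.subset_span ⟨M, rfl⟩
        · exact zero_mem _
      | zero => exact ⟨0, map_zero _, by simp⟩
      | add x y _ _ hx hy =>
        obtain ⟨z, hz, hzN⟩ := hx
        obtain ⟨z', hz', hzN'⟩ := hy
        exact ⟨z + z', by rw [map_add, hz, hz'], by simpa using add_mem hzN hzN'⟩
      | smul c x _ hx =>
        obtain ⟨z, hz, hzN⟩ := hx
        exact ⟨(C c : ℚ[X]) • z, by rw [map_smul, hz, rat_smul_spec],
          Submodule.smul_mem N (C c) hzN⟩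
    obtain ⟨z, hz, hzN⟩ := key _ (classical_word_mem_span hn _ (classicalSerre_specGen hs) u)
    obtain ⟨z', hz', hzx'⟩ := isSpec_list_prod _ (fun i => IsSpec.gen (e := e) i) u
    have h0 : z' - z ∈ specIdeal e := by
      rw [← Ideal.Quotient.eq_zero_iff_mem]
      exact (map_sub (Ideal.Quotient.mkₐ ℚ[X] (specIdeal e)) z' z).trans
        (sub_eq_zero.2 (hzx'.trans hz.symm))
    obtain ⟨y, hy⟩ := h0
    have hc := congrArg (fun t : integralForm e => (t : A[X]).coeff w.length) hy
    have e1 : ((z' - z : integralForm e) : A[X]) = z' - z := rfl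
    have e2 : (((X - 1 : ℚ[X]) • y : integralForm e) : A[X]) = (X - 1 : ℚ[X]) • (y : A[X]) := rfl
    simp only [e1, e2, coeff_sub, coeff_smul] at hc
    rw [hz', coeff_monomial, if_pos (by simp [hu]), sub_eq_iff_eq_add'] at hc
    change (u.map e).prod ∈ _
    rw [hc]
    exact Submodule.add_mem_sup hzN (Submodule.smul_mem_smul
      (Ideal.mem_span_singleton_self _) (coeff_mem_wordSpan y.2 _))
  obtain ⟨r, hr, hrN⟩ := Submodule.exists_sub_one_mem_and_smul_le_of_fg_of_le_sup hfg le_rfl hle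
  have hr0 : r ≠ 0 := by
    rintro rfl
    obtain ⟨q, hq⟩ := Ideal.mem_span_singleton.1 hr
    have := congrArg (eval 1) hq
    simp at this
  have hw : r • (w.map e).prod ∈ N := hrN (Submodule.smul_mem_pointwise_smul _ _ _
    (Submodule.subset_span ⟨w, rfl, rfl⟩))
  rw [hN, Submodule.restrictScalars_mem, ← algebraMap_smul Qv r] at hw
  exact (Submodule.smul_mem_iff _ (by simpa using hr0)).1 hw

end Specialization

attribute [local instance] LieRing.ofAssociativeRing in
open Polynomial in
/-- Words in elements satisfying the quantum Serre relations lie in the span of the ordered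
monomials in the PBW root vectors. -/
lemma quantum_word_mem_span {n : ℕ} {A : Type*} [Ring A] [Algebra Qv A] {e : ZMod n → A}
    (hn : 2 ≤ n) (hs : QuantumSerre e) (w : List (ZMod n)) :
    (w.map e).prod ∈ Submodule.span Qv (Set.range (ordMon (pbwVec Qv e))) := by
  let _ : Algebra ℚ[X] A := Algebra.compHom A (algebraMap ℚ[X] Qv)
  have : IsScalarTower ℚ[X] Qv A := IsScalarTower.of_algebraMap_eq fun _ => rfl
  exact quantum_word_mem_span_of_isScalarTower hn hs w

section WordModule

open TensorProduct
open Finsupp (single mapDomain lsingle lmapDomain mapDomain_single lsingle_apply)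

variable {R S : Type*} [CommRing R]

/-- The diagonal operator on words whose eigenvalues are multiplicative in the letters. -/
def wordDiag (χ : S → R) : (List S →₀ R) →ₗ[R] (List S →₀ R) :=
  Finsupp.lsum R fun w => (w.map χ).prod • lsingle w

/-- A twisted derivation on words, on basis vectors. -/
def wordOpFun (g : S → Option S) (α β : S → R) : List S → (List S →₀ R)
  | [] => 0
  | s :: w => ((g s).elim 0 fun t => single (t :: w) (w.map α).prod) +
    β s • mapDomain (List.cons s) (wordOpFun g α β w)

lemma wordOpFun_cons (g : S → Option S) (α β : S → R) (s : S) (w : List S) :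
    wordOpFun g α β (s :: w) = ((g s).elim 0 fun t => single (t :: w) (w.map α).prod) +
      β s • mapDomain (List.cons s) (wordOpFun g α β w) := rfl

/-- The twisted derivation on words acting on letters by the partial map `g`, with twist `α` on
the letters to the right and `β` on the letters to the left. -/
def wordOp (g : S → Option S) (α β : S → R) : (List S →₀ R) →ₗ[R] (List S →₀ R) :=
  Finsupp.linearCombination R (wordOpFun g α β)

/-- The linear operator on letters attached to a partial map. -/
def letterOp (R : Type*) {S : Type*} [CommRing R] (g : S → Option S) : (S →₀ R) →ₗ[R] (S →₀ R) :=
  Finsupp.linearCombination R fun s => (g s).elim 0 fun t => single t 1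

/-- The diagonal operator on letters. -/
def letterDiag (χ : S → R) : (S →₀ R) →ₗ[R] (S →₀ R) :=
  Finsupp.lsum R fun s => χ s • lsingle s

/-- Concatenation of a letter and a word. -/
def consMap (R S : Type*) [CommRing R] : (S →₀ R) ⊗[R] (List S →₀ R) →ₗ[R] (List S →₀ R) :=
  TensorProduct.lift (Finsupp.linearCombination R fun s => lmapDomain R R (List.cons s))

@[simp] lemma wordDiag_single (χ : S → R) (w : List S) (c : R) :
    wordDiag χ (single w c) = single w ((w.map χ).prod * c) := by
  simp [wordDiag]

@[simp] lemma letterDiag_single (χ : S → R) (s : S) (c : R) :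
    letterDiag χ (single s c) = single s (χ s * c) := by
  simp [letterDiag]

lemma letterOp_single (g : S → Option S) (s : S) :
    letterOp R g (single s 1) = (g s).elim 0 fun t => single t 1 := by
  simp [letterOp]

@[simp] lemma wordOp_single (g : S → Option S) (α β : S → R) (w : List S) :
    wordOp g α β (single w 1) = wordOpFun g α β w := by
  simp [wordOp]

@[simp] lemma consMap_tmul_single (s : S) (x : List S →₀ R) :
    consMap R S (single s 1 ⊗ₜ x) = mapDomain (List.cons s) x := by
  simp [consMap]

/-- Two operators on words agree if they agree on the empty word and, inductively, on all words. -/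
lemma word_linearMap_ext {M : Type*} [AddCommGroup M] [Module R M]
    {f g : (List S →₀ R) →ₗ[R] M} (h : ∀ w, f (single w 1) = g (single w 1)) : f = g := by
  refine Finsupp.lhom_ext' fun w => LinearMap.ext_ring ?_
  simpa using h w

lemma consMap_single_tmul_single (s : S) (w : List S) :
    consMap R S ((single s 1 : S →₀ R) ⊗ₜ[R] (single w 1 : List S →₀ R)) =
      single (s :: w) 1 := by
  rw [consMap_tmul_single, mapDomain_single]

lemma letter_tmul_word_ext {M : Type*} [AddCommGroup M] [Module R M]
    {f g : (S →₀ R) ⊗[R] (List S →₀ R) →ₗ[R] M}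
    (h : ∀ s w, f ((single s 1 : S →₀ R) ⊗ₜ[R] (single w 1 : List S →₀ R)) =
      g ((single s 1 : S →₀ R) ⊗ₜ[R] (single w 1 : List S →₀ R))) : f = g :=
  TensorProduct.ext (Finsupp.lhom_ext' fun s => LinearMap.ext_ring
    (word_linearMap_ext fun w => h s w))

lemma wordOp_consMap (g : S → Option S) (α β : S → R) :
    wordOp g α β ∘ₗ consMap R S = consMap R S ∘ₗ
      (TensorProduct.map (letterOp R g) (wordDiag α) +
        TensorProduct.map (letterDiag β) (wordOp g α β)) := by
  refine letter_tmul_word_ext fun s w => ?_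
  have h2 : (single s (β s) : S →₀ R) = β s • single s 1 := by simp
  simp only [LinearMap.comp_apply, wordOp_single, LinearMap.add_apply,
    TensorProduct.map_tmul, letterOp_single, wordDiag_single, letterDiag_single, mul_one, h2,
    ← TensorProduct.smul_tmul', map_add, map_smul, consMap_tmul_single]
  rw [mapDomain_single, wordOp_single, wordOpFun_cons]
  cases g s with
  | none => simp
  | some t => simp [mapDomain_single]

lemma wordDiag_consMap (χ : S → R) :
    wordDiag χ ∘ₗ consMap R S = consMap R S ∘ₗ
      TensorProduct.map (letterDiag χ) (wordDiag χ) := by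
  refine letter_tmul_word_ext fun s w => ?_
  have h2 : (single s (χ s) : S →₀ R) = χ s • single s 1 := by simp
  simp only [LinearMap.comp_apply, wordDiag_single,
    TensorProduct.map_tmul, letterDiag_single, mul_one, h2, ← TensorProduct.smul_tmul', map_smul,
    consMap_tmul_single]
  simp [mapDomain_single]

/-- Induction principle for operators on words. -/
lemma word_operator_eq_zero (P : Module.End R (List S →₀ R)) (h0 : P (single [] 1) = 0)
    (Q : (S →₀ R) →ₗ[R] (S →₀ R))
    (h : P ∘ₗ consMap R S = consMap R S ∘ₗ TensorProduct.map Q P) : P = 0 := by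
  refine word_linearMap_ext fun w => ?_
  induction w with
  | nil => simpa using h0
  | cons s w ih =>
    have h1 := LinearMap.congr_fun h ((single s 1 : S →₀ R) ⊗ₜ[R] (single w 1 : List S →₀ R))
    simpa [mapDomain_single, ih] using h1

end WordModule

section SkewSum

variable {K B : Type*} [Field K] [Ring B] [Algebra K B]

/-- The quadratic quantum Serre polynomial. -/
def serrePoly (q : K) (x y : B) : B := x * x * y - (q + q⁻¹) • (x * y * x) + y * x * x

lemma serrePoly_inv (q : K) (x y : B) : serrePoly q⁻¹ x y = serrePoly q x y := by
  simp [serrePoly, add_comm]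

lemma serrePoly_add {q : K} (hq : q ≠ 0) {a b a' b' : B} (h₁ : a' * a = q ^ 2 • (a * a'))
    (h₂ : a' * b = q⁻¹ • (b * a')) (h₃ : b' * a = q⁻¹ • (a * b')) :
    serrePoly q (a + a') (b + b') = serrePoly q a b + serrePoly q a' b' := by
  have t₁ : ∀ z, a' * (a * z) = q ^ 2 • (a * (a' * z)) := fun z => by
    rw [← mul_assoc, h₁, smul_mul_assoc, mul_assoc]
  have t₂ : ∀ z, a' * (b * z) = q⁻¹ • (b * (a' * z)) := fun z => by
    rw [← mul_assoc, h₂, smul_mul_assoc, mul_assoc]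
  have t₃ : ∀ z, b' * (a * z) = q⁻¹ • (a * (b' * z)) := fun z => by
    rw [← mul_assoc, h₃, smul_mul_assoc, mul_assoc]
  simp only [serrePoly, mul_add, add_mul, mul_assoc, h₁, h₂, h₃, t₁, t₂, t₃, mul_smul_comm,
    smul_add, smul_smul, smul_mul_assoc]
  match_scalars <;> field_simp <;> ring

end SkewSum

section Splitting

open TensorProduct

variable {K V W : Type*} [Field K] [AddCommGroup V] [Module K V] [AddCommGroup W] [Module K W]
  {C : V ⊗[K] W →ₗ[K] W}

/-- The operator `P` corresponds to `Q` under `C`. -/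
def SplitsAs (C : V ⊗[K] W →ₗ[K] W) (P : Module.End K W) (Q : Module.End K (V ⊗[K] W)) : Prop :=
  P ∘ₗ C = C ∘ₗ Q

namespace SplitsAs

variable {P P' : Module.End K W} {Q Q' : Module.End K (V ⊗[K] W)}

lemma mul (h : SplitsAs C P Q) (h' : SplitsAs C P' Q') : SplitsAs C (P * P') (Q * Q') := by
  unfold SplitsAs at *
  rw [Module.End.mul_eq_comp, Module.End.mul_eq_comp, LinearMap.comp_assoc, h',
    ← LinearMap.comp_assoc, h, LinearMap.comp_assoc]

lemma add (h : SplitsAs C P Q) (h' : SplitsAs C P' Q') : SplitsAs C (P + P') (Q + Q') := by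
  unfold SplitsAs at *
  rw [LinearMap.add_comp, LinearMap.comp_add, h, h']

lemma sub (h : SplitsAs C P Q) (h' : SplitsAs C P' Q') : SplitsAs C (P - P') (Q - Q') := by
  unfold SplitsAs at *
  rw [LinearMap.sub_comp, LinearMap.comp_sub, h, h']

lemma smul (c : K) (h : SplitsAs C P Q) : SplitsAs C (c • P) (c • Q) := by
  unfold SplitsAs at *
  rw [LinearMap.smul_comp, LinearMap.comp_smul, h]

lemma serrePoly (q : K) (h : SplitsAs C P Q) (h' : SplitsAs C P' Q') :
    SplitsAs C (serrePoly q P P') (serrePoly q Q Q') :=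
  (((h.mul h).mul h').sub (((h.mul h').mul h).smul _)).add ((h'.mul h).mul h)

end SplitsAs

lemma tensor_map_mul (f f' : Module.End K V) (g g' : Module.End K W) :
    (TensorProduct.map f g * TensorProduct.map f' g' : Module.End K (V ⊗[K] W)) =
      TensorProduct.map (f * f') (g * g') :=
  (TensorProduct.map_mul f f' g g').symm

lemma tensor_map_sub (f : Module.End K V) (g g' : Module.End K W) :
    (TensorProduct.map f (g - g') : Module.End K (V ⊗[K] W)) =
      TensorProduct.map f g - TensorProduct.map f g' := by
  rw [sub_eq_add_neg, TensorProduct.map_add_right, ← neg_one_smul K g',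
    TensorProduct.map_smul_right]
  module

lemma tensor_sub_map (f f' : Module.End K V) (g : Module.End K W) :
    (TensorProduct.map (f - f') g : Module.End K (V ⊗[K] W)) =
      TensorProduct.map f g - TensorProduct.map f' g := by
  rw [sub_eq_add_neg, TensorProduct.map_add_left, ← neg_one_smul K f',
    TensorProduct.map_smul_left]
  module

variable {X Y k l d : Module.End K V} {x y p s D : Module.End K W}

lemma splits_diag_comm {c : K} (hD : SplitsAs C D (TensorProduct.map d D))
    (hx : SplitsAs C x (TensorProduct.map X p + TensorProduct.map k x))
    (h₁ : d * X = c • (X * d)) (h₂ : D * p = p * D) (h₃ : d * k = k * d) :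
    SplitsAs C (D * x - c • (x * D)) (TensorProduct.map (d * k) (D * x - c • (x * D))) := by
  have := (hD.mul hx).sub ((hx.mul hD).smul c)
  convert this using 1
  simp only [mul_add, add_mul, tensor_map_mul, h₁, h₂, h₃, smul_add, TensorProduct.map_smul_left,
    tensor_map_sub, TensorProduct.map_smul_right]
  abel

lemma splits_comm
    (hx : SplitsAs C x (TensorProduct.map X p + TensorProduct.map k x))
    (hy : SplitsAs C y (TensorProduct.map Y s + TensorProduct.map l y))
    (h₁ : X * Y = Y * X) (h₂ : p * s = s * p) (h₃ : k * l = l * k)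
    (h₄ : TensorProduct.map (k * Y) (x * s) = TensorProduct.map (Y * k) (s * x))
    (h₅ : TensorProduct.map (l * X) (y * p) = TensorProduct.map (X * l) (p * y)) :
    SplitsAs C (x * y - y * x) (TensorProduct.map (k * l) (x * y - y * x)) := by
  have := (hx.mul hy).sub (hy.mul hx)
  convert this using 1
  simp only [mul_add, add_mul, tensor_map_mul, h₁, h₂, h₃, h₄, h₅, tensor_map_sub]
  abel

lemma splits_commutator {c : K} {D' : Module.End K W} {d' : Module.End K V}
    (hD : SplitsAs C D (TensorProduct.map d D)) (hD' : SplitsAs C D' (TensorProduct.map d' D'))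
    (hx : SplitsAs C x (TensorProduct.map X 1 + TensorProduct.map d x))
    (hy : SplitsAs C y (TensorProduct.map Y D' + TensorProduct.map 1 y))
    (h₁ : X * Y - Y * X = c • (d - d'))
    (h₂ : TensorProduct.map (d * Y) (x * D') = TensorProduct.map (Y * d) (D' * x)) :
    SplitsAs C (x * y - y * x - c • (D - D'))
      (TensorProduct.map d (x * y - y * x - c • (D - D'))) := by
  have := ((hx.mul hy).sub (hy.mul hx)).sub ((hD.sub hD').smul c)
  convert this using 1
  have h₃ : (TensorProduct.map (X * Y) D' : Module.End K (V ⊗[K] W)) =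
      TensorProduct.map (Y * X) D' + c • (TensorProduct.map d D' - TensorProduct.map d' D') := by
    rw [← tensor_sub_map, ← TensorProduct.map_smul_left, ← h₁, tensor_sub_map]
    abel
  simp only [mul_add, add_mul, tensor_map_mul, h₂, h₃, tensor_map_sub, mul_one, one_mul,
    TensorProduct.map_smul_right]
  module

lemma splits_serrePoly {q : K} (hq : q ≠ 0)
    (hx : SplitsAs C x (TensorProduct.map X p + TensorProduct.map k x))
    (hy : SplitsAs C y (TensorProduct.map Y s + TensorProduct.map l y))
    (hXX : X * X = 0) (hXYX : X * Y * X = 0) (hkl : k * l = l * k)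
    (h₁ : TensorProduct.map (k * X) (x * p) = q ^ 2 • TensorProduct.map (X * k) (p * x))
    (h₂ : TensorProduct.map (k * Y) (x * s) = q⁻¹ • TensorProduct.map (Y * k) (s * x))
    (h₃ : TensorProduct.map (l * X) (y * p) = q⁻¹ • TensorProduct.map (X * l) (p * y)) :
    SplitsAs C (serrePoly q x y) (TensorProduct.map (k * k * l) (serrePoly q x y)) := by
  have := SplitsAs.serrePoly q hx hy
  rw [serrePoly_add hq (by simpa only [tensor_map_mul] using h₁)
    (by simpa only [tensor_map_mul] using h₂) (by simpa only [tensor_map_mul] using h₃)] at this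
  convert this using 1
  have e₁ : k * l * k = k * k * l := by rw [mul_assoc, ← hkl, mul_assoc]
  have e₂ : l * k * k = k * k * l := by rw [← hkl, e₁]
  simp only [serrePoly, tensor_map_mul, hXX, hXYX, mul_assoc Y X X, mul_zero, zero_mul,
    TensorProduct.map_zero_left, smul_zero, sub_zero, zero_add, e₁, e₂, tensor_map_sub,
    TensorProduct.map_add_right, TensorProduct.map_smul_right]

end Splitting

section WordRelations

open TensorProduct
open Finsupp (single)

variable {K S : Type*} [Field K]

lemma splitsAs_wordOp (g : S → Option S) (α β : S → K) :
    SplitsAs (consMap K S) (wordOp g α β) (TensorProduct.map (letterOp K g) (wordDiag α) +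
        TensorProduct.map (letterDiag β) (wordOp g α β)) :=
  wordOp_consMap g α β

lemma splitsAs_wordDiag (χ : S → K) :
    SplitsAs (consMap K S) (wordDiag χ) (TensorProduct.map (letterDiag χ) (wordDiag χ)) :=
  wordDiag_consMap χ

@[simp] lemma wordOpFun_nil (g : S → Option S) (α β : S → K) : wordOpFun g α β [] = 0 := rfl

@[simp] lemma wordOp_nil (g : S → Option S) (α β : S → K) : wordOp g α β (single [] 1) = 0 := by
  rw [wordOp_single]; rfl

lemma letterDiag_mul (χ ψ : S → K) :
    (letterDiag χ * letterDiag ψ : Module.End K (S →₀ K)) = letterDiag (χ * ψ) := by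
  refine Finsupp.lhom_ext' fun s => LinearMap.ext_ring ?_
  simp only [LinearMap.comp_apply, Module.End.mul_apply, Finsupp.lsingle_apply,
    letterDiag_single, mul_one, Pi.mul_apply]

lemma wordDiag_mul (χ ψ : S → K) :
    (wordDiag χ * wordDiag ψ : Module.End K (List S →₀ K)) = wordDiag (χ * ψ) := by
  refine word_linearMap_ext fun w => ?_
  simp only [Module.End.mul_apply, wordDiag_single, mul_one, Pi.mul_def, List.prod_map_mul]

lemma wordDiag_one : (wordDiag 1 : Module.End K (List S →₀ K)) = 1 := by
  refine word_linearMap_ext fun w => ?_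
  simp [Pi.one_def]

lemma letterDiag_one : (letterDiag 1 : Module.End K (S →₀ K)) = 1 := by
  refine Finsupp.lhom_ext' fun s => LinearMap.ext_ring ?_
  simp

/-- Applying `g` multiplies the value of `χ` by `c`. -/
def Scales (χ : S → K) (g : S → Option S) (c : K) : Prop :=
  ∀ s t, g s = Option.some t → χ t = c * χ s

lemma Scales.letter {χ : S → K} {g : S → Option S} {c : K} (h : Scales χ g c) :
    (letterDiag χ * letterOp K g : Module.End K (S →₀ K)) = c • (letterOp K g * letterDiag χ) := by
  refine Finsupp.lhom_ext' fun s => LinearMap.ext_ring ?_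
  have h2 : (single s (χ s) : S →₀ K) = χ s • single s 1 := by simp
  simp only [LinearMap.comp_apply, Module.End.mul_apply, LinearMap.smul_apply,
    Finsupp.lsingle_apply, letterDiag_single, mul_one, h2, map_smul, letterOp_single]
  cases hg : g s with
  | none => simp
  | some t => simp [h s t hg]

lemma Scales.inv {χ : S → K} {g : S → Option S} {c : K} (h : Scales χ g c) : Scales χ⁻¹ g c⁻¹ :=
  fun s t hst => by simp [h s t hst, mul_comm]

lemma word_end_eq_zero {P : Module.End K (List S →₀ K)} (h0 : P (single [] 1) = 0)
    {Q : Module.End K (S →₀ K)} (h : SplitsAs (consMap K S) P (TensorProduct.map Q P)) : P = 0 :=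
  word_operator_eq_zero P h0 Q h

lemma wordDiag_comm (χ ψ : S → K) :
    (wordDiag χ * wordDiag ψ : Module.End K (List S →₀ K)) = wordDiag ψ * wordDiag χ := by
  rw [wordDiag_mul, wordDiag_mul, mul_comm]

lemma letterDiag_comm (χ ψ : S → K) :
    (letterDiag χ * letterDiag ψ : Module.End K (S →₀ K)) = letterDiag ψ * letterDiag χ := by
  rw [letterDiag_mul, letterDiag_mul, mul_comm]

lemma Scales.word {χ : S → K} {g : S → Option S} {c : K} (h : Scales χ g c) (α β : S → K) :
    (wordDiag χ * wordOp g α β : Module.End K (List S →₀ K)) =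
      c • (wordOp g α β * wordDiag χ) := by
  rw [← sub_eq_zero]
  exact word_end_eq_zero (by simp) (splits_diag_comm (splitsAs_wordDiag χ) (splitsAs_wordOp g α β)
    h.letter (wordDiag_comm _ _) (letterDiag_comm _ _))

lemma Scales.word' {χ : S → K} {g : S → Option S} {c : K} (hc : c ≠ 0) (h : Scales χ g c)
    (α β : S → K) : (wordOp g α β * wordDiag χ : Module.End K (List S →₀ K)) =
      c⁻¹ • (wordDiag χ * wordOp g α β) := by
  rw [h.word, smul_smul, inv_mul_cancel₀ hc, one_smul]

/-- The composite of two partial maps is empty. -/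
def Kills (g h : S → Option S) : Prop := ∀ s t, h s = Option.some t → g t = Option.none

lemma Kills.letter {g h : S → Option S} (H : Kills g h) :
    (letterOp K g * letterOp K h : Module.End K (S →₀ K)) = 0 := by
  refine Finsupp.lhom_ext' fun s => LinearMap.ext_ring ?_
  simp only [LinearMap.comp_apply, Module.End.mul_apply, Finsupp.lsingle_apply, letterOp_single]
  cases hg : h s with
  | none => simp
  | some t => simp [letterOp_single, H s t hg]

variable {g h : S → Option S} {α β α' β' : S → K}

lemma tensor_swap {b d : K} (hd : d ≠ 0) (h₁ : Scales β h b) (h₂ : Scales α' g d) :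
    TensorProduct.map (letterDiag β * letterOp K h : Module.End K (S →₀ K))
        (wordOp g α β * wordDiag α' : Module.End K (List S →₀ K)) =
      (b * d⁻¹) • TensorProduct.map (letterOp K h * letterDiag β : Module.End K (S →₀ K))
        (wordDiag α' * wordOp g α β : Module.End K (List S →₀ K)) := by
  rw [h₁.letter, h₂.word' hd, TensorProduct.map_smul_left, TensorProduct.map_smul_right, smul_smul]

lemma wordOp_comm {b b' : K} (hb : b ≠ 0) (hb' : b' ≠ 0) (hg : Kills g h) (hh : Kills h g)
    (h₁ : Scales β h b) (h₂ : Scales α' g b) (h₃ : Scales β' g b') (h₄ : Scales α h b') :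
    (wordOp g α β * wordOp h α' β' : Module.End K (List S →₀ K)) =
      wordOp h α' β' * wordOp g α β := by
  rw [← sub_eq_zero]
  refine word_end_eq_zero (by simp) (splits_comm (splitsAs_wordOp g α β) (splitsAs_wordOp h α' β')
    (by rw [hg.letter, hh.letter]) (wordDiag_comm _ _) (letterDiag_comm _ _) ?_ ?_)
  · have := tensor_swap (α := α) hb h₁ h₂
    rwa [mul_inv_cancel₀ hb, one_smul] at this
  · have := tensor_swap (α := α') hb' h₃ h₄
    rwa [mul_inv_cancel₀ hb', one_smul] at this

lemma wordOp_serrePoly {q b₁ d₁ b₂ d₂ b₃ d₃ : K} (hq : q ≠ 0) (hd₁ : d₁ ≠ 0) (hd₂ : d₂ ≠ 0)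
    (hd₃ : d₃ ≠ 0) (hg : Kills g g)
    (hgh : (letterOp K g * letterOp K h * letterOp K g : Module.End K (S →₀ K)) = 0)
    (h₁ : Scales β g b₁) (h₁' : Scales α g d₁) (e₁ : b₁ * d₁⁻¹ = q ^ 2)
    (h₂ : Scales β h b₂) (h₂' : Scales α' g d₂) (e₂ : b₂ * d₂⁻¹ = q⁻¹)
    (h₃ : Scales β' g b₃) (h₃' : Scales α h d₃) (e₃ : b₃ * d₃⁻¹ = q⁻¹) :
    serrePoly q (wordOp g α β : Module.End K (List S →₀ K)) (wordOp h α' β') = 0 := by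
  refine word_end_eq_zero (by simp [serrePoly]) (splits_serrePoly hq (splitsAs_wordOp g α β)
    (splitsAs_wordOp h α' β') hg.letter hgh (letterDiag_comm _ _) ?_ ?_ ?_)
  · rw [← e₁]; exact tensor_swap hd₁ h₁ h₁'
  · rw [← e₂]; exact tensor_swap hd₂ h₂ h₂'
  · rw [← e₃]; exact tensor_swap hd₃ h₃ h₃'

lemma wordOp_commutator {c b : K} {κ κ' : S → K} (hb : b ≠ 0)
    (h₁ : (letterOp K g * letterOp K h - letterOp K h * letterOp K g : Module.End K (S →₀ K)) =
      c • (letterDiag κ - letterDiag κ'))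
    (h₂ : Scales κ h b) (h₃ : Scales κ' g b) :
    (wordOp g 1 κ * wordOp h κ' 1 - wordOp h κ' 1 * wordOp g 1 κ : Module.End K (List S →₀ K)) =
      c • (wordDiag κ - wordDiag κ') := by
  rw [← sub_eq_zero]
  have hx := splitsAs_wordOp g 1 κ
  have hy := splitsAs_wordOp h κ' 1
  rw [wordDiag_one] at hx
  rw [letterDiag_one] at hy
  refine word_end_eq_zero (by simp) (splits_commutator (splitsAs_wordDiag κ) (splitsAs_wordDiag κ')
    hx hy h₁ ?_)
  have := tensor_swap (α := 1) hb h₂ h₃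
  rwa [mul_inv_cancel₀ hb, one_smul] at this

end WordRelations

section SerreSum

variable {A : Type} [Ring A] [Algebra Qv A]

/-- The alternating sum of divided powers in the quantum Serre relations. -/
def serreSum (k : ℕ) (x y : A) : A :=
  ∑ p ∈ Finset.range (k + 1), ((-1 : Qv) ^ p) • (dp x p * y * dp x (k - p))

/-- The cubic quantum Serre polynomial. -/
def cubicPoly {K B : Type*} [Field K] [Ring B] [Algebra K B] (q : K) (x y : B) : B :=
  x * x * x * y - (q ^ 2 + 1 + (q ^ 2)⁻¹) • (x * x * y * x) +
    (q ^ 2 + 1 + (q ^ 2)⁻¹) • (x * y * x * x) - y * x * x * x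

lemma map_serreSum {B : Type} [Ring B] [Algebra Qv B] (φ : A →ₐ[Qv] B) (k : ℕ) (x y : A) :
    φ (serreSum k x y) = serreSum k (φ x) (φ y) := by
  simp [serreSum, dp]

lemma vv_ne_zero : vv ≠ 0 := RatFunc.X_ne_zero

lemma vv_pow_ne_one {k : ℕ} (hk : k ≠ 0) : vv ^ k ≠ 1 := by
  intro h
  rw [vv_eq, ← map_pow, ← map_one (algebraMap (Polynomial ℚ) Qv)] at h
  have h1 := congrArg Polynomial.natDegree (RatFunc.algebraMap_injective ℚ h)
  simp at h1
  exact hk h1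

lemma vv_sub_inv_ne_zero : vv - vv⁻¹ ≠ 0 := by
  intro h
  refine vv_pow_ne_one two_ne_zero ?_
  have := vv_ne_zero
  field_simp at h
  linear_combination h

lemma qint_eq (a : ℕ) : qint a = (vv ^ a - (vv ^ a)⁻¹) / (vv - vv⁻¹) := by
  simp [qint]

lemma qfact_one : qfact 1 = 1 := by
  simp [qfact, qint, div_self vv_sub_inv_ne_zero]

lemma qfact_two : qfact 2 = vv + vv⁻¹ := by
  have h := vv_sub_inv_ne_zero
  have := vv_ne_zero
  rw [qfact, qfact_one, mul_one, qint_eq, div_eq_iff h]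
  field_simp
  ring

lemma qfact_two_ne_zero : qfact 2 ≠ 0 := by
  rw [qfact_two]
  intro h
  have h0 := vv_ne_zero
  have h1 : vv ^ 4 = 1 := by
    field_simp at h
    linear_combination (vv ^ 2 - 1) * h
  exact vv_pow_ne_one four_ne_zero h1

lemma qfact_three : qfact 3 = (vv ^ 2 + 1 + (vv ^ 2)⁻¹) * (vv + vv⁻¹) := by
  have h := vv_sub_inv_ne_zero
  have := vv_ne_zero
  rw [qfact, qfact_two, qint_eq]
  congr 1
  rw [div_eq_iff h]
  field_simp
  ring

lemma quantum_three_ne_zero : vv ^ 2 + 1 + (vv ^ 2)⁻¹ ≠ 0 := by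
  intro h
  have h0 := vv_ne_zero
  have h1 : vv ^ 6 = 1 := by
    field_simp at h
    linear_combination (vv ^ 2 - 1) * h
  exact vv_pow_ne_one (by norm_num) h1

lemma serreSum_one (x y : A) : serreSum 1 x y = y * x - x * y := by
  simp [serreSum, dp, Finset.sum_range_succ, qfact_one, show qfact 0 = 1 from rfl, sub_eq_add_neg]

lemma serreSum_two (x y : A) : serreSum 2 x y = (qfact 2)⁻¹ • serrePoly vv x y := by
  have h := qfact_two_ne_zero
  simp only [serreSum, dp, Finset.sum_range_succ, qfact_one, show qfact 0 = 1 from rfl, serrePoly,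
    Finset.sum_range_zero, ← qfact_two, smul_add, smul_sub, smul_smul, inv_mul_cancel₀ h]
  simp [mul_assoc, pow_two, qfact_one]
  abel

lemma serreSum_three (x y : A) : serreSum 3 x y = -((qfact 3)⁻¹ • cubicPoly vv x y) := by
  have h := qfact_two_ne_zero
  have h3 := quantum_three_ne_zero
  have e : (qfact 3)⁻¹ * (vv ^ 2 + 1 + (vv ^ 2)⁻¹) = (qfact 2)⁻¹ := by
    rw [qfact_three, ← qfact_two, mul_inv, mul_comm, ← mul_assoc, mul_inv_cancel₀ h3, one_mul]
  simp only [serreSum, dp, Finset.sum_range_succ, qfact_one, show qfact 0 = 1 from rfl, cubicPoly,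
    Finset.sum_range_zero, smul_add, smul_sub, smul_smul, e]
  simp [mul_assoc, pow_succ, qfact_one]
  abel

end SerreSum

section Cartan

variable {m : ℕ}

lemma ne_add_one (hm : 2 ≤ m) (i : ZMod m) : i ≠ i + 1 := by
  have : Fact (1 < m) := ⟨hm⟩
  simp

lemma add_one_ne_of_adj (hm : 3 ≤ m) {i j : ZMod m} (h : i + 1 = j) : j + 1 ≠ i := by
  rintro h'
  have h2 : (2 : ZMod m) = 0 := by
    have : i + (1 + 1) = i := by rw [← add_assoc, h, h']
    rw [← one_add_one_eq_two]; simpa using this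
  have : ((2 : ℕ) : ZMod m) = 0 := by exact_mod_cast h2
  rw [ZMod.natCast_eq_zero_iff] at this
  exact absurd (Nat.le_of_dvd (by norm_num) this) (by omega)

lemma cartan_comm (i j : ZMod m) : cartan i j = cartan j i := by
  unfold cartan
  have h1 : i = j + 1 ↔ j = i - 1 := by constructor <;> (intro h; rw [h]; ring)
  have h2 : i = j - 1 ↔ j = i + 1 := by constructor <;> (intro h; rw [h]; ring)
  simp only [h1, h2, eq_comm (a := i) (b := j)]
  ring

lemma cartan_self (hm : 2 ≤ m) (i : ZMod m) : cartan i i = 2 := by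
  have : Fact (1 < m) := ⟨hm⟩
  simp [cartan, eq_sub_iff_add_eq]

lemma cartan_adj (hm : 3 ≤ m) {i j : ZMod m} (h : i + 1 = j ∨ j + 1 = i) : cartan i j = -1 := by
  wlog h' : i + 1 = j generalizing i j
  · rw [cartan_comm]
    exact this h.symm (h.resolve_left h')
  have h1 := add_one_ne_of_adj hm h'
  have h2 := ne_add_one (by omega) i
  subst h'
  simp only [cartan, h2, Ne.symm h1, if_false, add_sub_cancel_right, if_true]
  norm_num

lemma cartan_of_not_adj {i j : ZMod m} (h : i ≠ j) (h₁ : i + 1 ≠ j) (h₂ : j + 1 ≠ i) :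
    cartan i j = 0 := by
  have h3 : i ≠ j - 1 := fun e => h₁ (by rw [e]; ring)
  simp [cartan, h, Ne.symm h₂, h3]

lemma cartan_two {i j : ZMod 2} (h : i ≠ j) : cartan i j = -2 := by
  revert i j; decide

end Cartan

section AffineWords

open Finsupp (single)

variable {m : ℕ}

/-- The letters of the level-zero vector representation. -/
abbrev Letter (m : ℕ) : Type := ZMod m × ℤ

/-- The space of words in the letters. -/
abbrev WordSpace (m : ℕ) : Type := List (Letter m) →₀ Qv

/-- The partial map on letters underlying `E i`. -/
def lower (wt : ZMod m → ℤ) (i : ZMod m) (s : Letter m) : Option (Letter m) :=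
  if s.1 = i + 1 then Option.some (i, s.2 - wt i) else Option.none

/-- The partial map on letters underlying `F i`. -/
def raise (wt : ZMod m → ℤ) (i : ZMod m) (s : Letter m) : Option (Letter m) :=
  if s.1 = i then Option.some (i + 1, s.2 + wt i) else Option.none

/-- The eigenvalue of `K i` on letters. -/
def kappa (i : ZMod m) (s : Letter m) : Qv :=
  vv ^ ((if s.1 = i then 1 else 0) - (if s.1 = i + 1 then 1 else 0) : ℤ)

/-- The action of `E i` on words. -/
def wordE (wt : ZMod m → ℤ) (i : ZMod m) : Module.End Qv (WordSpace m) :=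
  wordOp (lower wt i) 1 (kappa i)

/-- The action of `F i` on words. -/
def wordF (wt : ZMod m → ℤ) (i : ZMod m) : Module.End Qv (WordSpace m) :=
  wordOp (raise wt i) (kappa i)⁻¹ 1

lemma kappa_ne_zero (i : ZMod m) (s : Letter m) : kappa i s ≠ 0 := zpow_ne_zero _ vv_ne_zero

lemma scales_kappa_lower (wt : ZMod m → ℤ) (i j : ZMod m) :
    Scales (kappa i) (lower wt j) (vv ^ cartan i j) := by
  rintro ⟨a, k⟩ t h
  simp only [lower] at h
  split_ifs at h with ha
  obtain rfl := (Option.some.inj h).symm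
  subst ha
  rw [kappa, kappa, ← zpow_add₀ vv_ne_zero]
  congr 1
  have h1 : j = i + 1 ↔ i = j - 1 := by constructor <;> (intro h; rw [h]; ring)
  simp only [cartan, add_left_inj, h1, eq_comm (a := j) (b := i), eq_comm (a := j + 1) (b := i)]
  split_ifs <;> norm_num

lemma scales_kappa_raise (wt : ZMod m → ℤ) (i j : ZMod m) :
    Scales (kappa i) (raise wt j) (vv ^ (-cartan i j)) := by
  rintro ⟨a, k⟩ t h
  simp only [raise] at h
  split_ifs at h with ha
  obtain rfl := (Option.some.inj h).symm
  subst ha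
  rw [kappa, kappa, ← zpow_add₀ vv_ne_zero]
  congr 1
  have h1 : a = i + 1 ↔ i = a - 1 := by constructor <;> (intro h; rw [h]; ring)
  simp only [cartan, add_left_inj, h1, eq_comm (a := a) (b := i), eq_comm (a := a + 1) (b := i)]
  split_ifs <;> norm_num

lemma scales_one (g : Letter m → Option (Letter m)) : Scales (1 : Letter m → Qv) g (vv ^ (0 : ℤ)) :=
  fun s t _ => by simp

lemma kills_lower_lower (wt : ZMod m → ℤ) {i j : ZMod m} (h : j ≠ i + 1) :
    Kills (lower wt i) (lower wt j) := by
  intro s t hst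
  simp only [lower] at hst
  split_ifs at hst
  obtain rfl := (Option.some.inj hst).symm
  simp [lower, h]

lemma kills_raise_raise (wt : ZMod m → ℤ) {i j : ZMod m} (h : i ≠ j + 1) :
    Kills (raise wt i) (raise wt j) := by
  intro s t hst
  simp only [raise] at hst
  split_ifs at hst
  obtain rfl := (Option.some.inj hst).symm
  simp [raise, h.symm]

lemma kills_lower_raise (wt : ZMod m → ℤ) {i j : ZMod m} (h : i ≠ j) :
    Kills (lower wt i) (raise wt j) := by
  intro s t hst
  simp only [raise] at hst
  split_ifs at hst
  obtain rfl := (Option.some.inj hst).symm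
  simp [lower, h.symm]

lemma kills_raise_lower (wt : ZMod m → ℤ) {i j : ZMod m} (h : i ≠ j) :
    Kills (raise wt i) (lower wt j) := by
  intro s t hst
  simp only [lower] at hst
  split_ifs at hst
  obtain rfl := (Option.some.inj hst).symm
  simp [raise, h.symm]

lemma letter_commutator (hm : 2 ≤ m) (wt : ZMod m → ℤ) (i : ZMod m) :
    (letterOp Qv (lower wt i) * letterOp Qv (raise wt i) -
      letterOp Qv (raise wt i) * letterOp Qv (lower wt i) : Module.End Qv (Letter m →₀ Qv)) =
      (vv - vv⁻¹)⁻¹ • (letterDiag (kappa i) - letterDiag (kappa i)⁻¹) := by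
  have h0 := vv_sub_inv_ne_zero
  have hi := ne_add_one hm i
  refine Finsupp.lhom_ext' fun s => LinearMap.ext_ring ?_
  obtain ⟨a, k⟩ := s
  simp only [LinearMap.comp_apply, LinearMap.sub_apply, LinearMap.smul_apply,
    Module.End.mul_apply, Finsupp.lsingle_apply, letterOp_single, letterDiag_single, mul_one,
    lower, raise, Pi.inv_apply, kappa]
  by_cases h1 : a = i
  · subst h1
    simp [hi, letterOp_single, lower, ← Finsupp.single_sub, inv_mul_cancel₀ h0]
  · by_cases h2 : a = i + 1
    · subst h2
      simp only [hi.symm, if_false, if_true, Option.elim_none, map_zero, Option.elim_some,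
        letterOp_single, zero_sub, zpow_neg, zpow_one, inv_inv,
        ← Finsupp.single_sub, Finsupp.smul_single, smul_eq_mul]
      rw [← neg_sub vv vv⁻¹, mul_neg, inv_mul_cancel₀ h0, Finsupp.single_neg]
      simp [raise]
    · simp [h1, h2]

lemma word_commutator (hm : 2 ≤ m) (wt : ZMod m → ℤ) (i j : ZMod m) :
    wordE wt i * wordF wt j - wordF wt j * wordE wt i =
      if i = j then (vv - vv⁻¹)⁻¹ • ((wordDiag (kappa i) : Module.End Qv (WordSpace m)) -
        wordDiag (kappa i)⁻¹) else 0 := by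
  split_ifs with h
  · subst h
    refine wordOp_commutator (b := vv ^ (-cartan i i)) (zpow_ne_zero _ vv_ne_zero)
      (letter_commutator hm wt i) (scales_kappa_raise wt i i) ?_
    rw [zpow_neg]
    exact (scales_kappa_lower wt i i).inv
  · refine (sub_eq_zero (G := Module.End Qv (WordSpace m))).mpr ?_
    refine wordOp_comm (b := vv ^ (-cartan i j)) (b' := vv ^ (0 : ℤ)) (zpow_ne_zero _ vv_ne_zero)
      (zpow_ne_zero _ vv_ne_zero) (kills_lower_raise wt h) (kills_raise_lower wt (Ne.symm h))
      (scales_kappa_raise wt i j) ?_ (scales_one _) (scales_one _)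
    rw [zpow_neg, cartan_comm]
    exact (scales_kappa_lower wt j i).inv

lemma wordE_serre (hm : 3 ≤ m) (wt : ZMod m → ℤ) {i j : ZMod m} (h : i ≠ j) :
    serreSum (1 - cartan i j).toNat (wordE wt i) (wordE wt j) = 0 := by
  have hz := vv_ne_zero
  by_cases h1 : i + 1 = j ∨ j + 1 = i
  · rw [cartan_adj hm h1]
    refine (serreSum_two _ _).trans ?_
    rw [wordE, wordE, wordOp_serrePoly (b₁ := vv ^ (2 : ℤ)) (b₂ := vv ^ (-1 : ℤ))
      (b₃ := vv ^ (-1 : ℤ)) (d₁ := vv ^ (0 : ℤ)) (d₂ := vv ^ (0 : ℤ)) (d₃ := vv ^ (0 : ℤ)) hz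
      (zpow_ne_zero _ hz) (zpow_ne_zero _ hz) (zpow_ne_zero _ hz)
      (kills_lower_lower wt (ne_add_one (by omega) i)) ?_
      (by rw [← cartan_self (by omega) i]; exact scales_kappa_lower wt i i) (scales_one _)
      (by simp) (by rw [← cartan_adj hm h1]; exact scales_kappa_lower wt i j) (scales_one _)
      (by simp) (by rw [← cartan_adj hm h1.symm]; exact scales_kappa_lower wt j i) (scales_one _)
      (by simp), smul_zero]
    rcases h1 with h1 | h1
    · rw [mul_assoc, (kills_lower_lower wt (Ne.symm (add_one_ne_of_adj hm h1))).letter, mul_zero]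
    · rw [(kills_lower_lower wt (Ne.symm (add_one_ne_of_adj hm h1))).letter, zero_mul]
  · push Not at h1
    rw [cartan_of_not_adj h h1.1 h1.2]
    refine (serreSum_one _ _).trans ?_
    refine sub_eq_zero.mpr ?_
    refine wordOp_comm (b := vv ^ (0 : ℤ)) (b' := vv ^ (0 : ℤ)) (zpow_ne_zero _ hz)
      (zpow_ne_zero _ hz) (kills_lower_lower wt h1.2.symm) (kills_lower_lower wt h1.1.symm)
      ?_ (scales_one _) ?_ (scales_one _)
    · rw [← cartan_of_not_adj h.symm h1.2 h1.1]; exact scales_kappa_lower wt j i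
    · rw [← cartan_of_not_adj h h1.1 h1.2]; exact scales_kappa_lower wt i j

lemma wordF_serre (hm : 3 ≤ m) (wt : ZMod m → ℤ) {i j : ZMod m} (h : i ≠ j) :
    serreSum (1 - cartan i j).toNat (wordF wt i) (wordF wt j) = 0 := by
  have hz := vv_ne_zero
  have key : ∀ (i j : ZMod m) {c : ℤ}, cartan i j = c →
      Scales (kappa i)⁻¹ (raise wt j) (vv ^ c) := by
    rintro i j c rfl
    have := (scales_kappa_raise wt i j).inv
    rwa [zpow_neg, inv_inv] at this
  by_cases h1 : i + 1 = j ∨ j + 1 = i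
  · rw [cartan_adj hm h1]
    refine (serreSum_two _ _).trans ?_
    rw [← serrePoly_inv, wordF, wordF, wordOp_serrePoly (d₁ := vv ^ (2 : ℤ)) (d₂ := vv ^ (-1 : ℤ))
      (d₃ := vv ^ (-1 : ℤ)) (b₁ := vv ^ (0 : ℤ)) (b₂ := vv ^ (0 : ℤ)) (b₃ := vv ^ (0 : ℤ))
      (inv_ne_zero hz) (zpow_ne_zero _ hz) (zpow_ne_zero _ hz) (zpow_ne_zero _ hz)
      (kills_raise_raise wt (ne_add_one (by omega) i)) ?_
      (scales_one _) (key i i (cartan_self (by omega) i)) (by simp) 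
      (scales_one _) (key j i (cartan_adj hm h1.symm)) (by simp)
      (scales_one _) (key i j (cartan_adj hm h1)) (by simp), smul_zero]
    rcases h1 with h1 | h1
    · rw [(kills_raise_raise wt (Ne.symm (add_one_ne_of_adj hm h1))).letter, zero_mul]
    · rw [mul_assoc, (kills_raise_raise wt (Ne.symm (add_one_ne_of_adj hm h1))).letter, mul_zero]
  · push Not at h1
    rw [cartan_of_not_adj h h1.1 h1.2]
    refine (serreSum_one _ _).trans ?_
    refine sub_eq_zero.mpr ?_
    exact wordOp_comm (b := vv ^ (0 : ℤ)) (b' := vv ^ (0 : ℤ)) (zpow_ne_zero _ hz)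
      (zpow_ne_zero _ hz) (kills_raise_raise wt h1.1.symm) (kills_raise_raise wt h1.2.symm)
      (scales_one _) (key i j (cartan_of_not_adj h h1.1 h1.2)) (scales_one _)
      (key j i (cartan_of_not_adj h.symm h1.2 h1.1))

/-- The images of the generators under the word representation. -/
def wordGen (wt : ZMod m → ℤ) : Gen m → Module.End Qv (WordSpace m)
  | .E i => wordE wt i
  | .F i => wordF wt i
  | .K i => wordDiag (kappa i)
  | .Kinv i => wordDiag (kappa i)⁻¹

lemma wordGen_rel (hm : 3 ≤ m) (wt : ZMod m → ℤ) ⦃x y : FA m⦄ (h : URel m x y) :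
    FreeAlgebra.lift Qv (wordGen wt) x = FreeAlgebra.lift Qv (wordGen wt) y := by
  have hcancel : ∀ i : ZMod m, (kappa i * (kappa i)⁻¹ : Letter m → Qv) = 1 := fun i =>
    funext fun s => mul_inv_cancel₀ (kappa_ne_zero i s)
  induction h with
  | KK i j => simp [fK, wordGen, wordDiag_comm]
  | KKinv i => simp [fK, fKinv, wordGen, wordDiag_mul, hcancel, wordDiag_one]
  | KinvK i => simp [fK, fKinv, wordGen, wordDiag_mul, mul_comm _ (kappa i), hcancel, wordDiag_one]
  | KE i j => simpa [fK, fE, wordGen, wordE] using (scales_kappa_lower wt i j).word _ _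
  | KF i j => simpa [fK, fF, wordGen, wordF] using (scales_kappa_raise wt i j).word _ _
  | EF i j =>
    rw [apply_ite (FreeAlgebra.lift Qv (wordGen wt))]
    simpa [fE, fF, fK, fKinv, wordGen] using word_commutator (by omega) wt i j
  | serreE i j h =>
    refine (map_serreSum (FreeAlgebra.lift Qv (wordGen wt)) _ _ _).trans ?_
    simpa [fE, wordGen] using wordE_serre hm wt h
  | serreF i j h =>
    refine (map_serreSum (FreeAlgebra.lift Qv (wordGen wt)) _ _ _).trans ?_
    simpa [fF, wordGen] using wordF_serre hm wt h

/-- The word representation of the quantum affine algebra. -/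
def wordRep (hm : 3 ≤ m) (wt : ZMod m → ℤ) : U m →ₐ[Qv] Module.End Qv (WordSpace m) :=
  RingQuot.liftAlgHom Qv ⟨FreeAlgebra.lift Qv (wordGen wt), wordGen_rel hm wt⟩

end AffineWords

section Relabel

open Finsupp (single mapDomain mapDomain_single)

variable {K S T : Type*} [Field K] {σ : S → T}

/-- Relabelling of letters in words. -/
def reletter (K : Type*) [Field K] (σ : S → T) : (List S →₀ K) →ₗ[K] (List T →₀ K) :=
  Finsupp.lmapDomain K K (List.map σ)

@[simp] lemma reletter_single (w : List S) (c : K) :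
    reletter K σ (single w c) = single (w.map σ) c := by
  simp [reletter, mapDomain_single]

lemma reletter_injective (hσ : Function.Injective σ) : Function.Injective (reletter K σ) :=
  Finsupp.mapDomain_injective (List.map_injective_iff.mpr hσ)

lemma reletter_mapDomain_cons (s : S) (x : List S →₀ K) :
    reletter K σ (mapDomain (List.cons s) x) = mapDomain (List.cons (σ s)) (reletter K σ x) := by
  simp only [reletter, Finsupp.lmapDomain_apply, ← Finsupp.mapDomain_comp]
  congr 1

lemma wordOp_mapDomain_cons (g : S → Option S) (α β : S → K) (s : S) (hg : g s = Option.none)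
    (x : List S →₀ K) : wordOp g α β (mapDomain (List.cons s) x) =
      β s • mapDomain (List.cons s) (wordOp g α β x) := by
  have : wordOp g α β ∘ₗ Finsupp.lmapDomain K K (List.cons s) =
      β s • Finsupp.lmapDomain K K (List.cons s) ∘ₗ wordOp g α β := by
    refine word_linearMap_ext fun w => ?_
    simp [mapDomain_single, wordOpFun_cons, hg]
  exact LinearMap.congr_fun this x

lemma wordOp_relabel {g : T → Option T} {α β : T → K} {g' : S → Option S} {α' β' : S → K}
    (hg : ∀ s, g (σ s) = (g' s).map σ) (hα : ∀ s, α (σ s) = α' s) (hβ : ∀ s, β (σ s) = β' s) :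
    wordOp g α β ∘ₗ reletter K σ = reletter K σ ∘ₗ wordOp g' α' β' := by
  refine word_linearMap_ext fun w => ?_
  simp only [LinearMap.comp_apply, reletter_single, wordOp_single]
  induction w with
  | nil => simp
  | cons s w ih =>
    rw [List.map_cons, wordOpFun_cons, wordOpFun_cons, ih, hg, hβ, map_add, map_smul,
      reletter_mapDomain_cons]
    congr 1
    cases g' s with
    | none => simp
    | some t => simp [Function.comp_def, hα]

lemma wordOp_relabel_eq_zero {g : T → Option T} (α β : T → K)
    (hg : ∀ s, g (σ s) = Option.none) (x : List S →₀ K) : wordOp g α β (reletter K σ x) = 0 := by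
  have : wordOp g α β ∘ₗ reletter K σ = 0 := by
    refine word_linearMap_ext fun w => ?_
    simp only [LinearMap.comp_apply, reletter_single, wordOp_single, LinearMap.zero_apply]
    induction w with
    | nil => simp
    | cons s w ih => simp [wordOpFun_cons, hg, ih]
  exact LinearMap.congr_fun this x

lemma wordOp_comp_relabel {g h : T → Option T} {α β γ δ : T → K} {g' : S → Option S}
    {α' β' : S → K} (hg : ∀ s, g (σ s) = Option.none)
    (hgh : ∀ s, (h (σ s)).bind g = (g' s).map σ) (hα : ∀ s, α (σ s) * γ (σ s) = α' s)
    (hβ : ∀ s, β (σ s) * δ (σ s) = β' s) :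
    wordOp g α β ∘ₗ wordOp h γ δ ∘ₗ reletter K σ = reletter K σ ∘ₗ wordOp g' α' β' := by
  refine word_linearMap_ext fun w => ?_
  simp only [LinearMap.comp_apply, reletter_single, wordOp_single]
  induction w with
  | nil => simp
  | cons s w ih =>
    have h1 : wordOpFun g α β (w.map σ) = 0 := by
      have := wordOp_relabel_eq_zero α β hg (single w 1)
      rwa [reletter_single, wordOp_single] at this
    have h2 : ∀ t, wordOp g α β (single (t :: w.map σ) ((w.map σ).map γ).prod) =
        (g t).elim 0 fun u => single (u :: w.map σ) (w.map α').prod := by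
      intro t
      have e : (single (t :: w.map σ) ((w.map σ).map γ).prod : List T →₀ K) =
        ((w.map σ).map γ).prod • single (t :: w.map σ) 1 := by simp
      rw [e, map_smul, wordOp_single, wordOpFun_cons, h1]
      cases g t with
      | none => simp
      | some u =>
        simp only [Option.elim_some, Finsupp.mapDomain_zero, smul_zero, add_zero,
          Finsupp.smul_single, smul_eq_mul, List.map_map, Function.comp_def]
        rw [show α' = fun s => γ (σ s) * α (σ s) from funext fun s => by rw [mul_comm, hα],
          List.prod_map_mul, mul_comm]
    rw [List.map_cons, wordOpFun_cons, wordOpFun_cons, map_add, map_smul, map_add, map_smul,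
      wordOp_mapDomain_cons g α β _ (hg s), ih, reletter_mapDomain_cons, smul_smul, mul_comm (δ _),
      hβ]
    congr 1
    have h3 := hgh s
    cases hh : h (σ s) with
    | none =>
      rw [hh] at h3
      cases hg' : g' s with
      | none => simp
      | some u => simp [hg'] at h3
    | some t =>
      rw [hh, Option.bind_some] at h3
      rw [Option.elim_some, h2, h3]
      cases g' s <;> simp

lemma wordDiag_relabel {χ : T → K} {χ' : S → K} (h : ∀ s, χ (σ s) = χ' s) :
    wordDiag χ ∘ₗ reletter K σ = reletter K σ ∘ₗ wordDiag χ' := by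
  refine word_linearMap_ext fun w => ?_
  simp [Function.comp_def, h]

end Relabel

section SmallModule

variable {n : ℕ}

/-- The position of the `p`-th letter of the small module among the letters of the big one. -/
def skip (r p : ℕ) : ℕ := if p ≤ r then p else p + 1

/-- The reletterling `ℤ/n → ℤ/(n+1)` avoiding `r + 1`. -/
def skipMap (r : ℕ) (i : ZMod n) : ZMod (n + 1) := ((skip r i.val : ℕ) : ZMod (n + 1))

lemma skip_le {r p : ℕ} (hp : p < n) : skip r p ≤ n := by
  unfold skip; split_ifs <;> omega

lemma natCast_inj_of_le {a b : ℕ} (ha : a ≤ n) (hb : b ≤ n) :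
    (a : ZMod (n + 1)) = b ↔ a = b := by
  refine ⟨fun h => ?_, fun h => by rw [h]⟩
  have := congrArg ZMod.val h
  rwa [ZMod.val_natCast_of_lt (by omega), ZMod.val_natCast_of_lt (by omega)] at this

lemma skipMap_injective (hn : 2 ≤ n) (r : ℕ) : Function.Injective (skipMap (n := n) r) := by
  have : NeZero n := ⟨by omega⟩
  intro i j h
  have hi := ZMod.val_lt i
  have hj := ZMod.val_lt j
  unfold skipMap at h
  rw [natCast_inj_of_le (skip_le hi) (skip_le hj)] at h
  apply ZMod.val_injective
  unfold skip at h
  split_ifs at h <;> omega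

lemma skipMap_ne (hn : 2 ≤ n) {r : ℕ} (hr : r ≤ n - 1) (i : ZMod n) :
    skipMap r i ≠ (r : ZMod (n + 1)) + 1 := by
  have : NeZero n := ⟨by omega⟩
  have hi := ZMod.val_lt i
  have e : (r : ZMod (n + 1)) + 1 = ((r + 1 : ℕ) : ZMod (n + 1)) := by push_cast; rfl
  rw [e, skipMap, Ne, natCast_inj_of_le (skip_le hi) (by omega)]
  unfold skip
  split_ifs <;> omega

lemma skipMap_natCast (hn : 2 ≤ n) {r : ℕ} (hr : r ≤ n - 1) {p : ℕ} (hp : p ≤ n) :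
    skipMap r (p : ZMod n) = ((skip r p : ℕ) : ZMod (n + 1)) := by
  rcases hp.lt_or_eq with h | h
  · rw [skipMap, ZMod.val_natCast_of_lt h]
  · subst h
    have : ¬ p ≤ r := by omega
    simp [skipMap, skip, this]

lemma skipMap_add_one (hn : 2 ≤ n) {r : ℕ} (hr : r ≤ n - 1) (i : ZMod n) :
    skipMap r (i + 1) = ((skip r (i.val + 1) : ℕ) : ZMod (n + 1)) := by
  have : NeZero n := ⟨by omega⟩
  have hi := ZMod.val_lt i
  rw [← skipMap_natCast hn hr (by omega)]
  simp

lemma skipMap_add_one_of_ne (hn : 2 ≤ n) {r : ℕ} (hr : r ≤ n - 1) {i : ZMod n} (h : i.val ≠ r) :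
    skipMap r (i + 1) = skipMap r i + 1 := by
  rw [skipMap_add_one hn hr, skipMap, skip, skip]
  split_ifs <;> first | omega | (push_cast; rfl)

/-- The reletterling of letters. -/
def skipLetter (r : ℕ) (s : Letter n) : Letter (n + 1) := (skipMap r s.1, s.2)

lemma skipLetter_injective (hn : 2 ≤ n) (r : ℕ) : Function.Injective (skipLetter (n := n) r) := by
  intro a b h
  have h1 : skipMap r a.1 = skipMap r b.1 := congrArg (fun c : Letter (n + 1) => c.1) h
  have h2 : a.2 = b.2 := congrArg (fun c : Letter (n + 1) => c.2) h
  exact Prod.ext (skipMap_injective hn r h1) h2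

/-- The grading shift used on the big module. -/
def bigWt (n r : ℕ) (i : ZMod (n + 1)) : ℤ := if i = (r : ZMod (n + 1)) then 0 else 1

/-- The inclusion of the small word space. -/
abbrev inclWords (n r : ℕ) : WordSpace n →ₗ[Qv] WordSpace (n + 1) :=
  reletter Qv (skipLetter r)

lemma skipMap_of_val_ne (hn : 2 ≤ n) {r : ℕ} (hr : r ≤ n - 1) {i : ZMod n} (h : i.val ≠ r) :
    skipMap r i ≠ (r : ZMod (n + 1)) := by
  have : NeZero n := ⟨by omega⟩
  have hi := ZMod.val_lt i
  rw [skipMap, Ne, natCast_inj_of_le (skip_le hi) (by omega)]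
  unfold skip
  split_ifs <;> omega

lemma skipMap_of_val_eq {r : ℕ} {i : ZMod n} (h : i.val = r) :
    skipMap r i = (r : ZMod (n + 1)) := by
  simp [skipMap, skip, h]

lemma skipMap_add_one_of_val_eq (hn : 2 ≤ n) {r : ℕ} (hr : r ≤ n - 1) {i : ZMod n}
    (h : i.val = r) : skipMap r (i + 1) = (r : ZMod (n + 1)) + 1 + 1 := by
  rw [skipMap_add_one hn hr, h, skip, if_neg (by omega)]
  push_cast
  rfl

/-- The weight of a letter at position `i`. -/
def delta {m : ℕ} (i : ZMod m) (s : Letter m) : Qv := vv ^ (if s.1 = i then 1 else 0 : ℤ)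

lemma delta_ne_zero {m : ℕ} (i : ZMod m) (s : Letter m) : delta i s ≠ 0 :=
  zpow_ne_zero _ vv_ne_zero

lemma kappa_eq_delta {m : ℕ} (i : ZMod m) : kappa i = delta i * (delta (i + 1))⁻¹ := by
  funext s
  simp [kappa, delta, zpow_sub₀ vv_ne_zero, div_eq_mul_inv]

lemma delta_mul_inv {m : ℕ} (i : ZMod m) : delta i * (delta i)⁻¹ = 1 :=
  funext fun s => mul_inv_cancel₀ (delta_ne_zero i s)

lemma prod_wordDiag_kappa {m : ℕ} (j k : ℕ) :
    ((List.range k).map fun t => (wordDiag (kappa ((j + t : ℕ) : ZMod m)) :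
      Module.End Qv (WordSpace m))).prod =
      wordDiag (delta (j : ZMod m) * (delta ((j + k : ℕ) : ZMod m))⁻¹) := by
  induction k with
  | zero => simp [delta_mul_inv, wordDiag_one]
  | succ k ih =>
    rw [List.range_succ, List.map_append, List.prod_append, ih, List.map_singleton,
      List.prod_singleton, wordDiag_mul, kappa_eq_delta]
    rw [show ((j + (k + 1) : ℕ) : ZMod m) = ((j + k : ℕ) : ZMod m) + 1 by push_cast; ring]
    congr 1
    linear_combination (delta (j : ZMod m) * (delta (((j + k : ℕ) : ZMod m) + 1))⁻¹) *
      delta_mul_inv ((j + k : ℕ) : ZMod m)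

lemma prod_wordDiag_kappa_inv {m : ℕ} (j k : ℕ) :
    ((List.range k).map fun t => (wordDiag (kappa ((j + t : ℕ) : ZMod m))⁻¹ :
      Module.End Qv (WordSpace m))).prod =
      wordDiag (delta (j : ZMod m) * (delta ((j + k : ℕ) : ZMod m))⁻¹)⁻¹ := by
  induction k with
  | zero => simp [delta_mul_inv, wordDiag_one]
  | succ k ih =>
    rw [List.range_succ, List.map_append, List.prod_append, ih, List.map_singleton,
      List.prod_singleton, wordDiag_mul, kappa_eq_delta]
    rw [show ((j + (k + 1) : ℕ) : ZMod m) = ((j + k : ℕ) : ZMod m) + 1 by push_cast; ring]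
    congr 1
    simp only [mul_inv, inv_inv]
    linear_combination ((delta (j : ZMod m))⁻¹ * (delta (((j + k : ℕ) : ZMod m) + 1))) *
      delta_mul_inv ((j + k : ℕ) : ZMod m)

end SmallModule

section LevelOne

variable {n : ℕ}

section

variable {m : ℕ} (hm : 3 ≤ m) (wt : ZMod m → ℤ) (i : ZMod m)

lemma wordRep_UE : wordRep hm wt (UE i) = wordE wt i := by
  simp [wordRep, UE, fE, wordGen]

lemma wordRep_UF : wordRep hm wt (UF i) = wordF wt i := by
  simp [wordRep, UF, fF, wordGen]

lemma wordRep_UK : wordRep hm wt (UK i) = wordDiag (kappa i) := by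
  simp [wordRep, UK, fK, wordGen]

lemma wordRep_UKinv : wordRep hm wt (UKinv i) = wordDiag (kappa i)⁻¹ := by
  simp [wordRep, UKinv, fKinv, wordGen]

end

lemma wordRep_prodK (hm : 3 ≤ n + 1) (wt : ZMod (n + 1) → ℤ) :
    wordRep hm wt (prodK n) = wordRep hm wt 1 := by
  rw [prodK, map_list_prod, List.map_map, map_one]
  have := prod_wordDiag_kappa (m := n + 1) 1 (n + 1)
  simp only [add_comm 1 (_ : ℕ)] at this
  simp only [Function.comp_def, wordRep_UK]
  rw [this]
  have e : ((n + 1 + 1 : ℕ) : ZMod (n + 1)) = ((1 : ℕ) : ZMod (n + 1)) := by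
    rw [Nat.cast_add, ZMod.natCast_self, zero_add]
  rw [e, delta_mul_inv, wordDiag_one]

/-- The word representation of the level-one quotient. -/
def levelOneRep (hm : 3 ≤ n + 1) (wt : ZMod (n + 1) → ℤ) :
    U1 n →ₐ[Qv] Module.End Qv (WordSpace (n + 1)) :=
  RingQuot.liftAlgHom Qv ⟨wordRep hm wt, by rintro x y ⟨⟩; exact wordRep_prodK hm wt⟩

lemma levelOneRep_toU1 (hm : 3 ≤ n + 1) (wt : ZMod (n + 1) → ℤ) (x : U (n + 1)) :
    levelOneRep hm wt (toU1 n x) = wordRep hm wt x := by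
  simp [levelOneRep, toU1]

lemma wordRep_lElt (hm : 3 ≤ n + 1) (wt : ZMod (n + 1) → ℤ) (r i : ℕ) :
    wordRep hm wt (lElt n r i) =
      wordDiag (delta ((skip r i : ℕ) : ZMod (n + 1)) * (delta ((r : ZMod (n + 1)) + 1))⁻¹) := by
  rw [lElt, apply_ite (wordRep hm wt), map_list_prod, map_list_prod, List.map_map, List.map_map]
  simp only [Function.comp_def, wordRep_UK, wordRep_UKinv]
  rw [prod_wordDiag_kappa, prod_wordDiag_kappa_inv, skip]
  split_ifs with h
  · rw [show i + (r + 1 - i) = r + 1 by omega]; push_cast; rfl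
  · rw [show r + 1 + (i - r) = i + 1 by omega, mul_inv, inv_inv, mul_comm]; push_cast; rfl

lemma wordRep_linvElt (hm : 3 ≤ n + 1) (wt : ZMod (n + 1) → ℤ) (r i : ℕ) :
    wordRep hm wt (linvElt n r i) =
      wordDiag (delta ((skip r i : ℕ) : ZMod (n + 1)) * (delta ((r : ZMod (n + 1)) + 1))⁻¹)⁻¹ := by
  rw [linvElt, apply_ite (wordRep hm wt), map_list_prod, map_list_prod, List.map_map, List.map_map]
  simp only [Function.comp_def, wordRep_UK, wordRep_UKinv]
  rw [prod_wordDiag_kappa, prod_wordDiag_kappa_inv, skip]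
  split_ifs with h
  · rw [show i + (r + 1 - i) = r + 1 by omega]; push_cast; rfl
  · rw [show r + 1 + (i - r) = i + 1 by omega, mul_inv, inv_inv, mul_comm]; push_cast; rfl

/-- The images of the generators of `U(ĝl_n)` on words. -/
def smallGen : GenGl n → Module.End Qv (WordSpace n)
  | .E i => wordE 1 i
  | .F i => wordF 1 i
  | .L i => wordDiag (delta i)
  | .Linv i => wordDiag (delta i)⁻¹

lemma bigWt_skipMap (hn : 2 ≤ n) {r : ℕ} (hr : r ≤ n - 1) (i : ZMod n) (hi : i.val ≠ r) :
    bigWt n r (skipMap r i) = 1 :=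
  if_neg (skipMap_of_val_ne hn hr hi)

lemma delta_skipMap (hn : 2 ≤ n) {r : ℕ} (i : ZMod n) (s : Letter n) :
    delta (skipMap r i) (skipLetter r s) = delta i s := by
  simp [delta, skipLetter, (skipMap_injective hn r).eq_iff]

lemma delta_skipLetter (hn : 2 ≤ n) {r : ℕ} (hr : r ≤ n - 1) (s : Letter n) :
    delta ((r : ZMod (n + 1)) + 1) (skipLetter r s) = 1 := by
  simp [delta, skipLetter, skipMap_ne hn hr]

lemma skipMap_rep1 (hn : 2 ≤ n) {r : ℕ} (hr : r ≤ n - 1) (i : ZMod n) :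
    ((skip r (rep1 i) : ℕ) : ZMod (n + 1)) = skipMap r i := by
  have : NeZero n := ⟨by omega⟩
  have hi := ZMod.val_lt i
  have h : rep1 i ≤ n := by unfold rep1; split_ifs <;> omega
  rw [← skipMap_natCast hn hr h]
  congr 1
  unfold rep1
  split_ifs with h0
  · rw [ZMod.natCast_self, (ZMod.val_eq_zero i).mp h0]
  · exact ZMod.natCast_zmod_val i

lemma intertwine_l (hn : 2 ≤ n) {r : ℕ} (hr : r ≤ n - 1) (i : ZMod n) :
    wordRep (by omega) (bigWt n r) (lElt n r (rep1 i)) ∘ₗ inclWords n r =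
      inclWords n r ∘ₗ smallGen (.L i) := by
  rw [wordRep_lElt]
  refine wordDiag_relabel fun s => ?_
  simp [skipMap_rep1 hn hr, delta_skipMap hn, delta_skipLetter hn hr]

lemma intertwine_linv (hn : 2 ≤ n) {r : ℕ} (hr : r ≤ n - 1) (i : ZMod n) :
    wordRep (by omega) (bigWt n r) (linvElt n r (rep1 i)) ∘ₗ inclWords n r =
      inclWords n r ∘ₗ smallGen (.Linv i) := by
  rw [wordRep_linvElt]
  refine wordDiag_relabel fun s => ?_
  simp [skipMap_rep1 hn hr, delta_skipMap hn, delta_skipLetter hn hr]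

lemma eElt_of_val_ne {r : ℕ} (i : ZMod n) (ε : ℤ) (hi : i.val ≠ r) :
    eElt n r ε i = UE (skipMap r i) := by
  rw [eElt, skipMap, skip]
  split_ifs <;> first | omega | rfl

lemma fElt_of_val_ne {r : ℕ} (i : ZMod n) (ε : ℤ) (hi : i.val ≠ r) :
    fElt n r ε i = UF (skipMap r i) := by
  rw [fElt, skipMap, skip]
  split_ifs <;> first | omega | rfl

lemma eElt_of_val_eq {r : ℕ} (i : ZMod n) (ε : ℤ) (hi : i.val = r) : eElt n r ε i = er n r ε := by
  simp [eElt, hi]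

lemma fElt_of_val_eq {r : ℕ} (i : ZMod n) (ε : ℤ) (hi : i.val = r) : fElt n r ε i = fr n r ε := by
  simp [fElt, hi]

lemma kappa_skipMap (hn : 2 ≤ n) {r : ℕ} (hr : r ≤ n - 1) (i : ZMod n) (hi : i.val ≠ r)
    (s : Letter n) :
    kappa (skipMap r i) (skipLetter r s) = kappa i s := by
  rw [kappa_eq_delta, kappa_eq_delta, ← skipMap_add_one_of_ne hn hr hi]
  simp [delta_skipMap hn]

lemma kappa_mul_kappa (hn : 2 ≤ n) {r : ℕ} (hr : r ≤ n - 1) (i : ZMod n) (hi : i.val = r)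
    (s : Letter n) :
    kappa (r : ZMod (n + 1)) (skipLetter r s) *
      kappa ((r : ZMod (n + 1)) + 1) (skipLetter r s) = kappa i s := by
  have h1 := delta_skipMap hn (r := r) i s
  have h2 := delta_skipMap hn (r := r) (i + 1) s
  rw [skipMap_of_val_eq hi] at h1
  rw [skipMap_add_one_of_val_eq hn hr hi] at h2
  simp only [kappa_eq_delta, Pi.mul_apply, Pi.inv_apply, h1, h2, delta_skipLetter hn hr]
  simp

lemma intertwine_e (hn : 2 ≤ n) {r : ℕ} (hr : r ≤ n - 1) (i : ZMod n) (ε : ℤ) :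
    wordRep (by omega) (bigWt n r) (eElt n r ε i) ∘ₗ inclWords n r =
      inclWords n r ∘ₗ smallGen (.E i) := by
  have h3 : 3 ≤ n + 1 := by omega
  by_cases hi : i.val = r
  · rw [eElt_of_val_eq i ε hi, er, map_sub, map_smul, map_mul, map_mul, wordRep_UE, wordRep_UE]
    have hg : ∀ s : Letter n,
        lower (bigWt n r) (r : ZMod (n + 1)) (skipLetter r s) = Option.none := fun s =>
      if_neg (skipMap_ne hn hr s.1)
    have h0 : wordE (bigWt n r) (r : ZMod (n + 1)) ∘ₗ inclWords n r = 0 :=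
      LinearMap.ext fun x => wordOp_relabel_eq_zero _ _ hg x
    rw [LinearMap.sub_comp, LinearMap.smul_comp, Module.End.mul_eq_comp, Module.End.mul_eq_comp,
      LinearMap.comp_assoc, LinearMap.comp_assoc, h0, LinearMap.comp_zero, smul_zero]
    refine (sub_zero (G := WordSpace n →ₗ[Qv] WordSpace (n + 1)) _).trans ?_
    refine wordOp_comp_relabel hg (fun s => ?_) (by simp) (kappa_mul_kappa hn hr i hi)
    have hs : (skipLetter r s).1 = (r : ZMod (n + 1)) + 1 + 1 ↔ s.1 = i + 1 := by
      rw [← skipMap_add_one_of_val_eq hn hr hi]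
      exact (skipMap_injective hn r).eq_iff
    by_cases h : s.1 = i + 1
    · rw [lower, if_pos (hs.mpr h)]
      have e := skipMap_of_val_eq hi
      have e' : bigWt n r ((r : ZMod (n + 1)) + 1) = 1 := if_neg (ne_add_one (by omega) _).symm
      have e'' : bigWt n r (r : ZMod (n + 1)) = 0 := if_pos rfl
      simp [lower, h, skipLetter, e, e', e'']
    · rw [lower, if_neg (mt hs.mp h), lower, if_neg h]
      rfl
  · rw [eElt_of_val_ne i ε hi, wordRep_UE]
    refine wordOp_relabel (fun s => ?_) (by simp) (kappa_skipMap hn hr i hi)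
    have hs : (skipLetter r s).1 = skipMap r i + 1 ↔ s.1 = i + 1 := by
      rw [← skipMap_add_one_of_ne hn hr hi]
      exact (skipMap_injective hn r).eq_iff
    simp only [lower, hs]
    split_ifs <;> simp [skipLetter, bigWt_skipMap hn hr i hi]

lemma intertwine_f (hn : 2 ≤ n) {r : ℕ} (hr : r ≤ n - 1) (i : ZMod n) (ε : ℤ) :
    wordRep (by omega) (bigWt n r) (fElt n r ε i) ∘ₗ inclWords n r =
      inclWords n r ∘ₗ smallGen (.F i) := by
  have h3 : 3 ≤ n + 1 := by omega
  by_cases hi : i.val = r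
  · rw [fElt_of_val_eq i ε hi, fr, map_sub, map_smul, map_mul, map_mul, wordRep_UF, wordRep_UF]
    have hg : ∀ s : Letter n,
        raise (bigWt n r) ((r : ZMod (n + 1)) + 1) (skipLetter r s) = Option.none := fun s =>
      if_neg (skipMap_ne hn hr s.1)
    have h0 : wordF (bigWt n r) ((r : ZMod (n + 1)) + 1) ∘ₗ inclWords n r = 0 :=
      LinearMap.ext fun x => wordOp_relabel_eq_zero _ _ hg x
    rw [LinearMap.sub_comp, LinearMap.smul_comp, Module.End.mul_eq_comp, Module.End.mul_eq_comp,
      LinearMap.comp_assoc, LinearMap.comp_assoc, h0, LinearMap.comp_zero, smul_zero]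
    refine (sub_zero (G := WordSpace n →ₗ[Qv] WordSpace (n + 1)) _).trans ?_
    refine wordOp_comp_relabel hg (fun s => ?_) (fun s => ?_) (by simp)
    · have hs : (skipLetter r s).1 = (r : ZMod (n + 1)) ↔ s.1 = i := by
        rw [← skipMap_of_val_eq hi]
        exact (skipMap_injective hn r).eq_iff
      by_cases h : s.1 = i
      · rw [raise, if_pos (hs.mpr h)]
        have e := skipMap_add_one_of_val_eq hn hr hi
        have e' : bigWt n r ((r : ZMod (n + 1)) + 1) = 1 := if_neg (ne_add_one (by omega) _).symm
        simp only [Option.bind_some, raise, h, if_true, e', Option.map_some, skipLetter, e]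
        simp [bigWt]
      · rw [raise, if_neg (mt hs.mp h), raise, if_neg h]
        rfl
    · simp only [Pi.inv_apply]
      rw [← mul_inv, mul_comm, kappa_mul_kappa hn hr i hi]
  · rw [fElt_of_val_ne i ε hi, wordRep_UF]
    refine wordOp_relabel (fun s => ?_) (fun s => ?_) (by simp)
    · have hs : (skipLetter r s).1 = skipMap r i ↔ s.1 = i := (skipMap_injective hn r).eq_iff
      simp only [raise, hs]
      split_ifs
      · simp [skipLetter, bigWt_skipMap hn hr i hi, skipMap_add_one_of_ne hn hr hi]
      · rfl
    · simp only [Pi.inv_apply]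
      rw [kappa_skipMap hn hr i hi]

/-- An algebra map with the prescribed values on generators is compatible with the action
on words. -/
lemma intertwine (hn : 2 ≤ n) {r : ℕ} (hr : r ≤ n - 1) (ε : ℤ) (Φ : Ugl n →ₐ[Qv] U1 n)
    (hΦ : ∀ i : ZMod n,
      Φ (GlE i) = toU1 n (eElt n r ε i) ∧ Φ (GlF i) = toU1 n (fElt n r ε i) ∧
      Φ (GlL i) = toU1 n (lElt n r (rep1 i)) ∧
      Φ (GlLinv i) = toU1 n (linvElt n r (rep1 i))) (x : FAgl n) :
    levelOneRep (by omega) (bigWt n r) (Φ (RingQuot.mkAlgHom Qv (RelGl n) x)) ∘ₗ inclWords n r =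
      inclWords n r ∘ₗ FreeAlgebra.lift Qv smallGen x := by
  induction x using FreeAlgebra.induction with
  | grade0 c =>
    simp only [Algebra.algebraMap_eq_smul_one]
    exact LinearMap.ext fun y => by simp
  | grade1 g =>
    rw [FreeAlgebra.lift_ι_apply]
    cases g with
    | E i => rw [← gE, ← GlE, (hΦ i).1, levelOneRep_toU1, intertwine_e hn hr]
    | F i => rw [← gF, ← GlF, (hΦ i).2.1, levelOneRep_toU1, intertwine_f hn hr]
    | L i => rw [← gL, ← GlL, (hΦ i).2.2.1, levelOneRep_toU1, intertwine_l hn hr]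
    | Linv i => rw [← gLinv, ← GlLinv, (hΦ i).2.2.2, levelOneRep_toU1, intertwine_linv hn hr]
  | mul x y hx hy =>
    rw [map_mul, map_mul, map_mul, map_mul, Module.End.mul_eq_comp, Module.End.mul_eq_comp,
      LinearMap.comp_assoc, hy, ← LinearMap.comp_assoc, hx, LinearMap.comp_assoc]
  | add x y hx hy =>
    rw [map_add, map_add, map_add, map_add, LinearMap.add_comp, LinearMap.comp_add, hx, hy]

end LevelOne

section Spanning

attribute [local instance] LieRing.ofAssociativeRing

variable {n : ℕ}

lemma quantumSerre_of_serreSum {A : Type} [Ring A] [Algebra Qv A] (hn : 2 ≤ n) {e : ZMod n → A}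
    (h : ∀ i j, i ≠ j → serreSum (1 - cartan i j).toNat (e i) (e j) = 0) : QuantumSerre e where
  comm i j h₁ h₂ := by
    by_cases hij : i = j
    · rw [hij]
    · have := h i j hij
      rw [cartan_of_not_adj hij h₁ h₂] at this
      exact (sub_eq_zero.mp ((serreSum_one _ _).symm.trans this)).symm
  quad h3 i j hij := by
    have h0 := vv_ne_zero
    have hne : i ≠ j := by
      rintro rfl
      exact hij.elim (ne_add_one hn i).symm (ne_add_one hn i).symm
    have := h i j hne
    rw [cartan_adj h3 hij] at this
    have h2 : serrePoly vv (e i) (e j) = 0 :=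
      (smul_eq_zero.mp ((serreSum_two _ _).symm.trans this)).resolve_left
        (inv_ne_zero qfact_two_ne_zero)
    have h4 := congrArg (vv • ·) h2
    have h5 : vv * (vv + vv⁻¹) = vv ^ 2 + 1 := by
      field_simp
    simp only [serrePoly, smul_add, smul_sub, smul_smul, smul_zero, h5] at h4
    exact h4
  cubic h2 i := by
    subst h2
    have h0 := vv_ne_zero
    have hne : i ≠ i + 1 := ne_add_one hn i
    have := h i _ hne
    rw [cartan_two hne] at this
    have h3 : qfact 3 ≠ 0 := by
      rw [qfact_three, ← qfact_two]
      exact mul_ne_zero quantum_three_ne_zero qfact_two_ne_zero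
    have h2 : cubicPoly vv (e i) (e (i + 1)) = 0 :=
      (smul_eq_zero.mp (neg_eq_zero.mp ((serreSum_three _ _).symm.trans this))).resolve_left
        (inv_ne_zero h3)
    have h4 := congrArg (vv ^ 2 • ·) h2
    have h5 : vv ^ 2 * (vv ^ 2 + 1 + (vv ^ 2)⁻¹) = vv ^ 4 + vv ^ 2 + 1 := by
      field_simp
    simp only [cubicPoly, smul_add, smul_sub, smul_smul, smul_zero, h5] at h4
    exact h4

lemma gl_rel {x y : FAgl n} (h : RelGl n x y) :
    RingQuot.mkAlgHom Qv (RelGl n) x = RingQuot.mkAlgHom Qv (RelGl n) y :=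
  RingQuot.mkAlgHom_rel Qv h

lemma quantumSerre_GlE (hn : 2 ≤ n) : QuantumSerre (GlE (m := n)) :=
  quantumSerre_of_serreSum hn fun i j h =>
    (map_serreSum _ _ _ _).symm.trans ((gl_rel (RelGl.serreE i j h)).trans (map_zero _))

lemma cartan_neg_sub (i j : ZMod n) : cartan (-i - 1) (-j - 1) = cartan i j := by
  unfold cartan
  have h1 : -i - 1 = -j - 1 ↔ i = j := by simp
  have h2 : -i - 1 = -j - 1 + 1 ↔ i = j - 1 := by
    constructor <;> intro h <;> linear_combination -h
  have h3 : -i - 1 = -j - 1 - 1 ↔ i = j + 1 := by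
    constructor <;> intro h <;> linear_combination -h
  simp only [h1, h2, h3]
  ring

/-- The lowering generators, indexed so that they behave like the raising ones. -/
def flipF (i : ZMod n) : Ugl n := GlF (-i - 1)

lemma quantumSerre_flipF (hn : 2 ≤ n) : QuantumSerre (flipF (n := n)) :=
  quantumSerre_of_serreSum hn fun i j h => by
    rw [← cartan_neg_sub]
    exact (map_serreSum _ _ _ _).symm.trans
      ((gl_rel (RelGl.serreF _ _ (by simpa using h))).trans (map_zero _))

lemma GlL_mul_GlLinv (i : ZMod n) : GlL i * GlLinv i = (1 : Ugl n) := by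
  simpa [GlL, GlLinv] using gl_rel (RelGl.LLinv i)

lemma GlLinv_mul_GlL (i : ZMod n) : GlLinv i * GlL i = (1 : Ugl n) := by
  simpa [GlL, GlLinv] using gl_rel (RelGl.LinvL i)

/-- `L i` as a unit. -/
def glUnit (i : ZMod n) : (Ugl n)ˣ := ⟨GlL i, GlLinv i, GlL_mul_GlLinv i, GlLinv_mul_GlL i⟩

lemma glUnit_commute (i j : ZMod n) : Commute (glUnit i) (glUnit j) := by
  refine Units.ext ?_
  simpa [GlL, glUnit] using gl_rel (RelGl.LL i j)

/-- The Laurent monomials in the `L i`. -/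
def torus [NeZero n] : (ZMod n → Multiplicative ℤ) →* (Ugl n)ˣ :=
  MonoidHom.noncommPiCoprod (fun i => zpowersHom _ (glUnit i)) fun i j _ x y => by
    simpa [zpowersHom_apply] using (glUnit_commute i j).zpow_zpow _ _

lemma torus_mulSingle [NeZero n] (i : ZMod n) (k : ℤ) :
    torus (Pi.mulSingle i (Multiplicative.ofAdd k)) = glUnit i ^ k := by
  refine (MonoidHom.noncommPiCoprod_mulSingle _ i _).trans ?_
  simp [zpowersHom_apply]

/-- `t` and `x` commute up to a scalar. -/
def ScalarCommute (t x : Ugl n) : Prop := ∃ c : Qv, t * x = c • (x * t)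

lemma ScalarCommute.mul {t x y : Ugl n} (hx : ScalarCommute t x) (hy : ScalarCommute t y) :
    ScalarCommute t (x * y) := by
  obtain ⟨c, hc⟩ := hx
  obtain ⟨d, hd⟩ := hy
  refine ⟨c * d, ?_⟩
  rw [← mul_assoc, hc, smul_mul_assoc, mul_assoc, hd, mul_smul_comm, smul_smul, mul_assoc]

lemma ScalarCommute.list_prod {ι : Type*} {t : Ugl n} {f : ι → Ugl n}
    (h : ∀ i, ScalarCommute t (f i)) (w : List ι) : ScalarCommute t (w.map f).prod := by
  induction w with
  | nil => exact ⟨1, by simp⟩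
  | cons i w ih => simpa using (h i).mul ih

lemma scalarCommute_GlL_GlE (i j : ZMod n) : ScalarCommute (GlL i) (GlE j) :=
  ⟨_, by simpa [GlL, GlE] using gl_rel (RelGl.LE i j)⟩

lemma scalarCommute_GlL_GlF (i j : ZMod n) : ScalarCommute (GlL i) (GlF j) :=
  ⟨_, by simpa [GlL, GlF] using gl_rel (RelGl.LF i j)⟩

lemma scalarCommute_inv {t s x : Ugl n} (h : s * t = 1) (h' : t * s = 1)
    (hx : ∃ c : Qv, c ≠ 0 ∧ t * x = c • (x * t)) : ScalarCommute s x := by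
  obtain ⟨c, hc, hx⟩ := hx
  refine ⟨c⁻¹, ?_⟩
  have h1 : x * s = c • (s * x) := by
    calc x * s = s * (t * x) * s := by rw [← mul_assoc, h, one_mul]
      _ = c • (s * x * (t * s)) := by rw [hx]; simp only [mul_smul_comm, smul_mul_assoc, mul_assoc]
      _ = c • (s * x) := by rw [h', mul_one]
  rw [h1, smul_smul, inv_mul_cancel₀ hc, one_smul]

lemma scalarCommute_GlLinv_GlE (i j : ZMod n) : ScalarCommute (GlLinv i) (GlE j) :=
  scalarCommute_inv (GlLinv_mul_GlL i) (GlL_mul_GlLinv i)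
    ⟨_, zpow_ne_zero _ vv_ne_zero, by simpa [GlL, GlE] using gl_rel (RelGl.LE i j)⟩

lemma scalarCommute_GlLinv_GlF (i j : ZMod n) : ScalarCommute (GlLinv i) (GlF j) :=
  scalarCommute_inv (GlLinv_mul_GlL i) (GlL_mul_GlLinv i)
    ⟨_, zpow_ne_zero _ vv_ne_zero, by simpa [GlL, GlF] using gl_rel (RelGl.LF i j)⟩

lemma GlE_mul_GlF (i j : ZMod n) : GlE i * GlF j = (GlF j * GlE i : Ugl n) +
    if i = j then (vv - vv⁻¹)⁻¹ • (GlL i * GlLinv (i + 1) - GlLinv i * GlL (i + 1)) else 0 := by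
  have := gl_rel (RelGl.EF i j)
  rw [map_sub, sub_eq_iff_eq_add, map_mul, map_mul] at this
  refine this.trans ?_
  rw [add_comm]
  congr 1
  split_ifs <;> simp [GlL, GlLinv]

/-- The triangular monomials. -/
def triMon [NeZero n] (u w : List (ZMod n)) (μ : ZMod n → Multiplicative ℤ) : Ugl n :=
  (u.map flipF).prod * (w.map GlE).prod * torus μ

/-- The span of the triangular monomials. -/
def triSpan (n : ℕ) [NeZero n] : Submodule Qv (Ugl n) :=
  Submodule.span Qv {x | ∃ u w μ, triMon u w μ = x}

lemma triMon_mem [NeZero n] (u w : List (ZMod n)) (μ : ZMod n → Multiplicative ℤ) :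
    triMon u w μ ∈ triSpan n := Submodule.subset_span ⟨u, w, μ, rfl⟩

lemma triSpan_mul_mem [NeZero n] {t : Ugl n} (h : ∀ u w μ, t * triMon u w μ ∈ triSpan n)
    {x : Ugl n} (hx : x ∈ triSpan n) : t * x ∈ triSpan n := by
  have : triSpan n ≤ (triSpan n).comap (LinearMap.mulLeft Qv t) := by
    refine Submodule.span_le.mpr ?_
    rintro _ ⟨u, w, μ, rfl⟩
    exact h u w μ
  exact this hx

lemma flipF_mul_mem [NeZero n] (i : ZMod n) {x : Ugl n} (hx : x ∈ triSpan n) :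
    flipF i * x ∈ triSpan n :=
  triSpan_mul_mem (fun u w μ => by
    have : flipF i * triMon u w μ = triMon (i :: u) w μ := by simp [triMon, mul_assoc]
    exact this ▸ triMon_mem _ _ _) hx

lemma GlF_mul_mem [NeZero n] (i : ZMod n) {x : Ugl n} (hx : x ∈ triSpan n) :
    GlF i * x ∈ triSpan n := by
  have := flipF_mul_mem (-i - 1) hx
  rwa [flipF, show -(-i - 1) - 1 = i by ring] at this

lemma scalar_mul_mem [NeZero n] {t : Ugl n} {ν : ZMod n → Multiplicative ℤ} (ht : t = torus ν)
    (hE : ∀ i, ScalarCommute t (GlE i)) (hF : ∀ i, ScalarCommute t (GlF i)) {x : Ugl n}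
    (hx : x ∈ triSpan n) : t * x ∈ triSpan n :=
  triSpan_mul_mem (fun u w μ => by
    obtain ⟨c, hc⟩ := (ScalarCommute.list_prod (f := flipF) (fun i => hF _) u).mul
      (ScalarCommute.list_prod hE w)
    have : t * triMon u w μ = c • triMon u w (ν * μ) := by
      rw [triMon, ← mul_assoc, hc, triMon, map_mul, Units.val_mul, ← ht, smul_mul_assoc, mul_assoc]
    rw [this]
    exact Submodule.smul_mem _ _ (triMon_mem _ _ _)) hx

lemma GlL_mul_mem [NeZero n] (i : ZMod n) {x : Ugl n} (hx : x ∈ triSpan n) :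
    GlL i * x ∈ triSpan n :=
  scalar_mul_mem (by rw [torus_mulSingle i 1]; simp [glUnit])
    (scalarCommute_GlL_GlE i) (scalarCommute_GlL_GlF i) hx

lemma GlLinv_mul_mem [NeZero n] (i : ZMod n) {x : Ugl n} (hx : x ∈ triSpan n) :
    GlLinv i * x ∈ triSpan n :=
  scalar_mul_mem (by rw [torus_mulSingle i (-1)]; simp [glUnit])
    (scalarCommute_GlLinv_GlE i) (scalarCommute_GlLinv_GlF i) hx

lemma GlE_mul_mem [NeZero n] (i : ZMod n) {x : Ugl n} (hx : x ∈ triSpan n) :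
    GlE i * x ∈ triSpan n := by
  refine triSpan_mul_mem (fun u w μ => ?_) hx
  induction u with
  | nil =>
    have : GlE i * triMon [] w μ = triMon [] (i :: w) μ := by simp [triMon, mul_assoc]
    exact this ▸ triMon_mem _ _ _
  | cons j u ih =>
    have h1 : triMon (j :: u) w μ = GlF (-j - 1) * triMon u w μ := by
      simp [triMon, flipF, mul_assoc]
    rw [h1, ← mul_assoc, GlE_mul_GlF, add_mul, mul_assoc]
    refine add_mem (GlF_mul_mem _ ih) ?_
    split_ifs
    · rw [smul_mul_assoc, sub_mul, mul_assoc, mul_assoc]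
      exact Submodule.smul_mem _ _ (sub_mem
        (GlL_mul_mem _ (GlLinv_mul_mem _ (triMon_mem _ _ _)))
        (GlLinv_mul_mem _ (GlL_mul_mem _ (triMon_mem _ _ _))))
    · rw [zero_mul]
      exact zero_mem _

lemma triSpan_eq_top [NeZero n] : triSpan n = ⊤ := by
  have h : ∀ z : FAgl n, ∀ x ∈ triSpan n, RingQuot.mkAlgHom Qv (RelGl n) z * x ∈ triSpan n := by
    intro z
    induction z using FreeAlgebra.induction with
    | grade0 c =>
      intro x hx
      rw [AlgHom.commutes, Algebra.algebraMap_eq_smul_one, smul_mul_assoc, one_mul]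
      exact Submodule.smul_mem _ _ hx
    | grade1 g =>
      intro x hx
      cases g with
      | E i => exact GlE_mul_mem i hx
      | F i => exact GlF_mul_mem i hx
      | L i => exact GlL_mul_mem i hx
      | Linv i => exact GlLinv_mul_mem i hx
    | mul a b ha hb =>
      intro x hx
      rw [map_mul, mul_assoc]
      exact ha _ (hb _ hx)
    | add a b ha hb =>
      intro x hx
      rw [map_add, add_mul]
      exact add_mem (ha _ hx) (hb _ hx)
  refine Submodule.eq_top_iff'.mpr fun x => ?_
  obtain ⟨z, rfl⟩ := RingQuot.mkAlgHom_surjective Qv (RelGl n) x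
  have := h z 1 (by simpa [triMon] using triMon_mem (n := n) [] [] 1)
  rwa [mul_one] at this

/-- The ordered monomials in the root vectors and the torus. -/
def pbwMon [NeZero n]
    (p : (Multiset (RootIdx n) × Multiset (RootIdx n)) × (ZMod n → Multiplicative ℤ)) : Ugl n :=
  ordMon (pbwVec Qv flipF) p.1.1 * ordMon (pbwVec Qv GlE) p.1.2 * torus p.2

lemma span_pbwMon [NeZero n] (hn : 2 ≤ n) :
    Submodule.span Qv (Set.range (pbwMon (n := n))) = ⊤ := by
  rw [eq_top_iff, ← triSpan_eq_top]
  refine Submodule.span_le.mpr ?_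
  rintro _ ⟨u, w, μ, rfl⟩
  have h1 := quantum_word_mem_span hn (quantumSerre_flipF hn) u
  have h2 := quantum_word_mem_span hn (quantumSerre_GlE hn) w
  have h3 : (torus μ : Ugl n) ∈ Submodule.span Qv {(torus μ : Ugl n)} :=
    Submodule.mem_span_singleton_self _
  have h4 := Submodule.mul_mem_mul (Submodule.mul_mem_mul h1 h2) h3
  rw [Submodule.span_mul_span, Submodule.span_mul_span] at h4
  refine Submodule.span_mono ?_ h4
  rintro _ ⟨_, ⟨_, ⟨a, rfl⟩, _, ⟨b, rfl⟩, rfl⟩, _, rfl, rfl⟩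
  exact ⟨((a, b), μ), rfl⟩

end Spanning

section Derivations

open TensorProduct
open Finsupp (single mapDomain)

variable {S B : Type*}

/-- All ways of splitting a list into a sublist and its complement. -/
def splits : List B → List (List B × List B)
  | [] => [([], [])]
  | a :: l => (splits l).map (fun p => (a :: p.1, p.2)) ++ (splits l).map fun p => (p.1, a :: p.2)

lemma perm_of_mem_splits {l : List B} {p : List B × List B} (h : p ∈ splits l) :
    l.Perm (p.1 ++ p.2) := by
  induction l generalizing p with
  | nil =>
    rw [splits, List.mem_singleton] at h
    simp [h]
  | cons a l ih =>
    rw [splits, List.mem_append, List.mem_map, List.mem_map] at h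
    rcases h with ⟨q, hq, rfl⟩ | ⟨q, hq, rfl⟩
    · exact (ih hq).cons a
    · exact ((ih hq).cons a).trans List.perm_middle.symm

lemma nil_mem_splits (l : List B) : ([], l) ∈ splits l := by
  induction l with
  | nil => simp [splits]
  | cons a l ih =>
    rw [splits, List.mem_append, List.mem_map, List.mem_map]
    exact Or.inr ⟨_, ih, rfl⟩

lemma exists_singleton_mem_splits {l : List B} {b : B} (h : b ∈ l) :
    ∃ l', ([b], l') ∈ splits l := by
  induction l with
  | nil => simp at h
  | cons a l ih =>
    rw [splits]
    rcases List.mem_cons.mp h with rfl | h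
    · exact ⟨l, List.mem_append_left _ (List.mem_map.mpr ⟨_, nil_mem_splits l, rfl⟩)⟩
    · obtain ⟨l', hl⟩ := ih h
      exact ⟨a :: l', List.mem_append_right _ (List.mem_map.mpr ⟨_, hl, rfl⟩)⟩

/-- The operator `T` on words is the derivation extending the operator `g` on letters. -/
def IsDer (T : Module.End ℚ (List S →₀ ℚ)) (g : Module.End ℚ (S →₀ ℚ)) : Prop :=
  ∀ x m, T (consMap ℚ S (x ⊗ₜ m)) = consMap ℚ S (g x ⊗ₜ m) + consMap ℚ S (x ⊗ₜ T m)

namespace IsDer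

variable {T T' : Module.End ℚ (List S →₀ ℚ)} {g g' : Module.End ℚ (S →₀ ℚ)}

lemma zero : IsDer (0 : Module.End ℚ (List S →₀ ℚ)) 0 := fun x m => by simp

lemma add (h : IsDer T g) (h' : IsDer T' g') : IsDer (T + T') (g + g') := fun x m => by
  simp only [LinearMap.add_apply, h x m, h' x m, TensorProduct.add_tmul, TensorProduct.tmul_add,
    map_add]
  abel

lemma sub (h : IsDer T g) (h' : IsDer T' g') : IsDer (T - T') (g - g') := fun x m => by
  simp only [LinearMap.sub_apply, h x m, h' x m, TensorProduct.sub_tmul, TensorProduct.tmul_sub,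
    map_sub]
  abel

lemma smul (c : ℚ) (h : IsDer T g) : IsDer (c • T) (c • g) := fun x m => by
  simp only [LinearMap.smul_apply, h x m, ← TensorProduct.smul_tmul', TensorProduct.tmul_smul,
    map_smul, smul_add]

lemma commutator (h : IsDer T g) (h' : IsDer T' g') : IsDer (T * T' - T' * T) (g * g' - g' * g) :=
  fun x m => by
    simp only [LinearMap.sub_apply, Module.End.mul_apply, h _ _, h' _ _, map_add,
      TensorProduct.sub_tmul, TensorProduct.tmul_sub, map_sub]
    abel

lemma wordOp (g : S → Option S) : IsDer (wordOp g 1 1) (letterOp ℚ g) := by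
  intro x m
  induction x using Finsupp.induction_linear with
  | zero => simp
  | add a b ha hb => simp only [TensorProduct.add_tmul, map_add, ha, hb]; abel
  | single s c =>
    induction m using Finsupp.induction_linear with
    | zero => simp
    | add a b ha hb => simp only [TensorProduct.tmul_add, map_add, ha, hb]; abel
    | single w d =>
      have e1 : (single s c : S →₀ ℚ) = c • single s 1 := by simp
      have e2 : (single w d : List S →₀ ℚ) = d • single w 1 := by simp
      rw [e1, e2]
      simp only [map_smul, ← TensorProduct.smul_tmul', TensorProduct.tmul_smul]
      rw [← smul_add, ← smul_add, consMap_tmul_single, consMap_tmul_single,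
          Finsupp.mapDomain_single,
        wordOp_single, wordOpFun_cons, wordOp_single, letterOp_single]
      cases g s with
      | none => simp
      | some t =>
        have h1 : (w.map (1 : S → ℚ)).prod = 1 :=
          List.prod_eq_one fun x hx => by
            obtain ⟨y, -, rfl⟩ := List.mem_map.mp hx
            rfl
        simp only [h1]
        simp [Finsupp.mapDomain_single]

variable {T : B → Module.End ℚ (List S →₀ ℚ)} {g : B → Module.End ℚ (S →₀ ℚ)}

lemma prod_apply (h : ∀ b, IsDer (T b) (g b)) (l : List B) (x : S →₀ ℚ) (m : List S →₀ ℚ) :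
    (l.map T).prod (consMap ℚ S (x ⊗ₜ m)) = ((splits l).map fun p =>
      consMap ℚ S ((p.1.map g).prod x ⊗ₜ (p.2.map T).prod m)).sum := by
  induction l with
  | nil => simp [splits]
  | cons a l ih =>
    rw [List.map_cons, List.prod_cons, Module.End.mul_apply, ih, map_list_sum, List.map_map,
      splits, List.map_append, List.sum_append, List.map_map, List.map_map, ← List.sum_map_add]
    congr 1
    refine List.map_congr_left fun p _ => ?_
    simp [h a _ _, Module.End.mul_apply]

end IsDer

lemma consMap_apply_cons (x : S →₀ ℚ) (m : List S →₀ ℚ) (t : S) (w : List S) :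
    consMap ℚ S (x ⊗ₜ m) (t :: w) = x t * m w := by
  induction x using Finsupp.induction_linear with
  | zero => simp
  | add a b ha hb => simp only [TensorProduct.add_tmul, map_add, Finsupp.add_apply, ha, hb, add_mul]
  | single s c =>
    have e1 : (single s c : S →₀ ℚ) = c • single s 1 := by simp
    rw [e1, ← TensorProduct.smul_tmul', map_smul, consMap_tmul_single, Finsupp.smul_apply,
      Finsupp.smul_apply, smul_eq_mul, smul_eq_mul, mul_assoc]
    congr 1
    by_cases hst : s = t
    · subst hst
      rw [Finsupp.mapDomain_apply (List.cons_injective), Finsupp.single_eq_same, one_mul]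
    · rw [Finsupp.single_eq_of_ne (Ne.symm hst), zero_mul, Finsupp.mapDomain_of_notMem_range]
      rintro ⟨u, hu⟩
      exact hst (List.cons.inj hu).1

/-- Each operator moves its own point to its target with coefficient one, and has coefficient
zero at the points of the other operators. -/
structure Detects (g : B → Module.End ℚ (S →₀ ℚ)) (src tgt : B → S) : Prop where
  ne : ∀ b, src b ≠ tgt b
  same : ∀ b, g b (single (src b) 1) (tgt b) = 1
  other : ∀ a b, a ≠ b → g a (single (src b) 1) (tgt b) = 0

/-- The matrix coefficients between words assembled from points detect products of derivations
up to permutation. -/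
lemma Detects.coeff {T : B → Module.End ℚ (List S →₀ ℚ)} {g : B → Module.End ℚ (S →₀ ℚ)}
    {src tgt : B → S} (hd : Detects g src tgt) (h : ∀ b, IsDer (T b) (g b)) (c d : List B)
    (hcd : d.length ≤ c.length) (u : List S) :
    0 ≤ (d.map T).prod (single (c.map src ++ u) 1) (c.map tgt ++ u) ∧
      ((d.map T).prod (single (c.map src ++ u) 1) (c.map tgt ++ u) ≠ 0 ↔ d.Perm c) := by
  induction c generalizing d with
  | nil =>
    obtain rfl : d = [] := List.length_eq_zero_iff.mp (by simpa using hcd)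
    simp
  | cons b c ih =>
    have e : (d.map T).prod (single ((b :: c).map src ++ u) 1) ((b :: c).map tgt ++ u) =
        ((splits d).map fun p => (p.1.map g).prod (single (src b) 1) (tgt b) *
          (p.2.map T).prod (single (c.map src ++ u) 1) (c.map tgt ++ u)).sum := by
      rw [List.map_cons, List.map_cons, List.cons_append, List.cons_append,
        ← consMap_single_tmul_single, IsDer.prod_apply h]
      have : ∀ L : List (List S →₀ ℚ), ∀ w, L.sum w = (L.map fun y => y w).sum := fun L w => by
        induction L with
        | nil => simp
        | cons y L ihL => simp [ihL]
      rw [this, List.map_map]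
      simp only [Function.comp_def, consMap_apply_cons]
    have key : ∀ p ∈ splits d,
        0 ≤ (p.1.map g).prod (single (src b) 1) (tgt b) *
          (p.2.map T).prod (single (c.map src ++ u) 1) (c.map tgt ++ u) ∧
        ((p.1.map g).prod (single (src b) 1) (tgt b) *
          (p.2.map T).prod (single (c.map src ++ u) 1) (c.map tgt ++ u) ≠ 0 ↔
            p.1 = [b] ∧ p.2.Perm c) := by
      rintro ⟨p, q⟩ hp
      have hl := (perm_of_mem_splits hp).length_eq
      simp only [List.length_append] at hl
      simp only [List.length_cons] at hcd
      match p with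
      | [] => simp [Finsupp.single_eq_of_ne (hd.ne b).symm]
      | [a] =>
        have hq := ih q (by simp only [List.length_singleton] at hl; omega)
        simp only [List.map_cons, List.map_nil, List.prod_singleton]
        by_cases hab : a = b
        · subst hab
          rw [hd.same, one_mul]
          exact ⟨hq.1, by simpa using hq.2⟩
        · simp [hd.other a b hab, hab]
      | a :: a' :: p' =>
        simp only [List.length_cons] at hl
        have hq := ih q (by omega)
        have hz : (q.map T).prod (single (c.map src ++ u) 1) (c.map tgt ++ u) = 0 := by
          by_contra hne
          have := (hq.2.mp hne).length_eq
          omega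
        simp [hz]
    rw [e]
    refine ⟨List.sum_nonneg fun x hx => ?_, ?_⟩
    · obtain ⟨p, hp, rfl⟩ := List.mem_map.mp hx
      exact (key p hp).1
    · constructor
      · intro hne
        obtain ⟨x, hx, hx0⟩ : ∃ x ∈ (splits d).map fun p =>
            (p.1.map g).prod (single (src b) 1) (tgt b) *
              (p.2.map T).prod (single (c.map src ++ u) 1) (c.map tgt ++ u), x ≠ 0 := by
          by_contra! hall
          exact hne (List.sum_eq_zero hall)
        obtain ⟨p, hp, rfl⟩ := List.mem_map.mp hx
        obtain ⟨h1, h2⟩ := (key p hp).2.mp hx0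
        refine (perm_of_mem_splits hp).trans ?_
        rw [h1]
        exact h2.cons b
      · intro hperm
        obtain ⟨q, hq⟩ := exists_singleton_mem_splits (hperm.mem_iff.mpr List.mem_cons_self)
        have hqc : q.Perm c := ((perm_of_mem_splits hq).symm.trans hperm).cons_inv
        have h0 := (key _ hq)
        have hpos := lt_of_le_of_ne h0.1 (Ne.symm (h0.2.mpr ⟨rfl, hqc⟩))
        refine (lt_of_lt_of_le hpos (List.single_le_sum (fun x hx => ?_) _
          (List.mem_map.mpr ⟨_, hq, rfl⟩))).ne'
        obtain ⟨p, hp, rfl⟩ := List.mem_map.mp hx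
        exact (key p hp).1

end Derivations

section RelatedRootVectors

variable {𝕜 𝕜' L L' : Type*} [Field 𝕜] [Field 𝕜'] [LieRing L] [LieRing L'] [Module 𝕜 L]
  [Module 𝕜' L'] {n : ℕ}

/-- A relation between two Lie rings compatible with the operations used to build root vectors. -/
structure LieRelation (𝕜 𝕜' : Type*) {L L' : Type*} [Field 𝕜] [Field 𝕜'] [LieRing L] [LieRing L']
    [Module 𝕜 L] [Module 𝕜' L'] (P : L → L' → Prop) : Prop where
  zero : P 0 0
  add : ∀ {x y x' y'}, P x x' → P y y' → P (x + y) (x' + y')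
  sub : ∀ {x y x' y'}, P x x' → P y y' → P (x - y) (x' - y')
  lie : ∀ {x y x' y'}, P x x' → P y y' → P ⁅x, y⁆ ⁅x', y'⁆
  smul : ∀ (k : ℕ) {x x'}, P x x' → P ((k : 𝕜)⁻¹ • x) ((k : 𝕜')⁻¹ • x')

variable {P : L → L' → Prop} {e : ZMod n → L} {e' : ZMod n → L'}

lemma LieRelation.rootVec (h : LieRelation 𝕜 𝕜' P) (he : ∀ i, P (e i) (e' i)) (m : ℕ)
    (i : ZMod n) : P (rootVec 𝕜 e m i) (rootVec 𝕜' e' m i) := by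
  induction m using Nat.strong_induction_on generalizing i with
  | _ m ih =>
    by_cases hm : m = 1
    · subst hm
      rw [rootVec_one, rootVec_one]
      exact he i
    · rw [rootVec_of_ne_one e hm, rootVec_of_ne_one e' hm]
      refine h.smul _ ?_
      have hsum : ∀ s ⊆ Finset.Ioo 0 m,
          P (∑ a ∈ s, ⁅_root_.rootVec 𝕜 e a i, _root_.rootVec 𝕜 e (m - a) (i + (a : ZMod n))⁆)
            (∑ a ∈ s, ⁅_root_.rootVec 𝕜' e' a i,
              _root_.rootVec 𝕜' e' (m - a) (i + (a : ZMod n))⁆) := by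
        intro s
        induction s using Finset.induction_on with
        | empty => exact fun _ => h.zero
        | insert a s ha ihs =>
          intro hs
          rw [Finset.sum_insert ha, Finset.sum_insert ha]
          have := Finset.mem_Ioo.mp (hs (Finset.mem_insert_self a s))
          exact h.add (h.lie (ih a this.2 _) (ih (m - a) (by omega) _))
            (ihs ((Finset.subset_insert a s).trans hs))
      exact hsum _ subset_rfl

lemma LieRelation.pbwVec (h : LieRelation 𝕜 𝕜' P) (he : ∀ i, P (e i) (e' i)) (p : RootIdx n) :
    P (pbwVec 𝕜 e p) (pbwVec 𝕜' e' p) := by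
  unfold _root_.pbwVec
  split_ifs
  · exact h.sub (h.rootVec he _ _) (h.rootVec he _ _)
  · exact h.sub (h.rootVec he _ _) h.zero

end RelatedRootVectors

section Specialization

open Polynomial
open Finsupp (single)

/-- The pairs of a rational function regular at `1` and its value there. -/
def spRing : Subring (Qv × ℚ) where
  carrier := {x | ∃ p s : ℚ[X], s.eval 1 ≠ 0 ∧ x.1 * algebraMap ℚ[X] Qv s = algebraMap ℚ[X] Qv p ∧
    x.2 * s.eval 1 = p.eval 1}
  mul_mem' := by
    rintro ⟨x, x'⟩ ⟨y, y'⟩ ⟨p, s, hs, h1, h2⟩ ⟨q, t, ht, h3, h4⟩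
    refine ⟨p * q, s * t, by simp [hs, ht], ?_, ?_⟩
    · simp only [Prod.mk_mul_mk, map_mul, ← h1, ← h3]; ring
    · simp only [Prod.mk_mul_mk, eval_mul, ← h2, ← h4]; ring
  one_mem' := ⟨1, 1, by simp⟩
  add_mem' := by
    rintro ⟨x, x'⟩ ⟨y, y'⟩ ⟨p, s, hs, h1, h2⟩ ⟨q, t, ht, h3, h4⟩
    refine ⟨p * t + q * s, s * t, by simp [hs, ht], ?_, ?_⟩
    · simp only [Prod.mk_add_mk, map_mul, map_add, ← h1, ← h3]; ring
    · simp only [Prod.mk_add_mk, eval_mul, eval_add, ← h2, ← h4]; ring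
  zero_mem' := ⟨0, 1, by simp⟩
  neg_mem' := by
    rintro ⟨x, x'⟩ ⟨p, s, hs, h1, h2⟩
    exact ⟨-p, s, hs, by simpa using h1, by simpa using h2⟩

lemma eq_zero_of_mem_spRing {y : ℚ} (h : ((0 : Qv), y) ∈ spRing) : y = 0 := by
  obtain ⟨p, s, hs, h1, h2⟩ := h
  have hp : p = 0 := (map_eq_zero_iff _ (RatFunc.algebraMap_injective ℚ)).mp (by simpa using h1.symm)
  simpa [hp, hs] using h2

lemma vv_pow_mem_spRing (k : ℤ) : (vv ^ k, (1 : ℚ)) ∈ spRing := by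
  obtain ⟨a, rfl | rfl⟩ := k.eq_nat_or_neg
  · exact ⟨X ^ a, 1, by simp, by simp [vv_eq], by simp⟩
  · refine ⟨1, X ^ a, by simp, ?_, by simp⟩
    rw [map_pow, ← vv_eq, zpow_neg, zpow_natCast, map_one, inv_mul_cancel₀]
    exact pow_ne_zero _ vv_ne_zero

lemma natCast_inv_mem_spRing (k : ℕ) : ((k : Qv)⁻¹, (k : ℚ)⁻¹) ∈ spRing :=
  ⟨C (k : ℚ)⁻¹, 1, by simp, by simp [RatFunc.algebraMap_C], by simp⟩

/-- The operator `t` over `ℚ` is the specialization of `T`. -/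
def OpSp {W : Type*} (T : Module.End Qv (W →₀ Qv)) (t : Module.End ℚ (W →₀ ℚ)) : Prop :=
  ∀ w w', (T (single w 1) w', t (single w 1) w') ∈ spRing

lemma end_apply_eq_sum {R W : Type*} [CommRing R] (T : Module.End R (W →₀ R)) {x : W →₀ R}
    {s : Finset W} (hs : x.support ⊆ s) (w : W) :
    T x w = ∑ u ∈ s, x u * T (single u 1) w := by
  conv_lhs => rw [← Finsupp.sum_single x]
  rw [Finsupp.sum_of_support_subset x hs _ (by simp), map_sum, Finsupp.finsetSum_apply]
  refine Finset.sum_congr rfl fun u _ => ?_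
  have : (single u (x u) : W →₀ R) = x u • single u 1 := by simp
  rw [this, map_smul, Finsupp.smul_apply, smul_eq_mul]

namespace OpSp

variable {W : Type*} {T T' : Module.End Qv (W →₀ Qv)} {t t' : Module.End ℚ (W →₀ ℚ)}

lemma zero : OpSp (0 : Module.End Qv (W →₀ Qv)) 0 := fun _ _ => spRing.zero_mem

lemma one : OpSp (1 : Module.End Qv (W →₀ Qv)) 1 := fun w w' => by
  classical
  simp only [Module.End.one_apply, Finsupp.single_apply]
  split_ifs
  · exact spRing.one_mem
  · exact spRing.zero_mem

lemma add (h : OpSp T t) (h' : OpSp T' t') : OpSp (T + T') (t + t') :=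
  fun w w' => spRing.add_mem (h w w') (h' w w')

lemma sub (h : OpSp T t) (h' : OpSp T' t') : OpSp (T - T') (t - t') :=
  fun w w' => spRing.sub_mem (h w w') (h' w w')

lemma smul (k : ℕ) (h : OpSp T t) : OpSp ((k : Qv)⁻¹ • T) ((k : ℚ)⁻¹ • t) :=
  fun w w' => spRing.mul_mem (natCast_inv_mem_spRing k) (h w w')

lemma mul (h : OpSp T t) (h' : OpSp T' t') : OpSp (T * T') (t * t') := fun w w' => by
  classical
  rw [Module.End.mul_apply, Module.End.mul_apply,
    end_apply_eq_sum T (Finset.subset_union_left (s₂ := (t' (single w 1)).support)),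
    end_apply_eq_sum t (Finset.subset_union_right (s₁ := (T' (single w 1)).support))]
  have := spRing.sum_mem (t := (T' (single w 1)).support ∪ (t' (single w 1)).support)
    (f := fun u => (T' (single w 1) u, t' (single w 1) u) * (T (single u 1) w', t (single u 1) w'))
    fun u _ => spRing.mul_mem (h' w u) (h u w')
  convert this using 1
  simp [Prod.ext_iff, Prod.fst_sum, Prod.snd_sum]

lemma list_prod {B : Type*} {T : B → Module.End Qv (W →₀ Qv)} {t : B → Module.End ℚ (W →₀ ℚ)}
    (h : ∀ b, OpSp (T b) (t b)) (l : List B) : OpSp (l.map T).prod (l.map t).prod := by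
  induction l with
  | nil => exact one
  | cons b l ih =>
    rw [List.map_cons, List.map_cons, List.prod_cons, List.prod_cons]
    exact (h b).mul ih

lemma wordOp {S : Type*} (g : S → Option S) {α β : S → Qv} (hα : ∀ s, (α s, (1 : ℚ)) ∈ spRing)
    (hβ : ∀ s, (β s, (1 : ℚ)) ∈ spRing) : OpSp (wordOp g α β) (_root_.wordOp g 1 1) := by
  classical
  intro w w'
  rw [wordOp_single, wordOp_single]
  induction w generalizing w' with
  | nil => exact spRing.zero_mem
  | cons s w ih =>
    rw [wordOpFun_cons, wordOpFun_cons]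
    have h1 : ((w.map α).prod, (w.map (1 : S → ℚ)).prod) ∈ spRing := by
      clear ih
      induction w with
      | nil => exact spRing.one_mem
      | cons a w ih => exact spRing.mul_mem (hα a) ih
    refine spRing.add_mem (x := (_, _)) (y := (_, _)) ?_
      (spRing.mul_mem (x := (_, _)) (y := (_, _)) (hβ s) ?_)
    · cases g s with
      | none => exact spRing.zero_mem
      | some t =>
        simp only [Option.elim, Finsupp.single_apply]
        split_ifs
        · exact h1
        · exact spRing.zero_mem
    · cases w' with
      | nil => 
        rw [Finsupp.mapDomain_of_notMem_range _ _ (by simp),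
            Finsupp.mapDomain_of_notMem_range _ _ (by simp)]
        exact spRing.zero_mem
      | cons a w' =>
        by_cases ha : s = a
        · subst ha
          rw [Finsupp.mapDomain_apply List.cons_injective,
              Finsupp.mapDomain_apply List.cons_injective]
          exact ih w'
        · rw [Finsupp.mapDomain_of_notMem_range _ _ (by simp [ha]),
            Finsupp.mapDomain_of_notMem_range _ _ (by simp [ha])]
          exact spRing.zero_mem

end OpSp

end Specialization

section MatrixUnits

variable {n : ℕ} {A : Type*} [Ring A] [Algebra ℚ A]

attribute [local instance] LieRing.ofAssociativeRing

lemma lie_sub_sub_of_commute {x y z w : A} (hzy : Commute z y) (hxw : Commute x w)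
    (hzw : Commute z w) : ⁅x - z, y - w⁆ = ⁅x, y⁆ := by
  simp only [Ring.lie_def, sub_mul, mul_sub, hzy.eq, hxw.eq, hzw.eq]
  abel

/-- The root vectors in a loop algebra of matrix units. -/
lemma rootVec_matrixUnits [NeZero n] (hn : 2 ≤ n) (M : ZMod n → ℕ → A)
    (hM : ∀ i a j b, M i a * M j b = if i + a = j then M i (a + b) else 0) (m : ℕ) (hm : 0 < m)
    (i : ZMod n) :
    rootVec ℚ (fun i => M i 1) m i =
      M i m - if n ∣ m then (n : ℚ)⁻¹ • ∑ j, M j m else 0 := by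
  have hcast : ∀ m : ℕ, n ∣ m → (m : ZMod n) = 0 := fun m h => (ZMod.natCast_eq_zero_iff m n).mpr h
  set Z : ℕ → A := fun m => if n ∣ m then (n : ℚ)⁻¹ • ∑ j, M j m else 0 with hZ
  have hcomm : ∀ m i a, Commute (Z m) (M i a) := by
    intro m i a
    simp only [hZ]
    split_ifs with h
    · refine Commute.smul_left ?_ _
      simp [commute_iff_eq, Finset.sum_mul, Finset.mul_sum, hM, hcast m h, add_comm]
    · exact Commute.zero_left _
  have hcomm' : ∀ m m', Commute (Z m) (Z m') := by
    intro m m'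
    rw [show Z m' = if n ∣ m' then (n : ℚ)⁻¹ • ∑ j, M j m' else 0 from rfl]
    split_ifs
    · exact (Commute.sum_right _ _ _ fun j _ => hcomm m j m').smul_right _
    · exact Commute.zero_right _
  induction m using Nat.strong_induction_on generalizing i with
  | _ m ih =>
    by_cases hm1 : m = 1
    · subst hm1
      rw [rootVec_one, if_neg (by rw [Nat.dvd_one]; omega), sub_zero]
    rw [rootVec_of_ne_one _ hm1]
    have key : ∀ a ∈ Finset.Ioo 0 m, ⁅rootVec ℚ (fun i => M i 1) a i,
        rootVec ℚ (fun i => M i 1) (m - a) (i + (a : ZMod n))⁆ =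
        M i m - if n ∣ m then M (i + (a : ZMod n)) m else 0 := by
      intro a ha
      have ha := Finset.mem_Ioo.mp ha
      rw [ih a ha.2 ha.1, ih (m - a) (by omega) (by omega),
        lie_sub_sub_of_commute (hcomm _ _ _) (hcomm _ _ _).symm (hcomm' _ _), Ring.lie_def, hM, hM,
        if_pos rfl, Nat.add_sub_cancel' ha.2.le, Nat.sub_add_cancel ha.2.le,
        add_assoc, ← Nat.cast_add, Nat.add_sub_cancel' ha.2.le]
      simp only [add_eq_left, ZMod.natCast_eq_zero_iff]
    rw [Finset.sum_congr rfl key, affC]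
    have hcard : (Finset.Ioo 0 m).card = m - 1 := by simp
    by_cases h : n ∣ m
    · simp only [if_pos h]
      set G : ZMod n → A := fun i => ∑ a ∈ Finset.range m, M (i + (a : ZMod n)) m with hG
      have hG1 : ∀ i, G (i + 1) = G i := by
        intro i
        have e1 := Finset.sum_range_succ (fun a : ℕ => M (i + (a : ZMod n)) m) m
        rw [Finset.sum_range_succ'] at e1
        rw [hcast m h, Nat.cast_zero] at e1
        have e2 := add_right_cancel e1
        rw [hG]
        simp only
        rw [← e2]
        refine Finset.sum_congr rfl fun a _ => ?_
        rw [Nat.cast_succ, add_assoc, add_comm (1 : ZMod n)]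
      have hGc : ∀ k : ℕ, ∀ i, G (i + k) = G i := by
        intro k
        induction k with
        | zero => simp
        | succ k ihk => intro i; rw [Nat.cast_succ, ← add_assoc, hG1, ihk]
      have hGi : ∀ j, G j = G i := by
        intro j
        have := hGc (j - i).val i
        rwa [ZMod.natCast_zmod_val, add_sub_cancel] at this
      have hsum : (n : ℚ) • G i = (m : ℚ) • ∑ j, M j m := by
        have e1 : ∑ j, G j = (n : ℚ) • G i := by
          rw [Finset.sum_congr rfl fun j _ => hGi j]
          simp [ZMod.card, Nat.cast_smul_eq_nsmul]
        rw [← e1, hG]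
        simp only
        have e2 : ∀ a ∈ Finset.range m, ∑ j, M (j + (a : ZMod n)) m = ∑ j, M j m := fun a _ =>
          Equiv.sum_comp (Equiv.addRight (a : ZMod n)) (fun j => M j m)
        rw [Finset.sum_comm, Finset.sum_congr rfl e2]
        simp [Nat.cast_smul_eq_nsmul]
      have hsplit : G i = M i m + ∑ a ∈ Finset.Ioo 0 m, M (i + (a : ZMod n)) m := by
        rw [hG]
        simp only
        rw [Finset.range_eq_Ico, Finset.sum_eq_sum_Ico_succ_bot hm, Nat.cast_zero, add_zero]
        rfl
      have hn0 : (n : ℚ) ≠ 0 := by positivity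
      have hm0 : (m : ℚ) ≠ 0 := by positivity
      have hGval : G i = ((n : ℚ)⁻¹ * m) • ∑ j, M j m := by
        rw [mul_smul, ← hsum, inv_smul_smul₀ hn0]
      rw [Finset.sum_sub_distrib, Finset.sum_const, hcard, ← Nat.cast_smul_eq_nsmul ℚ,
        eq_sub_of_add_eq' hsplit.symm, hGval, Nat.cast_sub hm]
      match_scalars
      · field_simp; ring
      · field_simp
    · have hZm : Z m = 0 := if_neg h
      have hm0 : ((m - 1 : ℕ) : ℚ) ≠ 0 := by
        have : m - 1 ≠ 0 := by omega
        exact_mod_cast this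
      simp only [if_neg h, sub_zero, Finset.sum_const, hcard]
      rw [← Nat.cast_smul_eq_nsmul ℚ, inv_smul_smul₀ hm0]

lemma pbwVec_matrixUnits [NeZero n] (hn : 2 ≤ n) (M : ZMod n → ℕ → A)
    (hM : ∀ i a j b, M i a * M j b = if i + a = j then M i (a + b) else 0) (p : RootIdx n) :
    pbwVec ℚ (fun i => M i 1) p = M p.1.1 p.1.2 - if n ∣ p.1.2 then M 0 p.1.2 else 0 := by
  unfold pbwVec
  split_ifs with h <;> simp [rootVec_matrixUnits hn M hM _ p.2.1, h]

end MatrixUnits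

section LetterRoots

open Finsupp (single)

attribute [local instance] LieRing.ofAssociativeRing

variable {n : ℕ}

/-- The partial maps on letters underlying the root vectors built from the `E i`. -/
def lowerBy (i : ZMod n) (a : ℕ) (s : Letter n) : Option (Letter n) :=
  if s.1 = i + a then Option.some (i, s.2 - a) else Option.none

/-- The partial maps on letters underlying the root vectors built from the `F i`. -/
def raiseBy (i : ZMod n) (a : ℕ) (s : Letter n) : Option (Letter n) :=
  if s.1 = -i - a then Option.some (-i, s.2 + a) else Option.none

lemma lowerBy_eq_some {i : ZMod n} {a : ℕ} {s t : Letter n} :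
    lowerBy i a s = Option.some t ↔ s.1 = i + a ∧ i = t.1 ∧ s.2 - a = t.2 := by
  simp [lowerBy, Prod.ext_iff]

lemma raiseBy_eq_some {i : ZMod n} {a : ℕ} {s t : Letter n} :
    raiseBy i a s = Option.some t ↔ s.1 = -i - a ∧ -i = t.1 ∧ s.2 + a = t.2 := by
  simp [raiseBy, Prod.ext_iff]

lemma letterOp_apply (g : Letter n → Option (Letter n)) (s t : Letter n) :
    letterOp ℚ g (single s 1) t = if g s = Option.some t then 1 else 0 := by
  classical
  rw [letterOp_single]
  cases g s with
  | none => simp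
  | some u => simp [Finsupp.single_apply]

lemma letterOp_mul (g h : Letter n → Option (Letter n)) :
    letterOp ℚ g * letterOp ℚ h = letterOp ℚ fun s => (h s).bind g := by
  refine Finsupp.lhom_ext' fun s => LinearMap.ext_ring ?_
  simp only [LinearMap.comp_apply, Finsupp.lsingle_apply, Module.End.mul_apply]
  rw [letterOp_single, letterOp_single]
  cases h s with
  | none => simp
  | some u => simp [letterOp_single]

lemma letterOp_none : letterOp ℚ (fun _ : Letter n => Option.none) = 0 := by
  refine Finsupp.lhom_ext' fun s => LinearMap.ext_ring ?_
  simp [letterOp_single]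

lemma letterOp_lowerBy_mul (i : ZMod n) (a : ℕ) (j : ZMod n) (b : ℕ) :
    letterOp ℚ (lowerBy i a) * letterOp ℚ (lowerBy j b) =
      if i + a = j then letterOp ℚ (lowerBy i (a + b)) else 0 := by
  rw [letterOp_mul]
  split_ifs with h
  · congr 1
    funext s
    subst h
    simp only [lowerBy, Nat.cast_add, ← add_assoc]
    split_ifs <;> simp [lowerBy, sub_sub, add_comm]
  · rw [← letterOp_none]
    congr 1
    funext s
    simp only [lowerBy]
    split_ifs <;> simp [lowerBy, Ne.symm h]

lemma letterOp_raiseBy_mul (i : ZMod n) (a : ℕ) (j : ZMod n) (b : ℕ) :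
    letterOp ℚ (raiseBy i a) * letterOp ℚ (raiseBy j b) =
      if i + a = j then letterOp ℚ (raiseBy i (a + b)) else 0 := by
  rw [letterOp_mul]
  split_ifs with h
  · congr 1
    funext s
    subst h
    simp only [raiseBy, Nat.cast_add, ← sub_sub, neg_add]
    split_ifs <;> simp_all [raiseBy, add_assoc, add_comm, add_left_comm, sub_eq_add_neg]
  · rw [← letterOp_none]
    congr 1
    funext s
    have h' : -j ≠ -i - a := fun h' => h (by rw [← neg_inj, h']; ring)
    simp only [raiseBy]
    split_ifs <;> simp [raiseBy, h']

/-- The root vectors acting on letters; `inl` indexes those built from the `F i`, `inr` those built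
from the `E i`. -/
def letterRoot (n : ℕ) : RootIdx n ⊕ RootIdx n → Module.End ℚ (Letter n →₀ ℚ) :=
  Sum.elim (pbwVec ℚ fun i => letterOp ℚ (raise 1 (-i - 1)))
    (pbwVec ℚ fun i => letterOp ℚ (lower 1 i))

/-- The letter at which a root vector is tested. -/
def rootSrc (n : ℕ) : RootIdx n ⊕ RootIdx n → Letter n :=
  Sum.elim (fun p => (-p.1.1 - p.1.2, 0)) fun p => (p.1.1 + p.1.2, 0)

/-- The letter to which a root vector moves its source. -/
def rootTgt (n : ℕ) : RootIdx n ⊕ RootIdx n → Letter n :=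
  Sum.elim (fun p => (-p.1.1, p.1.2)) fun p => (p.1.1, -p.1.2)

lemma letterRoot_inl [NeZero n] (hn : 2 ≤ n) (p : RootIdx n) :
    letterRoot n (Sum.inl p) = letterOp ℚ (raiseBy p.1.1 p.1.2) -
      if n ∣ p.1.2 then letterOp ℚ (raiseBy 0 p.1.2) else 0 := by
  rw [← pbwVec_matrixUnits hn (fun i a => letterOp ℚ (raiseBy i a)) letterOp_raiseBy_mul p]
  simp only [letterRoot, Sum.elim_inl]
  congr 1
  funext i
  congr 1
  funext s
  simp [raise, raiseBy]

lemma letterRoot_inr [NeZero n] (hn : 2 ≤ n) (p : RootIdx n) :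
    letterRoot n (Sum.inr p) = letterOp ℚ (lowerBy p.1.1 p.1.2) -
      if n ∣ p.1.2 then letterOp ℚ (lowerBy 0 p.1.2) else 0 := by
  rw [← pbwVec_matrixUnits hn (fun i a => letterOp ℚ (lowerBy i a)) letterOp_lowerBy_mul p]
  simp only [letterRoot, Sum.elim_inr]
  congr 1
  funext i
  congr 1
  funext s
  simp [lower, lowerBy]

lemma letterRoot_inl_apply [NeZero n] (hn : 2 ≤ n) (p : RootIdx n) (s t : Letter n) :
    letterRoot n (Sum.inl p) (single s 1) t = (if raiseBy p.1.1 p.1.2 s = Option.some t then 1 else 0) -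
      if n ∣ p.1.2 ∧ raiseBy 0 p.1.2 s = Option.some t then 1 else 0 := by
  rw [letterRoot_inl hn]
  by_cases h : n ∣ p.1.2 <;> simp [h, letterOp_apply]

lemma letterRoot_inr_apply [NeZero n] (hn : 2 ≤ n) (p : RootIdx n) (s t : Letter n) :
    letterRoot n (Sum.inr p) (single s 1) t = (if lowerBy p.1.1 p.1.2 s = Option.some t then 1 else 0) -
      if n ∣ p.1.2 ∧ lowerBy 0 p.1.2 s = Option.some t then 1 else 0 := by
  rw [letterRoot_inr hn]
  by_cases h : n ∣ p.1.2 <;> simp [h, letterOp_apply]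

lemma detects_letterRoot [NeZero n] (hn : 2 ≤ n) :
    Detects (letterRoot n) (rootSrc n) (rootTgt n) where
  ne b := by
    obtain p | p := b <;> have hp := p.2.1 <;>
      simp only [rootSrc, rootTgt, Sum.elim_inl, Sum.elim_inr, ne_eq, Prod.mk.injEq, not_and] <;>
      intro _ <;> omega
  same b := by
    obtain p | p := b
    · rw [letterRoot_inl_apply hn, if_pos, if_neg, sub_zero]
      · rintro ⟨h, h'⟩
        simp only [raiseBy_eq_some, rootSrc, rootTgt, Sum.elim_inl] at h'
        exact p.2.2 h (neg_eq_zero.mp (h'.2.1.symm.trans neg_zero))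
      · simp [raiseBy_eq_some, rootSrc, rootTgt]
    · rw [letterRoot_inr_apply hn, if_pos, if_neg, sub_zero]
      · rintro ⟨h, h'⟩
        simp only [lowerBy_eq_some, rootSrc, rootTgt, Sum.elim_inr] at h'
        exact p.2.2 h h'.2.1.symm
      · simp [lowerBy_eq_some, rootSrc, rootTgt]
  other b c hbc := by
    obtain p | p := b <;> obtain q | q := c <;> have hp := p.2.1 <;> have hq := q.2.1
    · rw [letterRoot_inl_apply hn, if_neg, if_neg, sub_zero]
      · rintro ⟨h, h'⟩
        simp only [raiseBy_eq_some, rootSrc, rootTgt, Sum.elim_inl] at h'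
        have hpq : p.1.2 = q.1.2 := by omega
        exact q.2.2 (hpq ▸ h) (neg_eq_zero.mp (h'.2.1.symm.trans neg_zero))
      · intro h'
        simp only [raiseBy_eq_some, rootSrc, rootTgt, Sum.elim_inl] at h'
        have hpq : p.1.2 = q.1.2 := by omega
        exact hbc (congrArg Sum.inl (Subtype.ext (Prod.ext (neg_inj.mp h'.2.1) hpq)))
    · rw [letterRoot_inl_apply hn, if_neg, if_neg, sub_zero]
      all_goals
        simp only [raiseBy_eq_some, rootSrc, rootTgt, Sum.elim_inr]
        omega
    · rw [letterRoot_inr_apply hn, if_neg, if_neg, sub_zero]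
      all_goals
        simp only [lowerBy_eq_some, rootSrc, rootTgt, Sum.elim_inl]
        omega
    · rw [letterRoot_inr_apply hn, if_neg, if_neg, sub_zero]
      · rintro ⟨h, h'⟩
        simp only [lowerBy_eq_some, rootSrc, rootTgt, Sum.elim_inr] at h'
        have hpq : p.1.2 = q.1.2 := by omega
        exact q.2.2 (hpq ▸ h) h'.2.1.symm
      · intro h'
        simp only [lowerBy_eq_some, rootSrc, rootTgt, Sum.elim_inr] at h'
        have hpq : p.1.2 = q.1.2 := by omega
        exact hbc (congrArg Sum.inr (Subtype.ext (Prod.ext h'.2.1 hpq)))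

end LetterRoots

section Independence

open Finsupp (single)

attribute [local instance] LieRing.ofAssociativeRing

lemma Matrix.det_ne_zero_of_size {P : Type*} [Fintype P] [DecidableEq P] (m : Matrix P P ℚ)
    (size : P → ℕ) (h : ∀ γ α, size α ≤ size γ → (m γ α ≠ 0 ↔ α = γ)) : m.det ≠ 0 := by
  intro hdet
  obtain ⟨y, hy, hmy⟩ := Matrix.exists_mulVec_eq_zero_iff.mpr hdet
  obtain ⟨γ₀, hγ₀⟩ := Function.ne_iff.mp hy
  obtain ⟨γ, hγ, hmax⟩ := (Finset.univ.filter fun γ => y γ ≠ 0).exists_max_image size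
    ⟨γ₀, by simpa using hγ₀⟩
  simp only [Finset.mem_filter, Finset.mem_univ, true_and] at hγ hmax
  have h1 := congrFun hmy γ
  rw [Matrix.mulVec, dotProduct, Finset.sum_eq_single γ, Pi.zero_apply] at h1
  · exact mul_ne_zero ((h γ γ le_rfl).mpr rfl) hγ h1
  · intro α _ hα
    by_cases hyα : y α = 0
    · rw [hyα, mul_zero]
    · have := (h γ α (hmax α hyα)).not.mpr hα
      rw [not_not.mp this, zero_mul]
  · simp

lemma det_mem_spRing {P : Type*} [Fintype P] [DecidableEq P] {M : Matrix P P Qv}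
    {m : Matrix P P ℚ} (h : ∀ γ α, (M γ α, m γ α) ∈ spRing) : (M.det, m.det) ∈ spRing := by
  set N : Matrix P P spRing := fun γ α => ⟨(M γ α, m γ α), h γ α⟩
  have h1 : M.det = ((N.det : spRing) : Qv × ℚ).1 :=
    (((RingHom.fst Qv ℚ).comp spRing.subtype).map_det N).symm
  have h2 : m.det = ((N.det : spRing) : Qv × ℚ).2 :=
    (((RingHom.snd Qv ℚ).comp spRing.subtype).map_det N).symm
  rw [h1, h2]
  exact N.det.2

variable {n : ℕ}

/-- The root vectors acting on words. -/
def wordRoot (n : ℕ) : RootIdx n ⊕ RootIdx n → Module.End Qv (WordSpace n) :=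
  Sum.elim (pbwVec Qv fun i => wordF 1 (-i - 1)) (pbwVec Qv fun i => wordE 1 i)

/-- The root vectors acting on words, at `v = 1`. -/
def wordRootOne (n : ℕ) : RootIdx n ⊕ RootIdx n → Module.End ℚ (List (Letter n) →₀ ℚ) :=
  Sum.elim (pbwVec ℚ fun i => wordOp (raise 1 (-i - 1)) 1 1)
    (pbwVec ℚ fun i => wordOp (lower 1 i) 1 1)

lemma opSp_wordRoot (b : RootIdx n ⊕ RootIdx n) : OpSp (wordRoot n b) (wordRootOne n b) := by
  have hrel : LieRelation Qv ℚ (OpSp (W := List (Letter n))) :=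
    { zero := OpSp.zero, add := OpSp.add, sub := OpSp.sub, smul := fun k _ _ h => h.smul k
      lie := fun h h' => (h.mul h').sub (h'.mul h) }
  have hk : ∀ (i : ZMod n) s, (kappa i s, (1 : ℚ)) ∈ spRing := fun i s => vv_pow_mem_spRing _
  have hk' : ∀ (i : ZMod n) s, ((kappa i)⁻¹ s, (1 : ℚ)) ∈ spRing := fun i s => by
    rw [Pi.inv_apply, kappa, ← zpow_neg]
    exact vv_pow_mem_spRing _
  have h1 : ∀ s : Letter n, ((1 : Letter n → Qv) s, (1 : ℚ)) ∈ spRing := fun s => spRing.one_mem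
  obtain p | p := b
  · exact hrel.pbwVec (fun i => OpSp.wordOp _ (hk' _) h1) p
  · exact hrel.pbwVec (fun i => OpSp.wordOp _ h1 (hk _)) p

lemma isDer_wordRootOne (b : RootIdx n ⊕ RootIdx n) :
    IsDer (wordRootOne n b) (letterRoot n b) := by
  have hrel : LieRelation ℚ ℚ (IsDer (S := Letter n)) :=
    { zero := IsDer.zero, add := IsDer.add, sub := IsDer.sub, smul := fun _ _ _ h => h.smul _
      lie := IsDer.commutator }
  obtain p | p := b
  · exact hrel.pbwVec (fun i => IsDer.wordOp _) p
  · exact hrel.pbwVec (fun i => IsDer.wordOp _) p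

/-- The list of root vectors in a PBW monomial. -/
def rootList (α : Multiset (RootIdx n) × Multiset (RootIdx n)) : List (RootIdx n ⊕ RootIdx n) :=
  α.1.toList.map Sum.inl ++ α.2.toList.map Sum.inr

lemma rootList_perm_iff (α β : Multiset (RootIdx n) × Multiset (RootIdx n)) :
    (rootList α).Perm (rootList β) ↔ α = β := by
  refine ⟨fun h => ?_, fun h => h ▸ List.Perm.refl _⟩
  have h1 := Multiset.coe_eq_coe.mpr (h.filterMap Sum.getLeft?)
  have h2 := Multiset.coe_eq_coe.mpr (h.filterMap Sum.getRight?)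
  simp only [rootList, List.filterMap_append, List.filterMap_map, Function.comp_def,
    Sum.getLeft?_inl, Sum.getLeft?_inr, Sum.getRight?_inl, Sum.getRight?_inr,
    List.filterMap_some, List.filterMap_none, List.append_nil, List.nil_append,
    Multiset.coe_toList] at h1 h2
  exact Prod.ext h1 h2

/-- The character of the torus element of weight `μ` on letters. -/
def torusChar (μ : ZMod n → Multiplicative ℤ) (s : Letter n) : Qv := vv ^ (μ s.1).toAdd

lemma vv_zpow_injective : Function.Injective fun k : ℤ => vv ^ k := by
  intro a b h
  by_contra hab
  have h1 : vv ^ (a - b) = 1 := by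
    simp only at h
    rw [zpow_sub₀ vv_ne_zero, h, div_self (zpow_ne_zero _ vv_ne_zero)]
  refine vv_pow_ne_one (Int.natAbs_ne_zero.mpr (sub_ne_zero.mpr hab)) ?_
  rw [← zpow_natCast]
  rcases Int.natAbs_eq (a - b) with h2 | h2
  · rwa [← h2]
  · rw [← inv_inj, ← zpow_neg, ← h2, h1, inv_one]

/-- A linear dependency between monomials in the root vectors and the torus is trivial. -/
lemma wordMonomials_independent [NeZero n] (hn : 2 ≤ n)
    (c : (Multiset (RootIdx n) × Multiset (RootIdx n)) × (ZMod n → Multiplicative ℤ) →₀ Qv)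
    (hc : ∑ p ∈ c.support, c p • (((rootList p.1).map (wordRoot n)).prod *
      wordDiag (torusChar p.2) : Module.End Qv (WordSpace n)) = 0) : c = 0 := by
  classical
  set P := c.support.image Prod.fst with hP
  set T := c.support.image Prod.snd with hT
  set D := fun α => ((rootList α).map (wordRoot n)).prod with hD
  set pad := fun κ : FreeMonoid (ZMod n) => κ.toList.map fun j => ((j, 0) : Letter n) with hpad
  set rest := fun γ => (P.erase γ).toList.flatMap fun γ' => (rootList γ').map (rootSrc n)
  set W := fun μ : ZMod n → Multiplicative ℤ =>
    ∏ γ ∈ P, (((rootList γ).map (rootSrc n)).map (torusChar μ)).prod with hW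
  set χ := fun μ : ZMod n → Multiplicative ℤ =>
    FreeMonoid.lift fun j => (vv ^ (μ j).toAdd : Qv) with hχ
  have hχinj : Function.Injective χ := by
    intro μ ν h
    funext j
    have := DFunLike.congr_fun h (FreeMonoid.of j)
    simp only [hχ, FreeMonoid.lift_eval_of] at this
    exact Multiplicative.toAdd.injective (vv_zpow_injective this)
  have hweight : ∀ κ, ∀ γ ∈ P, ∀ μ, ((((rootList γ).map (rootSrc n)) ++ (rest γ ++ pad κ)).map
      (torusChar μ)).prod = W μ * χ μ κ := by
    intro κ γ hγ μ
    rw [List.map_append, List.prod_append, List.map_append, List.prod_append, ← mul_assoc]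
    congr 1
    · rw [hW]
      simp only
      rw [← Finset.mul_prod_erase P _ hγ]
      congr 1
      rw [List.map_flatMap, List.flatMap_def, List.prod_flatten, List.map_map]
      exact Finset.prod_map_toList (P.erase γ) fun γ =>
        (((rootList γ).map (rootSrc n)).map (torusChar μ)).prod
    · simp [hpad, hχ, FreeMonoid.lift_apply, torusChar, Function.comp_def]
  have hy : ∀ κ, ∀ α ∈ P, ∑ μ ∈ T, c (α, μ) * (W μ * χ μ κ) = 0 := by
    intro κ
    set M : Matrix P P Qv := fun γ α => D α (single ((rootList γ.1).map (rootSrc n) ++ (rest γ ++ pad κ)) 1)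
      ((rootList γ.1).map (rootTgt n) ++ (rest γ ++ pad κ)) with hM
    set m : Matrix P P ℚ := fun γ α => ((rootList α.1).map (wordRootOne n)).prod
      (single ((rootList γ.1).map (rootSrc n) ++ (rest γ ++ pad κ)) 1)
      ((rootList γ.1).map (rootTgt n) ++ (rest γ ++ pad κ)) with hm
    have hdet : M.det ≠ 0 := by
      intro h0
      have hm0 : m.det ≠ 0 := by
        refine Matrix.det_ne_zero_of_size m (fun γ => (rootList γ.1).length) fun γ α hle => ?_
        rw [Subtype.ext_iff, ← rootList_perm_iff]
        exact ((detects_letterRoot hn).coeff isDer_wordRootOne (rootList γ.1) (rootList α.1) hle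
          _).2
      have := det_mem_spRing (M := M) (m := m) fun γ α => OpSp.list_prod opSp_wordRoot _ _ _
      rw [h0] at this
      exact hm0 (eq_zero_of_mem_spRing this)
    have hMy : M.mulVec (fun α => ∑ μ ∈ T, c (α.1, μ) * (W μ * χ μ κ)) = 0 := by
      funext γ
      have h1 := congrArg (fun f : Module.End Qv (WordSpace n) =>
        f (single ((rootList γ.1).map (rootSrc n) ++ (rest γ ++ pad κ)) 1)
          ((rootList γ.1).map (rootTgt n) ++ (rest γ ++ pad κ))) hc
      simp only [LinearMap.sum_apply, Finsupp.finsetSum_apply, LinearMap.zero_apply,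
        Finsupp.zero_apply] at h1
      have hterm : ∀ p : (Multiset (RootIdx n) × Multiset (RootIdx n)) × (ZMod n → Multiplicative ℤ),
          (c p • (((rootList p.1).map (wordRoot n)).prod * wordDiag (torusChar p.2) :
            Module.End Qv (WordSpace n)))
            (single ((rootList γ.1).map (rootSrc n) ++ (rest γ ++ pad κ)) 1)
            ((rootList γ.1).map (rootTgt n) ++ (rest γ ++ pad κ)) =
          D p.1 (single ((rootList γ.1).map (rootSrc n) ++ (rest γ ++ pad κ)) 1)
            ((rootList γ.1).map (rootTgt n) ++ (rest γ ++ pad κ)) *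
            (c p * (W p.2 * χ p.2 κ)) := by
        intro p
        rw [LinearMap.smul_apply, Module.End.mul_apply, wordDiag_single, hweight κ γ.1 γ.2, mul_one]
        have e1 : ∀ w : List (Letter n), ∀ x : Qv, (single w x : WordSpace n) = x • single w 1 := by
          simp
        rw [e1, map_smul, Finsupp.smul_apply, Finsupp.smul_apply, smul_eq_mul, smul_eq_mul]
        ring
      rw [Finset.sum_congr rfl fun p _ => hterm p, Finset.sum_subset
        (show c.support ⊆ P ×ˢ T from fun p hp => Finset.mem_product.mpr
          ⟨Finset.mem_image_of_mem _ hp, Finset.mem_image_of_mem _ hp⟩)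
        (fun p _ hp => by rw [Finsupp.notMem_support_iff.mp hp, zero_mul, mul_zero]),
        Finset.sum_product] at h1
      rw [Matrix.mulVec, dotProduct, Pi.zero_apply, ← h1, Finset.sum_coe_sort P fun α =>
        D α (single ((rootList γ.1).map (rootSrc n) ++ (rest γ ++ pad κ)) 1)
          ((rootList γ.1).map (rootTgt n) ++ (rest γ ++ pad κ)) *
          ∑ μ ∈ T, c (α, μ) * (W μ * χ μ κ)]
      exact Finset.sum_congr rfl fun α _ => Finset.mul_sum _ _ _
    intro α hα
    have := congrFun (Matrix.eq_zero_of_mulVec_eq_zero hdet hMy) ⟨α, hα⟩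
    exact this
  ext ⟨α, μ⟩
  by_contra hne
  have hmem : (α, μ) ∈ c.support := Finsupp.mem_support_iff.mpr hne
  have hli := (linearIndependent_monoidHom (FreeMonoid (ZMod n)) Qv).comp χ hχinj
  have h0 := linearIndependent_iff'.mp hli T (fun μ => c (α, μ) * W μ) (by
    funext κ
    simpa [mul_assoc] using hy κ α (Finset.mem_image_of_mem Prod.fst hmem)) μ
    (Finset.mem_image_of_mem Prod.snd hmem)
  refine mul_ne_zero hne ?_ h0
  refine Finset.prod_ne_zero_iff.mpr fun γ _ => ?_
  refine List.prod_ne_zero fun h => ?_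
  obtain ⟨s, -, hs⟩ := List.mem_map.mp h
  exact zpow_ne_zero _ vv_ne_zero hs

end Independence

section Injectivity

attribute [local instance] LieRing.ofAssociativeRing

variable {n : ℕ}

lemma map_torus [NeZero n] (Θ : Ugl n →ₐ[Qv] Module.End Qv (WordSpace n))
    (hL : ∀ i, Θ (GlL i) = wordDiag (delta i)) (μ : ZMod n → Multiplicative ℤ) :
    Θ (torus μ) = wordDiag (torusChar μ) := by
  classical
  let f : (ZMod n → Multiplicative ℤ) →* Module.End Qv (WordSpace n) :=
    { toFun := fun μ => wordDiag (torusChar μ)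
      map_one' := by
        refine Eq.trans ?_ wordDiag_one
        congr 1
      map_mul' := fun μ ν => by
        refine Eq.trans ?_ (wordDiag_mul _ _).symm
        congr 1
        funext s
        simp [torusChar, zpow_add₀ vv_ne_zero] }
  have h : ((Θ : Ugl n →* Module.End Qv (WordSpace n)).comp (Units.coeHom (Ugl n))).comp torus =
      f := by
    ext1 μ
    refine Subgroup.pi_mem_of_mulSingle_mem (H := MonoidHom.eqLocus _ f) μ fun i => ?_
    generalize μ i = x
    revert x
    refine DFunLike.congr_fun (f := MonoidHom.comp (((Θ : Ugl n →* Module.End Qv (WordSpace n)).comp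
      (Units.coeHom (Ugl n))).comp torus) (MonoidHom.mulSingle (fun _ => Multiplicative ℤ) i))
      (g := f.comp (MonoidHom.mulSingle (fun _ => Multiplicative ℤ) i)) (MonoidHom.ext_mint ?_)
    simp only [MonoidHom.comp_apply, MonoidHom.mulSingle_apply]
    rw [torus_mulSingle, zpow_one]
    refine (hL i).trans ?_
    change _ = wordDiag (torusChar _)
    congr 1
    funext s
    simp only [delta, torusChar, Pi.mulSingle_apply]
    split_ifs <;> simp
  exact DFunLike.congr_fun h μ

theorem injective_of_generators [NeZero n] (hn : 2 ≤ n)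
    (Θ : Ugl n →ₐ[Qv] Module.End Qv (WordSpace n))
    (hE : ∀ i, Θ (GlE i) = wordE 1 i) (hF : ∀ i, Θ (GlF i) = wordF 1 i)
    (hL : ∀ i, Θ (GlL i) = wordDiag (delta i)) : Function.Injective Θ := by
  have hrel : LieRelation Qv Qv fun (x : Ugl n) y => Θ x = y :=
    { zero := map_zero Θ
      add := by rintro x y _ _ rfl rfl; exact map_add Θ x y
      sub := by rintro x y _ _ rfl rfl; exact map_sub Θ x y
      lie := by
        rintro x y _ _ rfl rfl
        rw [Ring.lie_def, Ring.lie_def, map_sub, map_mul, map_mul]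
      smul := by rintro k x _ rfl; exact map_smul Θ _ x }
  have hmon : ∀ p, Θ (pbwMon p) = ((rootList p.1).map (wordRoot n)).prod *
      wordDiag (torusChar p.2) := by
    intro p
    have hf : ∀ q, Θ (pbwVec Qv flipF q) = wordRoot n (Sum.inl q) :=
      hrel.pbwVec fun i => hF (-i - 1)
    have he : ∀ q, Θ (pbwVec Qv GlE q) = wordRoot n (Sum.inr q) := hrel.pbwVec hE
    rw [pbwMon, map_mul, map_mul, map_torus Θ hL, ordMon, ordMon, map_list_prod, map_list_prod,
      rootList, List.map_append, List.prod_append, List.map_map, List.map_map, List.map_map,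
      List.map_map]
    simp only [Function.comp_def, hf, he]
  refine (injective_iff_map_eq_zero Θ).mpr fun x hx => ?_
  have hspan : x ∈ Submodule.span Qv (Set.range (pbwMon (n := n))) := by
    rw [span_pbwMon hn]
    trivial
  obtain ⟨c, rfl⟩ := Finsupp.mem_span_range_iff_exists_finsupp.mp hspan
  have hc : c = 0 := by
    refine wordMonomials_independent hn c ?_
    rw [Finsupp.sum, map_sum] at hx
    simpa only [map_smul, hmon] using hx
  simp [hc]

end Injectivity

section Descent

variable {n r : ℕ}

/-- A homomorphism with the prescribed values on generators is injective. -/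
theorem injective_of_values (hn : 2 ≤ n) (hr : r ≤ n - 1) (ε : ℤ) (Φ : Ugl n →ₐ[Qv] U1 n)
    (hΦ : ∀ i : ZMod n,
        Φ (GlE i) = toU1 n (eElt n r ε i) ∧ Φ (GlF i) = toU1 n (fElt n r ε i) ∧
        Φ (GlL i) = toU1 n (lElt n r (rep1 i)) ∧
        Φ (GlLinv i) = toU1 n (linvElt n r (rep1 i))) : Function.Injective Φ := by
  have : NeZero n := ⟨by omega⟩
  have hincl : Function.Injective (inclWords n r) := reletter_injective (skipLetter_injective hn r)
  have hrel : ∀ ⦃x y⦄, RelGl n x y → FreeAlgebra.lift Qv (smallGen (n := n)) x =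
      FreeAlgebra.lift Qv smallGen y := by
    intro x y h
    have h1 := intertwine hn hr ε Φ hΦ x
    have h2 := intertwine hn hr ε Φ hΦ y
    rw [RingQuot.mkAlgHom_rel Qv h, h2] at h1
    refine LinearMap.ext fun w => hincl ?_
    exact (LinearMap.congr_fun h1 w).symm
  let Θ : Ugl n →ₐ[Qv] Module.End Qv (WordSpace n) :=
    RingQuot.liftAlgHom Qv ⟨FreeAlgebra.lift Qv smallGen, hrel⟩
  have hΘ : ∀ x, Θ (RingQuot.mkAlgHom Qv (RelGl n) x) = FreeAlgebra.lift Qv smallGen x :=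
    fun x => RingQuot.liftAlgHom_mkAlgHom_apply Qv _ hrel x
  have hinj : Function.Injective Θ := injective_of_generators hn Θ
    (fun i => (hΘ _).trans (FreeAlgebra.lift_ι_apply _ _))
    (fun i => (hΘ _).trans (FreeAlgebra.lift_ι_apply _ _))
    (fun i => (hΘ _).trans (FreeAlgebra.lift_ι_apply _ _))
  refine (injective_iff_map_eq_zero Φ).mpr fun x hx => ?_
  obtain ⟨x, rfl⟩ := RingQuot.mkAlgHom_surjective Qv (RelGl n) x
  have h1 := intertwine hn hr ε Φ hΦ x
  rw [hx, map_zero, ← hΘ] at h1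
  refine hinj ?_
  rw [map_zero]
  refine LinearMap.ext fun w => hincl ?_
  have := (LinearMap.congr_fun h1 w).symm
  simpa using this

end Descent

section QuantumCommutator

variable {K B : Type*} [Field K] [Ring B] [Algebra K B]

/-- The `q`-commutator `x y - q y x`. -/
def qcomm (q : K) (x y : B) : B := x * y - q • (y * x)

lemma qcomm_swap {q : K} (hq : q ≠ 0) (x y : B) : qcomm q x y = -q • qcomm q⁻¹ y x := by
  simp only [qcomm]
  match_scalars <;> field_simp

lemma qcomm_smul (q c : K) (x y : B) : qcomm q x (c • y) = c • qcomm q x y := by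
  simp only [qcomm, mul_smul_comm, smul_mul_assoc]
  module

lemma qcomm_zero (q : K) (x : B) : qcomm q x 0 = 0 := by simp [qcomm]

lemma commute_qcomm {q : K} {x y z : B} (hx : z * x = x * z) (hy : z * y = y * z) :
    z * qcomm q x y = qcomm q x y * z :=
  (Commute.sub_right (Commute.mul_right hx hy)
    (Commute.smul_right (Commute.mul_right hy hx) q) : Commute z (qcomm q x y))

lemma serrePoly_smul_left (q c : K) (x y : B) :
    serrePoly q (c • x) y = c ^ 2 • serrePoly q x y := by
  simp only [serrePoly, mul_smul_comm, smul_mul_assoc]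
  module

lemma serrePoly_smul_right (q c : K) (x y : B) : serrePoly q x (c • y) = c • serrePoly q x y := by
  simp only [serrePoly, mul_smul_comm, smul_mul_assoc]
  module

lemma cubicPoly_inv (q : K) (x y : B) : cubicPoly q⁻¹ x y = cubicPoly q x y := by
  have : (q⁻¹ ^ 2 + 1 + (q⁻¹ ^ 2)⁻¹ : K) = q ^ 2 + 1 + (q ^ 2)⁻¹ := by
    rw [inv_pow, inv_inv]; ring
  rw [cubicPoly, this, cubicPoly]

/-- The composite of three `q`-commutators. -/
lemma cubicPoly_eq_qcomm {q : K} (hq : q ≠ 0) (x y : B) :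
    cubicPoly q x y = qcomm (q ^ 2)⁻¹ x (qcomm (1 : K) x (qcomm (q ^ 2) x y)) := by
  simp only [cubicPoly, qcomm, mul_sub, sub_mul, smul_mul_assoc, mul_smul_comm, mul_assoc,
    smul_sub, smul_smul]
  match_scalars <;> field_simp <;> ring

lemma serrePoly_eq_qcomm {q : K} (hq : q ≠ 0) (x y : B) :
    serrePoly q x y = qcomm q⁻¹ x (qcomm q x y) := by
  simp only [serrePoly, qcomm, mul_sub, sub_mul, smul_mul_assoc, mul_smul_comm, mul_assoc,
    smul_sub, smul_smul]
  match_scalars <;> field_simp <;> ring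

lemma serrePoly_eq_qcomm' {q : K} (hq : q ≠ 0) (x y : B) :
    serrePoly q x y = qcomm q x (qcomm q⁻¹ x y) := by
  have := serrePoly_eq_qcomm (inv_ne_zero hq) x y
  rwa [serrePoly_inv, inv_inv] at this

/-- Iterated `q`-commutators satisfy the quantum Serre relation. -/
lemma qcomm_serre {q : K} (hq : q ≠ 0) {a b : B} (h : serrePoly q a b = 0) (c d : K) (u : B) :
    qcomm (c * q) a (qcomm (c * q⁻¹) a (qcomm d b u)) -
        (q + q⁻¹) • qcomm (c * q) a (qcomm (d * q⁻¹) b (qcomm c a u)) +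
      qcomm (d * (q ^ 2)⁻¹) b (qcomm (c * q ^ 2) a (qcomm c a u)) = 0 := by
  have key : qcomm (c * q) a (qcomm (c * q⁻¹) a (qcomm d b u)) -
        (q + q⁻¹) • qcomm (c * q) a (qcomm (d * q⁻¹) b (qcomm c a u)) +
      qcomm (d * (q ^ 2)⁻¹) b (qcomm (c * q ^ 2) a (qcomm c a u)) =
      serrePoly q a b * u - (c ^ 2 * d) • (u * serrePoly q a b) := by
    simp only [serrePoly, qcomm, mul_sub, sub_mul, smul_mul_assoc, mul_smul_comm, mul_assoc,
      smul_sub, smul_smul, mul_add, add_mul, smul_add]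
    match_scalars <;> field_simp <;> ring
  rw [key, h]
  simp

lemma mul_qcomm_of_serre {q : K} (hq : q ≠ 0) {a b : B} (h : serrePoly q a b = 0) :
    a * qcomm q a b = q⁻¹ • (qcomm q a b * a) := by
  rw [serrePoly_eq_qcomm hq, qcomm] at h
  exact sub_eq_zero.mp h

lemma qcomm_mul_of_serre {q : K} (hq : q ≠ 0) {a b : B} (h : serrePoly q b a = 0) :
    qcomm q a b * b = q⁻¹ • (b * qcomm q a b) := by
  rw [serrePoly_eq_qcomm' hq, qcomm] at h
  rw [qcomm_swap hq]
  simp only [mul_smul_comm, smul_mul_assoc, sub_eq_zero.mp h]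
  match_scalars; field_simp

lemma serrePoly_qcomm_right {q p : K} {x a b : B} (hb : x * b = b * x)
    (h : serrePoly p x a = 0) : serrePoly p x (qcomm q a b) = 0 := by
  have key : serrePoly p x (qcomm q a b) = serrePoly p x a * b - q • (b * serrePoly p x a) := by
    have hb' : ∀ z, x * (b * z) = b * (x * z) := fun z => by rw [← mul_assoc, hb, mul_assoc]
    simp only [serrePoly, qcomm, mul_sub, sub_mul, smul_mul_assoc, mul_smul_comm, mul_assoc,
      smul_sub, smul_smul, mul_add, add_mul, smul_add, hb, hb']
    module
  rw [key, h]
  simp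

lemma serrePoly_qcomm_left {q : K} (hq : q ≠ 0) (hq2 : q + q⁻¹ ≠ 0) {x a b : B}
    (hb : x * b = b * x) (hax : serrePoly q a x = 0) (hab : serrePoly q a b = 0)
    (hba : serrePoly q b a = 0) : serrePoly q (qcomm q a b) x = 0 := by
  have hae := mul_qcomm_of_serre hq hab
  have heb := qcomm_mul_of_serre hq hba
  have hay : a * qcomm q⁻¹ a x = q • (qcomm q⁻¹ a x * a) := by
    rw [serrePoly_eq_qcomm' hq] at hax
    exact sub_eq_zero.mp hax
  have hzb : qcomm q (qcomm q⁻¹ a x) b * b = q⁻¹ • (b * qcomm q (qcomm q⁻¹ a x) b) := by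
    refine qcomm_mul_of_serre hq ?_
    exact serrePoly_qcomm_right hb.symm hba
  have e_eq : a * b = qcomm q a b + q • (b * a) := by simp [qcomm]
  have y_eq : a * x = qcomm q⁻¹ a x + q⁻¹ • (x * a) := by simp [qcomm]
  have z_eq : qcomm q⁻¹ a x * b = qcomm q (qcomm q⁻¹ a x) b + q • (b * qcomm q⁻¹ a x) := by
    simp [qcomm]
  generalize qcomm q (qcomm q⁻¹ a x) b = z at *
  generalize qcomm q⁻¹ a x = y at *
  generalize qcomm q a b = e at *
  have hex : e * x = q⁻¹ • (x * e) + z := by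
    linear_combination (norm := (simp only [mul_sub, sub_mul, mul_add, add_mul, smul_mul_assoc,
      mul_smul_comm, mul_assoc, smul_sub, smul_add, smul_smul]; match_scalars <;> field_simp <;> ring))
      -(e_eq * x) - a * hb + y_eq * b + z_eq - q • (b * y_eq) + q⁻¹ • (x * e_eq) + hb * a
  have h1 : a * z = q⁻¹ • (e * y - y * e) + (q⁻¹ * q⁻¹) • (z * a) := by
    linear_combination (norm := (simp only [mul_sub, sub_mul, mul_add, add_mul, smul_mul_assoc,
      mul_smul_comm, mul_assoc, smul_sub, smul_add, smul_smul]; match_scalars <;> field_simp <;> ring))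
      -(a * hex) + hae * x + q⁻¹ • (e * y_eq) + (q⁻¹ * q⁻¹) • (hex * a) - q⁻¹ • (y_eq * e) -
        (q⁻¹ * q⁻¹) • (x * hae)
  have h2 : a * z = -q • (e * y - y * e) + (q * q) • (z * a) := by
    linear_combination (norm := (simp only [mul_sub, sub_mul, mul_add, add_mul, smul_mul_assoc,
      mul_smul_comm, mul_assoc, smul_sub, smul_add, smul_smul]; match_scalars <;> field_simp <;> ring))
      -(a * z_eq) + hay * b + q • (y * e_eq) + (q * q) • (z_eq * a) - q • (e_eq * y) -
        (q * q) • (b * hay)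
  have h3 : e * y - y * e = (q - q⁻¹) • (z * a) := by
    refine smul_right_injective B hq2 ?_
    dsimp only
    linear_combination (norm := (simp only [mul_sub, sub_mul, mul_add, add_mul, smul_mul_assoc,
      mul_smul_comm, mul_assoc, smul_sub, smul_add, smul_smul]; match_scalars <;> field_simp <;> ring))
      h2 - h1
  have haz : a * z = z * a := by
    rw [h1, h3]
    match_scalars
    field_simp
    ring
  have hez : e * z = q • (z * e) := by
    linear_combination (norm := (simp only [mul_sub, sub_mul, mul_add, add_mul, smul_mul_assoc,
      mul_smul_comm, mul_assoc, smul_sub, smul_add, smul_smul]; match_scalars <;> field_simp <;> ring))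
      -(e_eq * z) - q • (a * hzb) + q • (haz * b) + q • (z * e_eq) - q • (b * haz) +
        (q * q) • (hzb * a)
  rw [serrePoly_eq_qcomm' hq, show qcomm q⁻¹ e x = z by rw [qcomm, hex]; abel, qcomm, hez, sub_self]

end QuantumCommutator

section CubicRelations

variable {K B : Type*} [Field K] [Ring B] [Algebra K B] {q : K} {a b x : B}

lemma cubicPoly_of_chain (hq : q ≠ 0) {t u w : B} (h₁ : x * t = q ^ 2 • (t * x) + u)
    (h₂ : x * u = u * x + w) (h₃ : x * w = (q ^ 2)⁻¹ • (w * x)) : cubicPoly q x t = 0 := by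
  have e₁ : qcomm (q ^ 2) x t = u := by simp [qcomm, h₁]
  have e₂ : qcomm (1 : K) x u = w := by simp [qcomm, h₂]
  rw [cubicPoly_eq_qcomm hq, e₁, e₂, qcomm, h₃, sub_self]

lemma cubicPoly_mul (hq : q ≠ 0) (ha : serrePoly q x a = 0) (hb : serrePoly q x b = 0) :
    cubicPoly q x (a * b) = 0 := by
  rw [serrePoly_eq_qcomm hq] at ha hb
  replace ha := sub_eq_zero.mp ha
  replace hb := sub_eq_zero.mp hb
  have hxa : x * a = qcomm q x a + q • (a * x) := by simp [qcomm]
  have hxb : x * b = qcomm q x b + q • (b * x) := by simp [qcomm]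
  generalize qcomm q x a = a₁ at *
  generalize qcomm q x b = b₁ at *
  refine cubicPoly_of_chain hq (u := a₁ * b + q • (a * b₁)) (w := (q + q⁻¹) • (a₁ * b₁))
    ?_ ?_ ?_
  · linear_combination (norm := (simp only [mul_add, add_mul, smul_mul_assoc,
      mul_smul_comm, mul_assoc, smul_add, smul_smul]; match_scalars <;> field_simp <;> ring))
      hxa * b + q • (a * hxb)
  · linear_combination (norm := (simp only [mul_add, add_mul, smul_mul_assoc,
      mul_smul_comm, mul_assoc, smul_add, smul_smul]; match_scalars <;> field_simp <;> ring))
      ha * b + q⁻¹ • (a₁ * hxb) + q • (hxa * b₁) + (q * q) • (a * hb)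
  · linear_combination (norm := (simp only [mul_add, add_mul, smul_mul_assoc,
      mul_smul_comm, mul_assoc, smul_smul]; match_scalars <;> field_simp <;> ring))
      (q + q⁻¹) • (ha * b₁) + ((q + q⁻¹) * q⁻¹) • (a₁ * hb)

lemma cubicPoly_qcomm_right (hq : q ≠ 0) (ha : serrePoly q x a = 0) (hb : serrePoly q x b = 0)
    (p : K) : cubicPoly q x (qcomm p a b) = 0 := by
  have key : cubicPoly q x (qcomm p a b) =
      cubicPoly q x (a * b) - p • cubicPoly q x (b * a) := by
    simp only [qcomm, cubicPoly, mul_sub, sub_mul, mul_smul_comm, smul_mul_assoc]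
    module
  rw [key, cubicPoly_mul hq ha hb, cubicPoly_mul hq hb ha]
  simp

/-- The upper half of the adjoint representation generated by `x`. -/
lemma adjoint_relations (hq : q ≠ 0) (hax : serrePoly q a x = 0) (hab : serrePoly q a b = 0) :
    qcomm (1 : K) a (qcomm (q ^ 2)⁻¹ a (qcomm q⁻¹ b x)) =
        (q + q⁻¹) • qcomm (1 : K) a (qcomm (q ^ 2)⁻¹ b (qcomm q⁻¹ a x)) ∧
      qcomm (q ^ 2) a (qcomm (1 : K) a (qcomm (q ^ 2)⁻¹ b (qcomm q⁻¹ a x))) = 0 := by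
  have hay : qcomm q a (qcomm q⁻¹ a x) = 0 := by rwa [← serrePoly_eq_qcomm' hq]
  have h₁ := qcomm_serre hq hab q⁻¹ q⁻¹ x
  have h₂ := qcomm_serre hq hab q (q ^ 2)⁻¹ (qcomm q⁻¹ a x)
  have e₁ : q⁻¹ * q = 1 := inv_mul_cancel₀ hq
  have e₂ : q⁻¹ * q⁻¹ = (q ^ 2)⁻¹ := by field_simp
  have e₃ : q⁻¹ * q ^ 2 = q := by field_simp
  have e₄ : q * q = q ^ 2 := by ring
  have e₅ : q * q⁻¹ = 1 := mul_inv_cancel₀ hq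
  rw [e₁, e₂, e₃, hay, qcomm_zero, add_zero, sub_eq_zero] at h₁
  rw [e₄, e₅, hay] at h₂
  simp only [qcomm_zero, smul_zero, sub_zero, add_zero] at h₂
  exact ⟨h₁, h₂⟩

lemma adjoint_top_eq (hq : q ≠ 0) (hq2 : q + q⁻¹ ≠ 0) (hax : serrePoly q a x = 0)
    (hbx : serrePoly q b x = 0) (hab : serrePoly q a b = 0) :
    qcomm q⁻¹ a (qcomm (1 : K) b (qcomm (q ^ 2)⁻¹ a (qcomm q⁻¹ b x))) =
      qcomm q⁻¹ b (qcomm (1 : K) a (qcomm (q ^ 2)⁻¹ b (qcomm q⁻¹ a x))) := by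
  have hby : qcomm q b (qcomm q⁻¹ b x) = 0 := by rwa [← serrePoly_eq_qcomm' hq]
  have h := qcomm_serre hq hab (q ^ 2)⁻¹ q (qcomm q⁻¹ b x)
  have e₁ : (q ^ 2)⁻¹ * q = q⁻¹ := by field_simp
  have e₂ : q * (q ^ 2)⁻¹ = q⁻¹ := by field_simp
  have e₃ : (q ^ 2)⁻¹ * q ^ 2 = 1 := inv_mul_cancel₀ (pow_ne_zero 2 hq)
  rw [e₁, e₂, e₃, mul_inv_cancel₀ hq, hby, (adjoint_relations hq hax hab).1, qcomm_smul] at h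
  simp only [qcomm_zero, zero_sub] at h
  exact smul_right_injective B hq2 (neg_add_eq_zero.mp h)

lemma adjoint_top_relation (hq : q ≠ 0) (hq2 : q + q⁻¹ ≠ 0) (hq3 : q ^ 2 + 1 + (q ^ 2)⁻¹ ≠ 0)
    (hax : serrePoly q a x = 0) (hbx : serrePoly q b x = 0) (hab : serrePoly q a b = 0) :
    qcomm q a (qcomm q⁻¹ a (qcomm (1 : K) b (qcomm (q ^ 2)⁻¹ a (qcomm q⁻¹ b x)))) = 0 := by
  have h := qcomm_serre hq hab 1 1 (qcomm (q ^ 2)⁻¹ a (qcomm q⁻¹ b x))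
  obtain ⟨h₁, h₂⟩ := adjoint_relations hq hax hab
  simp only [one_mul] at h
  rw [h₁, qcomm_smul, qcomm_smul, qcomm_smul, qcomm_smul, h₂, qcomm_zero, smul_zero, add_zero,
    ← adjoint_top_eq hq hq2 hax hbx hab] at h
  generalize qcomm q a _ = t at h ⊢
  refine (smul_eq_zero_iff_right hq3).mp ?_
  rw [← neg_eq_zero, ← h]
  match_scalars
  field_simp
  ring

lemma cubicPoly_qcomm_left (hq : q ≠ 0) (hq2 : q + q⁻¹ ≠ 0) (hq3 : q ^ 2 + 1 + (q ^ 2)⁻¹ ≠ 0)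
    (hax : serrePoly q a x = 0) (hbx : serrePoly q b x = 0) (hab : serrePoly q a b = 0)
    (hba : serrePoly q b a = 0) : cubicPoly q (qcomm q a b) x = 0 := by
  have hae := mul_qcomm_of_serre hq hab
  have hby := sub_eq_zero.mp ((serrePoly_eq_qcomm' hq b x).symm.trans hbx)
  have hp₁ := (adjoint_relations hq hax hab).1
  have hp₂ := (adjoint_relations hq hbx hba).1
  have ht := adjoint_top_eq hq hq2 hax hbx hab
  have hta := adjoint_top_relation hq hq2 hq3 hax hbx hab
  have htb := adjoint_top_relation hq hq2 hq3 hbx hax hba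
  have hpb := (adjoint_relations hq hbx hba).2
  rw [← ht] at htb
  have e_eq : a * b = qcomm q a b + q • (b * a) := by simp [qcomm]
  have ya_eq : a * x = qcomm q⁻¹ a x + q⁻¹ • (x * a) := by simp [qcomm]
  have yb_eq : b * x = qcomm q⁻¹ b x + q⁻¹ • (x * b) := by simp [qcomm]
  generalize qcomm q a b = e at *
  generalize qcomm q⁻¹ a x = ya at *
  generalize qcomm q⁻¹ b x = yb at *
  have yab_eq : a * yb = qcomm (q ^ 2)⁻¹ a yb + (q ^ 2)⁻¹ • (yb * a) := by simp [qcomm]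
  have yba_eq : b * ya = qcomm (q ^ 2)⁻¹ b ya + (q ^ 2)⁻¹ • (ya * b) := by simp [qcomm]
  generalize qcomm (q ^ 2)⁻¹ a yb = yab at *
  generalize qcomm (q ^ 2)⁻¹ b ya = yba at *
  have pa_eq : a * yba = qcomm (1 : K) a yba + yba * a := by simp [qcomm]
  have pb_eq : b * yab = qcomm (1 : K) b yab + yab * b := by simp [qcomm]
  have pa_eq' : a * yab = (q + q⁻¹) • qcomm (1 : K) a yba + yab * a := by
    rw [← hp₁]; simp [qcomm]
  have pb_eq' : b * yba = (q + q⁻¹) • qcomm (1 : K) b yab + yba * b := by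
    rw [← hp₂]; simp [qcomm]
  clear hp₁ hp₂
  generalize qcomm (1 : K) a yba = pa at *
  generalize qcomm (1 : K) b yab = pb at *
  have t_eq : a * pb = qcomm q⁻¹ a pb + q⁻¹ • (pb * a) := by simp [qcomm]
  have t_eq' : b * pa = qcomm q⁻¹ a pb + q⁻¹ • (pa * b) := by rw [ht]; simp [qcomm]
  generalize qcomm q⁻¹ a pb = t at *
  replace hta := sub_eq_zero.mp hta
  replace htb := sub_eq_zero.mp htb
  replace hpb := sub_eq_zero.mp hpb
  have hep : e * pb = q • (pb * e) := by
    linear_combination (norm := (simp only [mul_add, add_mul, smul_mul_assoc,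
      mul_smul_comm, mul_assoc, smul_add, smul_smul]; match_scalars <;> field_simp <;> ring))
      -(e_eq * pb) + a * hpb + q ^ 2 • (t_eq * b) - q • (b * t_eq) + q • (pb * e_eq) -
        hpb * a - q • htb
  have het : e * t = q ^ 2 • (t * e) := by
    linear_combination (norm := (simp only [mul_add, add_mul, smul_mul_assoc,
      mul_smul_comm, mul_assoc, smul_add, smul_smul]; match_scalars <;> field_simp <;> ring))
      -(e_eq * t) + a * htb + q • (hta * b) + q ^ 2 • (t * e_eq) - q • (b * hta) - q ^ 2 • (htb * a)
  have hex : e * x = (q ^ 2)⁻¹ • (x * e) + (yab - q • yba + ((q ^ 2)⁻¹ - 1) • (yb * a)) := by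
    linear_combination (norm := (simp only [mul_add, add_mul, smul_mul_assoc,
      mul_smul_comm, mul_assoc, smul_add, smul_smul]; match_scalars <;> field_simp <;> ring))
      -(e_eq * x) + a * yb_eq + q⁻¹ • (ya_eq * b) + yab_eq - q • (b * ya_eq) - yb_eq * a -
        q • yba_eq + (q ^ 2)⁻¹ • (x * e_eq)
  have heyb : e * yb = q⁻¹ • (yb * e) - q • pb := by
    linear_combination (norm := (simp only [mul_add, add_mul, smul_mul_assoc,
      mul_smul_comm, mul_assoc, smul_add, smul_smul]; match_scalars <;> field_simp <;> ring))
      -(e_eq * yb) + a * hby + q • (yab_eq * b) - q • (b * yab_eq) - q • pb_eq +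
        q⁻¹ • (yb * e_eq) - q⁻¹ • (hby * a)
  have heab : e * yab = yab * e - q ^ 2 • t + (q⁻¹ - q) • (pb * a) := by
    linear_combination (norm := (simp only [mul_add, add_mul, smul_mul_assoc,
      mul_smul_comm, mul_assoc, smul_add, smul_smul]; match_scalars <;> field_simp <;> ring))
      -(e_eq * yab) + a * pb_eq + t_eq + pa_eq' * b - q • (b * pa_eq') - (q ^ 2 + 1) • t_eq' -
        q • (pb_eq * a) + yab * e_eq
  have heba : e * yba = yba * e + q⁻¹ • t + ((q ^ 2)⁻¹ - q ^ 2) • (pb * a) := by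
    linear_combination (norm := (simp only [mul_add, add_mul, smul_mul_assoc,
      mul_smul_comm, mul_assoc, smul_add, smul_smul]; match_scalars <;> field_simp <;> ring))
      -(e_eq * yba) + a * pb_eq' + (q + q⁻¹) • t_eq + pa_eq * b - q • (b * pa_eq) - q • t_eq' -
        q • (pb_eq' * a) + yba * e_eq
  have hea : e * a = q • (a * e) := by
    rw [hae, smul_smul, mul_inv_cancel₀ hq, one_smul]
  rw [← cubicPoly_inv]
  refine cubicPoly_of_chain (inv_ne_zero hq)
    (u := yab - q • yba + ((q ^ 2)⁻¹ - 1) • (yb * a))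
    (w := (q ^ 3 - q⁻¹) • (pb * a) - (q ^ 2 + 1) • t) ?_ ?_ ?_
  · rw [hex, inv_pow]
  · linear_combination (norm := (simp only [mul_sub, sub_mul, mul_add, add_mul, smul_mul_assoc,
      mul_smul_comm, mul_assoc, smul_sub, smul_add, smul_smul]; match_scalars <;> field_simp <;> ring))
      heab - q • heba + ((q ^ 2)⁻¹ - 1) • (heyb * a) + (((q ^ 2)⁻¹ - 1) * q⁻¹) • (yb * hea)
  · linear_combination (norm := (simp only [mul_sub, sub_mul, mul_add, add_mul, smul_mul_assoc,
      mul_smul_comm, mul_assoc, smul_sub, smul_smul]; match_scalars <;> field_simp <;> ring))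
      (q ^ 3 - q⁻¹) • (hep * a) + ((q ^ 3 - q⁻¹) * q) • (pb * hea) - (q ^ 2 + 1) • het

end CubicRelations

section SerreTransport

variable {A : Type} [Ring A] [Algebra Qv A]

/-- The family `X` satisfies the affine quantum Serre relations. -/
def SerreFamily {m : ℕ} (X : ZMod m → A) : Prop :=
  ∀ i j, i ≠ j → serreSum (1 - cartan i j).toNat (X i) (X j) = 0

lemma serreSum_smul (k : ℕ) (c d : Qv) (x y : A) :
    serreSum k (c • x) (d • y) = (c ^ k * d) • serreSum k x y := by
  simp only [serreSum, dp, Finset.smul_sum]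
  refine Finset.sum_congr rfl fun p hp => ?_
  rw [Finset.mem_range] at hp
  have : c ^ k = c ^ p * c ^ (k - p) := by rw [← pow_add]; congr 1; omega
  simp only [smul_pow, mul_smul_comm, smul_mul_assoc, smul_smul, this]
  congr 1
  ring

lemma SerreFamily.smul {m : ℕ} {X : ZMod m → A} (h : SerreFamily X) (c : ZMod m → Qv) :
    SerreFamily fun i => c i • X i := fun i j hij => by
  dsimp only
  rw [serreSum_smul, h i j hij, smul_zero]

lemma SerreFamily.commute {m : ℕ} {X : ZMod m → A} (h : SerreFamily X) {i j : ZMod m}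
    (h₀ : i ≠ j) (h₁ : i + 1 ≠ j) (h₂ : j + 1 ≠ i) : X i * X j = X j * X i := by
  have := h i j h₀
  rw [cartan_of_not_adj h₀ h₁ h₂] at this
  exact (sub_eq_zero.mp ((serreSum_one _ _).symm.trans this)).symm

lemma SerreFamily.quadratic {m : ℕ} (hm : 3 ≤ m) {X : ZMod m → A} (h : SerreFamily X)
    {i j : ZMod m} (hij : i + 1 = j ∨ j + 1 = i) : serrePoly vv (X i) (X j) = 0 := by
  have hne : i ≠ j := by
    rintro rfl
    exact ne_add_one (by omega) i (by rcases hij with h | h <;> exact h.symm)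
  have := h i j hne
  rw [cartan_adj hm hij] at this
  exact (smul_eq_zero_iff_right (inv_ne_zero qfact_two_ne_zero)).mp
    ((serreSum_two _ _).symm.trans this)

lemma serrePoly_zpow {ε : ℤ} (hε : ε = 1 ∨ ε = -1) (x y : A) :
    serrePoly (vv ^ ε) x y = serrePoly vv x y := by
  rcases hε with rfl | rfl
  · rw [zpow_one]
  · rw [zpow_neg_one, serrePoly_inv]

lemma cubicPoly_zpow {ε : ℤ} (hε : ε = 1 ∨ ε = -1) (x y : A) :
    cubicPoly (vv ^ ε) x y = cubicPoly vv x y := by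
  rcases hε with rfl | rfl
  · rw [zpow_one]
  · rw [zpow_neg_one, cubicPoly_inv]

lemma zpow_add_inv_ne_zero {ε : ℤ} (hε : ε = 1 ∨ ε = -1) : vv ^ ε + (vv ^ ε)⁻¹ ≠ 0 := by
  have h := qfact_two_ne_zero
  rw [qfact_two] at h
  rcases hε with rfl | rfl
  · rwa [zpow_one]
  · rwa [zpow_neg_one, inv_inv, add_comm]

lemma zpow_quantum_three_ne_zero {ε : ℤ} (hε : ε = 1 ∨ ε = -1) :
    (vv ^ ε) ^ 2 + 1 + ((vv ^ ε) ^ 2)⁻¹ ≠ 0 := by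
  have h := quantum_three_ne_zero
  rcases hε with rfl | rfl
  · rwa [zpow_one]
  · rw [zpow_neg_one, inv_pow, inv_inv]
    rwa [add_comm, add_comm ((vv ^ 2)⁻¹), ← add_assoc]

/-- The merged family obtained from `X` by replacing the letters `r`, `r + 1` with their
`q`-commutator. -/
def mergeFamily {n : ℕ} (r : ℕ) (q : Qv) (X : ZMod (n + 1) → A) (i : ZMod n) : A :=
  if i.val = r then qcomm q (X (r : ZMod (n + 1))) (X ((r : ZMod (n + 1)) + 1))
  else X (skipMap r i)

variable {n r : ℕ} {ε : ℤ} {X : ZMod (n + 1) → A}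

lemma skipMap_add_one_eq_iff (hn : 2 ≤ n) (hr : r ≤ n - 1) {i j : ZMod n} (hi : i.val ≠ r) :
    skipMap r i + 1 = skipMap r j ↔ i + 1 = j := by
  rw [← skipMap_add_one_of_ne hn hr hi, (skipMap_injective hn r).eq_iff]

lemma cartan_skipMap (hn : 2 ≤ n) (hr : r ≤ n - 1) {i j : ZMod n} (hi : i.val ≠ r)
    (hj : j.val ≠ r) : cartan (skipMap r i) (skipMap r j) = cartan i j := by
  simp only [cartan, eq_comm (b := skipMap r j + 1), eq_comm (b := j + 1), eq_sub_iff_add_eq,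
    skipMap_add_one_eq_iff hn hr hi, skipMap_add_one_eq_iff hn hr hj,
    (skipMap_injective hn r).eq_iff]

/-- How a letter meets the two letters that get merged, away from rank two. -/
lemma SerreFamily.merge_cases (hn : 3 ≤ n) (hr : r ≤ n - 1) (hX : SerreFamily X) {i j : ZMod n}
    (hi : i.val ≠ r) (hj : j.val = r) :
    (i + 1 = j ∧ serrePoly vv (X (r : ZMod (n + 1))) (X (skipMap r i)) = 0 ∧
      serrePoly vv (X (skipMap r i)) (X (r : ZMod (n + 1))) = 0 ∧
      X (skipMap r i) * X ((r : ZMod (n + 1)) + 1) = X ((r : ZMod (n + 1)) + 1) * X (skipMap r i)) ∨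
    (j + 1 = i ∧ serrePoly vv (X ((r : ZMod (n + 1)) + 1)) (X (skipMap r i)) = 0 ∧
      serrePoly vv (X (skipMap r i)) (X ((r : ZMod (n + 1)) + 1)) = 0 ∧
      X (skipMap r i) * X (r : ZMod (n + 1)) = X (r : ZMod (n + 1)) * X (skipMap r i)) ∨
    (i + 1 ≠ j ∧ j + 1 ≠ i ∧
      X (skipMap r i) * X (r : ZMod (n + 1)) = X (r : ZMod (n + 1)) * X (skipMap r i) ∧
      X (skipMap r i) * X ((r : ZMod (n + 1)) + 1) =
        X ((r : ZMod (n + 1)) + 1) * X (skipMap r i)) := by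
  have hn2 : 2 ≤ n := by omega
  have hm : 3 ≤ n + 1 := by omega
  have hσj : skipMap r j = (r : ZMod (n + 1)) := skipMap_of_val_eq hj
  have hσ₁ : skipMap r (j + 1) = (r : ZMod (n + 1)) + 1 + 1 :=
    skipMap_add_one_of_val_eq hn2 hr hj
  have hne : skipMap r i ≠ (r : ZMod (n + 1)) := skipMap_of_val_ne hn2 hr hi
  have hne' : skipMap r i ≠ (r : ZMod (n + 1)) + 1 := skipMap_ne hn2 hr i
  have hl : skipMap r i + 1 = (r : ZMod (n + 1)) ↔ i + 1 = j := by
    rw [← hσj, skipMap_add_one_eq_iff hn2 hr hi]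
  have hu : (r : ZMod (n + 1)) + 1 + 1 = skipMap r i ↔ j + 1 = i := by
    rw [← hσ₁, (skipMap_injective hn2 r).eq_iff]
  have hr' : skipMap r i + 1 ≠ (r : ZMod (n + 1)) + 1 := fun h => hne (add_right_cancel h)
  by_cases h₁ : i + 1 = j
  · refine Or.inl ⟨h₁, hX.quadratic hm (Or.inr (hl.mpr h₁)), hX.quadratic hm (Or.inl (hl.mpr h₁)),
      hX.commute hne' hr' fun h => add_one_ne_of_adj hn h₁ (hu.mp h)⟩
  by_cases h₂ : j + 1 = i
  · exact Or.inr (Or.inl ⟨h₂, hX.quadratic hm (Or.inl (hu.mpr h₂)),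
      hX.quadratic hm (Or.inr (hu.mpr h₂)),
      hX.commute hne (fun h => h₁ (hl.mp h)) fun h => hne' h.symm⟩)
  · exact Or.inr (Or.inr ⟨h₁, h₂,
      hX.commute hne (fun h => h₁ (hl.mp h)) fun h => hne' h.symm,
      hX.commute hne' hr' fun h => h₂ (hu.mp h)⟩)

lemma serrePoly_qcomm_swap {q : Qv} (hq : q ≠ 0) {a b x : A}
    (h : serrePoly q⁻¹ (qcomm q⁻¹ b a) x = 0) : serrePoly q (qcomm q a b) x = 0 := by
  rw [qcomm_swap hq, serrePoly_smul_left, ← serrePoly_inv, h, smul_zero]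

/-- The Serre relations between `e` and the neighbouring letters away from rank two. -/
lemma SerreFamily.merge_of_three_le (hn : 3 ≤ n) (hr : r ≤ n - 1) (hε : ε = 1 ∨ ε = -1)
    (hX : SerreFamily X) {i j : ZMod n} (hi : i.val ≠ r) (hj : j.val = r) :
    let e := qcomm (vv ^ ε) (X (r : ZMod (n + 1))) (X ((r : ZMod (n + 1)) + 1))
    serreSum (1 - cartan i j).toNat e (X (skipMap r i)) = 0 ∧
      serreSum (1 - cartan i j).toNat (X (skipMap r i)) e = 0 := by
  intro e
  have hm : 3 ≤ n + 1 := by omega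
  have hq : vv ^ ε ≠ 0 := zpow_ne_zero _ vv_ne_zero
  have hab : serrePoly (vv ^ ε) (X (r : ZMod (n + 1))) (X ((r : ZMod (n + 1)) + 1)) = 0 := by
    rw [serrePoly_zpow hε]; exact hX.quadratic hm (Or.inl rfl)
  have hba : serrePoly (vv ^ ε) (X ((r : ZMod (n + 1)) + 1)) (X (r : ZMod (n + 1))) = 0 := by
    rw [serrePoly_zpow hε]; exact hX.quadratic hm (Or.inr rfl)
  rcases hX.merge_cases hn hr hi hj with ⟨h, h₁, h₂, h₃⟩ | ⟨h, h₁, h₂, h₃⟩ | ⟨h, h', h₁, h₂⟩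
  · have hc : (1 - cartan i j).toNat = 2 := by rw [cartan_adj hn (Or.inl h)]; rfl
    rw [hc, serreSum_two, serreSum_two, serrePoly_qcomm_right h₃ h₂, ← serrePoly_zpow hε]
    rw [← serrePoly_zpow hε] at h₁
    rw [serrePoly_qcomm_left hq (zpow_add_inv_ne_zero hε) h₃ h₁ hab hba]
    simp
  · have hc : (1 - cartan i j).toNat = 2 := by rw [cartan_adj hn (Or.inr h)]; rfl
    rw [← serrePoly_zpow hε] at h₁
    have hl : serrePoly (vv ^ ε) e (X (skipMap r i)) = 0 := by
      refine serrePoly_qcomm_swap hq (serrePoly_qcomm_left (inv_ne_zero hq) ?_ h₃ ?_ ?_ ?_)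
      · rw [inv_inv, add_comm]; exact zpow_add_inv_ne_zero hε
      all_goals rwa [serrePoly_inv]
    have hrr : serrePoly vv (X (skipMap r i)) e = 0 := by
      change serrePoly vv _ (qcomm _ _ _) = 0
      rw [qcomm_swap hq, serrePoly_smul_right, serrePoly_qcomm_right h₃ h₂, smul_zero]
    rw [hc, serreSum_two, serreSum_two, hrr, ← serrePoly_zpow hε, hl]
    simp
  · have hc : (1 - cartan i j).toNat = 1 := by
      rw [cartan_of_not_adj (fun e => hi ((congrArg ZMod.val e).trans hj)) h h']; rfl
    have : _ = e * _ := commute_qcomm (q := vv ^ ε) h₁ h₂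
    rw [hc, serreSum_one, serreSum_one, ← this]
    exact ⟨sub_self _, sub_self _⟩

lemma SerreFamily.merge_two {X : ZMod (2 + 1) → A} (hr : r ≤ 1) (hε : ε = 1 ∨ ε = -1)
    (hX : SerreFamily X) {i j : ZMod 2} (hi : i.val ≠ r) (hj : j.val = r) :
    let e := qcomm (vv ^ ε) (X (r : ZMod (2 + 1))) (X ((r : ZMod (2 + 1)) + 1))
    serreSum (1 - cartan i j).toNat e (X (skipMap r i)) = 0 ∧
      serreSum (1 - cartan i j).toNat (X (skipMap r i)) e = 0 := by
  intro e
  have hq : vv ^ ε ≠ 0 := zpow_ne_zero _ vv_ne_zero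
  have hs : ∀ s t, s ≠ t → serrePoly (vv ^ ε) (X s) (X t) = 0 := fun s t hst => by
    rw [serrePoly_zpow hε]
    exact hX.quadratic le_rfl (by revert s t; decide)
  have hne : skipMap r i ≠ (r : ZMod (2 + 1)) := skipMap_of_val_ne le_rfl hr hi
  have hne' : skipMap r i ≠ (r : ZMod (2 + 1)) + 1 := skipMap_ne le_rfl hr i
  have hrr := ne_add_one (m := 2 + 1) (by norm_num) (r : ZMod (2 + 1))
  have hc : (1 - cartan i j).toNat = 3 := by
    rw [cartan_two (fun e => hi ((congrArg ZMod.val e).trans hj))]; rfl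
  rw [hc, serreSum_three, serreSum_three, ← cubicPoly_zpow hε, ← cubicPoly_zpow hε,
    cubicPoly_qcomm_right hq (hs _ _ hne) (hs _ _ hne'),
    cubicPoly_qcomm_left hq (zpow_add_inv_ne_zero hε) (zpow_quantum_three_ne_zero hε)
      (hs _ _ hne.symm) (hs _ _ hne'.symm) (hs _ _ hrr) (hs _ _ hrr.symm)]
  simp

theorem SerreFamily.merge (hn : 2 ≤ n) (hr : r ≤ n - 1) (hε : ε = 1 ∨ ε = -1)
    (hX : SerreFamily X) : SerreFamily (mergeFamily (n := n) r (vv ^ ε) X) := by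
  have : NeZero n := ⟨by omega⟩
  have key : ∀ i j : ZMod n, i.val ≠ r → j.val = r →
      serreSum (1 - cartan i j).toNat
        (qcomm (vv ^ ε) (X (r : ZMod (n + 1))) (X ((r : ZMod (n + 1)) + 1))) (X (skipMap r i)) = 0 ∧
      serreSum (1 - cartan i j).toNat (X (skipMap r i))
        (qcomm (vv ^ ε) (X (r : ZMod (n + 1))) (X ((r : ZMod (n + 1)) + 1))) = 0 := by
    intro i j hi hj
    rcases hn.lt_or_eq with h | h
    · exact hX.merge_of_three_le h hr hε hi hj
    · subst h
      exact hX.merge_two hr hε hi hj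
  intro i j hij
  unfold mergeFamily
  by_cases hi : i.val = r
  · have hj : j.val ≠ r := fun hj => hij (ZMod.val_injective n (hi.trans hj.symm))
    rw [if_pos hi, if_neg hj, cartan_comm]
    exact (key j i hj hi).1
  by_cases hj : j.val = r
  · rw [if_neg hi, if_pos hj]
    exact (key i j hi hj).2
  · rw [if_neg hi, if_neg hj, ← cartan_skipMap hn hr hi hj]
    exact hX _ _ ((skipMap_injective hn r).ne hij)

end SerreTransport

section MixedCommutator

variable {K B : Type*} [Field K] [Ring B] [Algebra K B]

/-- The commutator of the two merged root vectors. -/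
lemma qcomm_mixed {q c : K} (hq : q ≠ 0) (hc : c * (q - q⁻¹) = 1) {a b a' b' k k' l l' : B}
    (ha : a * a' - a' * a = c • (k - k')) (hb : b * b' - b' * b = c • (l - l'))
    (hab : a * b' = b' * a) (hba : b * a' = a' * b)
    (hkb : k * b' = q • (b' * k)) (hkb' : k' * b' = q⁻¹ • (b' * k'))
    (hla : l * a' = q • (a' * l)) (hla' : l' * a' = q⁻¹ • (a' * l'))
    (hl : l * a = q⁻¹ • (a * l)) (hk : k' * b = q • (b * k')) (hkl : k' * l = l * k') :
    qcomm q a b * qcomm q⁻¹ b' a' - qcomm q⁻¹ b' a' * qcomm q a b = c • (k * l - l' * k') := by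
  have hs : c * (1 - q⁻¹ * q⁻¹) = q⁻¹ := by
    have : c * (1 - q⁻¹ * q⁻¹) = q⁻¹ * (c * (q - q⁻¹)) := by field_simp
    rw [this, hc, mul_one]
  have h₁ : a * qcomm q⁻¹ b' a' = qcomm q⁻¹ b' a' * a - q⁻¹ • (b' * k') := by
    rw [← congrArg (· • (b' * k')) hs, qcomm]
    linear_combination
      (norm := (simp only [mul_sub, sub_mul, smul_mul_assoc, mul_smul_comm, mul_assoc, smul_sub,
        smul_smul]; match_scalars <;> field_simp <;> ring))
      hab * a' + b' * ha - q⁻¹ • (ha * b') - q⁻¹ • (a' * hab) - (q⁻¹ * c) • hkb + (q⁻¹ * c) • hkb'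
  have h₂ : b * qcomm q⁻¹ b' a' = qcomm q⁻¹ b' a' * b + a' * l := by
    have : a' * l = (c * (q - q⁻¹)) • (a' * l) := by rw [hc, one_smul]
    rw [this, qcomm]
    linear_combination
      (norm := (simp only [mul_sub, sub_mul, smul_mul_assoc, mul_smul_comm, mul_assoc, smul_sub,
        smul_smul]; match_scalars <;> field_simp <;> ring))
      hb * a' + b' * hba - q⁻¹ • (hba * b') - q⁻¹ • (a' * hb) + c • hla - c • hla'
  generalize qcomm q⁻¹ b' a' = f at *
  rw [qcomm]
  linear_combination
    (norm := (simp only [mul_sub, sub_mul, mul_add, add_mul, smul_mul_assoc, mul_smul_comm,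
      mul_assoc, smul_sub, smul_add, smul_smul]; match_scalars <;> field_simp <;> ring))
    a * h₂ + h₁ * b - q • (b * h₁) - q • (h₂ * a) + ha * l + hb * k' - q • (a' * hl) -
      q⁻¹ • (b' * hk) - c • hkl

lemma neg_smul_sub (c : K) (x y : B) : -c • (x - y) = c • (y - x) := by
  rw [neg_smul, ← smul_neg, neg_sub]

end MixedCommutator

section AffineTorus

variable {m : ℕ}

lemma u_rel {x y : FA m} (h : URel m x y) :
    RingQuot.mkAlgHom Qv (URel m) x = RingQuot.mkAlgHom Qv (URel m) y :=
  RingQuot.mkAlgHom_rel Qv h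

lemma serreFamily_UE : SerreFamily (UE (m := m)) := fun i j h =>
  (map_serreSum _ _ _ _).symm.trans ((u_rel (URel.serreE i j h)).trans (map_zero _))

lemma serreFamily_UF : SerreFamily (UF (m := m)) := fun i j h =>
  (map_serreSum _ _ _ _).symm.trans ((u_rel (URel.serreF i j h)).trans (map_zero _))

lemma UE_mul_UF_sub (i j : ZMod m) : UE i * UF j - UF j * UE i =
    if i = j then (vv - vv⁻¹)⁻¹ • (UK i - UKinv i) else 0 := by
  have := u_rel (URel.EF i j)
  rw [map_sub, map_mul, map_mul] at this
  refine this.trans ?_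
  split_ifs <;> simp [UK, UKinv]

/-- `K i` as a unit. -/
def kUnit (i : ZMod m) : (U m)ˣ :=
  ⟨UK i, UKinv i, by simpa [UK, UKinv] using u_rel (URel.KKinv i),
    by simpa [UK, UKinv] using u_rel (URel.KinvK i)⟩

lemma kUnit_commute (i j : ZMod m) : Commute (kUnit i) (kUnit j) := by
  refine Units.ext ?_
  simpa [UK, kUnit] using u_rel (URel.KK i j)

/-- The Laurent monomials in the `K i`. -/
def kTorus [NeZero m] : (ZMod m → Multiplicative ℤ) →* (U m)ˣ :=
  MonoidHom.noncommPiCoprod (fun i => zpowersHom _ (kUnit i)) fun i j _ x y => by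
    simpa [zpowersHom_apply] using (kUnit_commute i j).zpow_zpow _ _

/-- The exponent of `K i`. -/
def kExp (i : ZMod m) : ZMod m → Multiplicative ℤ := Pi.mulSingle i (Multiplicative.ofAdd 1)

lemma kTorus_kExp [NeZero m] (i : ZMod m) : kTorus (kExp i) = kUnit i := by
  refine (MonoidHom.noncommPiCoprod_mulSingle _ i _).trans ?_
  simp [zpowersHom_apply]

/-- `t` acts on the generators `E j` and `F j` by the weights `χ j` and `-χ j`. -/
structure HasWeight (t : (U m)ˣ) (χ : ZMod m → ℤ) : Prop where
  E (j) : ↑t * UE j = vv ^ χ j • (UE j * ↑t)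
  F (j) : ↑t * UF j = vv ^ (-χ j) • (UF j * ↑t)

lemma HasWeight.one : HasWeight (1 : (U m)ˣ) 0 := ⟨by simp, by simp⟩

lemma smul_conj_mul {t s x : U m} {a b : ℤ} (ht : t * x = vv ^ a • (x * t))
    (hs : s * x = vv ^ b • (x * s)) : t * s * x = vv ^ (a + b) • (x * (t * s)) := by
  rw [mul_assoc, hs, mul_smul_comm, ← mul_assoc, ht, smul_mul_assoc, smul_smul, mul_assoc,
    zpow_add₀ vv_ne_zero, mul_comm]

lemma smul_conj_inv {t : (U m)ˣ} {x : U m} {a : ℤ} (ht : ↑t * x = vv ^ a • (x * ↑t)) :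
    ↑t⁻¹ * x = vv ^ (-a) • (x * ↑t⁻¹) := by
  have h : x * ↑t⁻¹ = vv ^ a • (↑t⁻¹ * x) := by
    calc x * ↑t⁻¹ = ↑t⁻¹ * (↑t * x) * ↑t⁻¹ := by rw [← mul_assoc, t.inv_mul, one_mul]
      _ = vv ^ a • (↑t⁻¹ * x) := by
        rw [ht, mul_smul_comm, smul_mul_assoc, mul_assoc, mul_assoc, t.mul_inv, mul_one]
  rw [h, smul_smul, ← zpow_add₀ vv_ne_zero, neg_add_cancel, zpow_zero, one_smul]

lemma HasWeight.mul {t s : (U m)ˣ} {χ ψ : ZMod m → ℤ} (ht : HasWeight t χ)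
    (hs : HasWeight s ψ) : HasWeight (t * s) (χ + ψ) where
  E j := smul_conj_mul (ht.E j) (hs.E j)
  F j := by
    rw [Pi.add_apply, neg_add]
    exact smul_conj_mul (ht.F j) (hs.F j)

lemma HasWeight.inv {t : (U m)ˣ} {χ : ZMod m → ℤ} (ht : HasWeight t χ) :
    HasWeight t⁻¹ (-χ) where
  E j := smul_conj_inv (ht.E j)
  F j := smul_conj_inv (ht.F j)

lemma hasWeight_kUnit (i : ZMod m) : HasWeight (kUnit i) (cartan i) where
  E j := by simpa [UK, UE, kUnit] using u_rel (URel.KE i j)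
  F j := by simpa [UK, UF, kUnit] using u_rel (URel.KF i j)

lemma HasWeight.congr {t : (U m)ˣ} {χ ψ : ZMod m → ℤ} (ht : HasWeight t χ) (h : χ = ψ) :
    HasWeight t ψ := h ▸ ht

/-- The weight whose consecutive differences are the rows of the Cartan matrix. -/
def gap (i j : ZMod m) : ℤ := (if i = j then 1 else 0) - (if i - 1 = j then 1 else 0)

lemma gap_sub_gap (i : ZMod m) : gap i - gap (i + 1) = cartan i := by
  funext j
  have h₁ : i - 1 = j ↔ i = j + 1 := sub_eq_iff_eq_add
  have h₂ : i + 1 = j ↔ i = j - 1 := eq_sub_iff_add_eq.symm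
  simp only [Pi.sub_apply, gap, cartan, h₁, h₂, add_sub_cancel_right]
  split_ifs <;> omega

/-- The exponent of `K 1 ⋯ K p`. -/
def cumExp (p : ℕ) : ZMod m → Multiplicative ℤ :=
  ∏ t ∈ Finset.range p, kExp ((t + 1 : ℕ) : ZMod m)

lemma cumExp_succ (p : ℕ) :
    (cumExp (p + 1) : ZMod m → _) = cumExp p * kExp ((p + 1 : ℕ) : ZMod m) :=
  Finset.prod_range_succ _ _

lemma hasWeight_cumExp [NeZero m] (p : ℕ) :
    HasWeight (kTorus (cumExp p)) (gap (1 : ZMod m) - gap ((p + 1 : ℕ) : ZMod m)) := by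
  induction p with
  | zero => simpa [cumExp] using HasWeight.one (m := m)
  | succ p ih =>
    rw [cumExp_succ, map_mul, kTorus_kExp]
    refine (ih.mul (hasWeight_kUnit _)).congr ?_
    rw [← gap_sub_gap, sub_add_sub_cancel]
    simp

lemma list_prod_UK [NeZero m] (a k : ℕ) :
    ((List.range k).map fun t => UK ((a + 1 + t : ℕ) : ZMod m)).prod =
      ↑(kTorus (cumExp (a + k) / cumExp a : ZMod m → _)) := by
  induction k with
  | zero => simp
  | succ k ih =>
    rw [List.range_succ, List.map_append, List.prod_append, ih, ← add_assoc, cumExp_succ,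
      mul_div_right_comm, map_mul, kTorus_kExp]
    simp [kUnit, add_right_comm]

lemma list_prod_UKinv [NeZero m] (a k : ℕ) :
    ((List.range k).map fun t => UKinv ((a + 1 + t : ℕ) : ZMod m)).prod =
      ↑(kTorus (cumExp a / cumExp (a + k) : ZMod m → _)) := by
  induction k with
  | zero => simp
  | succ k ih =>
    rw [List.range_succ, List.map_append, List.prod_append, ih, ← add_assoc, cumExp_succ,
      ← div_div, div_eq_mul_inv _ (kExp _), map_mul, map_inv, kTorus_kExp]
    simp [kUnit, add_right_comm]

end AffineTorus

section MergedRelations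

variable {n r : ℕ} {ε : ℤ}

lemma smul_conj_qcomm {q : Qv} {m : ℕ} {t x y : U m} {a b : ℤ} (hx : t * x = vv ^ a • (x * t))
    (hy : t * y = vv ^ b • (y * t)) :
    t * qcomm q x y = vv ^ (a + b) • (qcomm q x y * t) := by
  have h₁ : t * (x * y) = vv ^ (a + b) • (x * y * t) := by
    rw [← mul_assoc, hx, smul_mul_assoc, mul_assoc, hy, mul_smul_comm, smul_smul, mul_assoc,
      zpow_add₀ vv_ne_zero]
  have h₂ : t * (y * x) = vv ^ (a + b) • (y * x * t) := by
    rw [← mul_assoc, hy, smul_mul_assoc, mul_assoc, hx, mul_smul_comm, smul_smul, mul_assoc,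
      zpow_add₀ vv_ne_zero, mul_comm (vv ^ b)]
  rw [qcomm, mul_sub, sub_mul, smul_sub, mul_smul_comm, smul_mul_assoc, h₁, h₂, smul_comm]

/-- The weight of a merged family. -/
def mergeWt (r : ℕ) (χ : ZMod (n + 1) → ℤ) (i : ZMod n) : ℤ :=
  if i.val = r then χ (r : ZMod (n + 1)) + χ ((r : ZMod (n + 1)) + 1) else χ (skipMap r i)

lemma mergeWt_neg (χ : ZMod (n + 1) → ℤ) (i : ZMod n) : mergeWt r (-χ) i = -mergeWt r χ i := by
  simp only [mergeWt, Pi.neg_apply]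
  split_ifs <;> ring

lemma smul_conj_mergeFamily {q : Qv} {t : U (n + 1)} {X : ZMod (n + 1) → U (n + 1)}
    {χ : ZMod (n + 1) → ℤ} (h : ∀ j, t * X j = vv ^ χ j • (X j * t)) (i : ZMod n) :
    t * mergeFamily r q X i = vv ^ mergeWt r χ i • (mergeFamily r q X i * t) := by
  rw [mergeFamily, mergeWt]
  split_ifs
  · exact smul_conj_qcomm (h _) (h _)
  · exact h _

lemma eElt_eq_mergeFamily (i : ZMod n) : eElt n r ε i = mergeFamily r (vv ^ ε) UE i := by
  rw [mergeFamily]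
  split_ifs with h
  · rw [eElt_of_val_eq i ε h, er, qcomm]
  · exact eElt_of_val_ne i ε h

/-- The scalar by which `f r` differs from a merged lowering generator. -/
def fScalar (r : ℕ) (ε : ℤ) (i : ZMod n) : Qv := if i.val = r then -vv ^ (-ε) else 1

lemma fElt_eq_smul_mergeFamily (i : ZMod n) :
    fElt n r ε i = fScalar r ε i • mergeFamily r (vv ^ ε) UF i := by
  rw [mergeFamily, fScalar]
  split_ifs with h
  · rw [fElt_of_val_eq i ε h, fr, ← qcomm, qcomm_swap (zpow_ne_zero _ vv_ne_zero), ← zpow_neg,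
      neg_neg]
  · rw [one_smul, fElt_of_val_ne i ε h]

lemma serreFamily_eElt (hn : 2 ≤ n) (hr : r ≤ n - 1) (hε : ε = 1 ∨ ε = -1) :
    SerreFamily (eElt n r ε) := by
  rw [show eElt n r ε = _ from funext eElt_eq_mergeFamily]
  exact serreFamily_UE.merge hn hr hε

lemma serreFamily_fElt (hn : 2 ≤ n) (hr : r ≤ n - 1) (hε : ε = 1 ∨ ε = -1) :
    SerreFamily (fElt n r ε) := by
  rw [show fElt n r ε = _ from funext fElt_eq_smul_mergeFamily]
  exact (serreFamily_UF.merge hn hr hε).smul _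

lemma HasWeight.eElt {t : (U (n + 1))ˣ} {χ : ZMod (n + 1) → ℤ} (h : HasWeight t χ) (i : ZMod n) :
    ↑t * eElt n r ε i = vv ^ mergeWt r χ i • (eElt n r ε i * ↑t) := by
  rw [eElt_eq_mergeFamily]
  exact smul_conj_mergeFamily h.E i

lemma HasWeight.fElt {t : (U (n + 1))ˣ} {χ : ZMod (n + 1) → ℤ} (h : HasWeight t χ) (i : ZMod n) :
    ↑t * fElt n r ε i = vv ^ (-mergeWt r χ i) • (fElt n r ε i * ↑t) := by
  rw [fElt_eq_smul_mergeFamily, mul_smul_comm, smul_conj_mergeFamily (χ := -χ) h.F i, mergeWt_neg,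
    smul_mul_assoc, smul_comm]

/-- The exponent of the Cartan element attached to a merged family. -/
def mergeExp (r : ℕ) (i : ZMod n) : ZMod (n + 1) → Multiplicative ℤ :=
  if i.val = r then kExp (r : ZMod (n + 1)) * kExp ((r : ZMod (n + 1)) + 1)
  else kExp (skipMap r i)

lemma UE_mul_UF_of_ne {m : ℕ} {i j : ZMod m} (h : i ≠ j) : UE i * UF j = UF j * UE i := by
  have := UE_mul_UF_sub i j
  rwa [if_neg h, sub_eq_zero] at this

lemma UE_mul_UF_sub_self {m : ℕ} (i : ZMod m) :
    UE i * UF i - UF i * UE i = (vv - vv⁻¹)⁻¹ • (UK i - UKinv i) := by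
  rw [UE_mul_UF_sub, if_pos rfl]

lemma eElt_mul_fElt_of_ne (hn : 2 ≤ n) (hr : r ≤ n - 1) {i j : ZMod n} (h : i ≠ j) :
    eElt n r ε i * fElt n r ε j = fElt n r ε j * eElt n r ε i := by
  have : NeZero n := ⟨by omega⟩
  rw [eElt_eq_mergeFamily, fElt_eq_smul_mergeFamily, mul_smul_comm, smul_mul_assoc]
  congr 1
  rw [mergeFamily, mergeFamily]
  split_ifs with hi hj hj
  · exact absurd (ZMod.val_injective n (hi.trans hj.symm)) h
  · exact (commute_qcomm (UE_mul_UF_of_ne (skipMap_of_val_ne hn hr hj).symm).symm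
      (UE_mul_UF_of_ne (skipMap_ne hn hr j).symm).symm).symm
  · exact commute_qcomm (UE_mul_UF_of_ne (skipMap_of_val_ne hn hr hi))
      (UE_mul_UF_of_ne (skipMap_ne hn hr i))
  · exact UE_mul_UF_of_ne ((skipMap_injective hn r).ne h)

lemma cartan_add_one {m : ℕ} (hm : 3 ≤ m) (i : ZMod m) : cartan i (i + 1) = -1 :=
  cartan_adj hm (Or.inl rfl)

lemma cartan_add_one_self {m : ℕ} (hm : 3 ≤ m) (i : ZMod m) : cartan (i + 1) i = -1 :=
  cartan_adj hm (Or.inr rfl)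

@[simp] lemma val_kUnit {m : ℕ} (i : ZMod m) : (kUnit i : U m) = UK i := rfl

@[simp] lemma val_inv_kUnit {m : ℕ} (i : ZMod m) : (↑(kUnit i)⁻¹ : U m) = UKinv i := rfl

lemma er_mul_fr_sub (hn : 2 ≤ n) (hε : ε = 1 ∨ ε = -1) :
    er n r ε * fr n r ε - fr n r ε * er n r ε = (vv - vv⁻¹)⁻¹ •
      (UK (r : ZMod (n + 1)) * UK ((r : ZMod (n + 1)) + 1) -
        UKinv ((r : ZMod (n + 1)) + 1) * UKinv (r : ZMod (n + 1))) := by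
  have hm : 3 ≤ n + 1 := by omega
  set a : ZMod (n + 1) := (r : ZMod (n + 1))
  have hne : a ≠ a + 1 := ne_add_one (by omega) a
  have w (i : ZMod (n + 1)) := hasWeight_kUnit i
  have w' (i : ZMod (n + 1)) := (hasWeight_kUnit i).inv
  have c₁ := cartan_add_one hm a
  have c₂ := cartan_add_one_self hm a
  have hkl : UKinv a * UK (a + 1) = UK (a + 1) * UKinv a :=
    congrArg Units.val ((kUnit_commute a (a + 1)).inv_left)
  have hkl' : UK a * UKinv (a + 1) = UKinv (a + 1) * UK a :=
    congrArg Units.val ((kUnit_commute a (a + 1)).inv_right)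
  have hkk : UK a * UK (a + 1) = UK (a + 1) * UK a :=
    congrArg Units.val (kUnit_commute a (a + 1))
  have hkk' : UKinv a * UKinv (a + 1) = UKinv (a + 1) * UKinv a :=
    congrArg Units.val ((kUnit_commute a (a + 1)).inv_inv)
  rcases hε with rfl | rfl
  · have := qcomm_mixed (q := vv) vv_ne_zero (inv_mul_cancel₀ vv_sub_inv_ne_zero)
      (UE_mul_UF_sub_self a) (UE_mul_UF_sub_self (a + 1)) (UE_mul_UF_of_ne hne)
      (UE_mul_UF_of_ne hne.symm) (by simpa [c₁] using (w a).F (a + 1))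
      (by simpa [c₁] using (w' a).F (a + 1)) (by simpa [c₂] using (w (a + 1)).F a)
      (by simpa [c₂] using (w' (a + 1)).F a) (by simpa [c₂] using (w (a + 1)).E a)
      (by simpa [c₁] using (w' a).E (a + 1)) hkl
    simpa [er, fr, qcomm] using this
  · have hd (i : ZMod (n + 1)) :
        UE i * UF i - UF i * UE i = (-(vv - vv⁻¹)⁻¹) • (UKinv i - UK i) := by
      rw [UE_mul_UF_sub_self, neg_smul_sub]
    have hc : -(vv - vv⁻¹)⁻¹ * (vv⁻¹ - vv⁻¹⁻¹) = 1 := by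
      rw [inv_inv, neg_mul, ← mul_neg, neg_sub, inv_mul_cancel₀ vv_sub_inv_ne_zero]
    have := qcomm_mixed (q := vv⁻¹) (inv_ne_zero vv_ne_zero) hc
      (hd a) (hd (a + 1)) (UE_mul_UF_of_ne hne)
      (UE_mul_UF_of_ne hne.symm) (by simpa [c₁] using (w' a).F (a + 1))
      (by simpa [c₁] using (w a).F (a + 1)) (by simpa [c₂] using (w' (a + 1)).F a)
      (by simpa [c₂] using (w (a + 1)).F a) (by simpa [c₂] using (w' (a + 1)).E a)
      (by simpa [c₁] using (w a).E (a + 1)) hkl'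
    rw [hkk, ← hkk', ← neg_smul_sub]
    simpa [er, fr, qcomm] using this

lemma eElt_mul_fElt_self_sub (hn : 2 ≤ n) (hr : r ≤ n - 1) (hε : ε = 1 ∨ ε = -1) (i : ZMod n) :
    eElt n r ε i * fElt n r ε i - fElt n r ε i * eElt n r ε i = (vv - vv⁻¹)⁻¹ •
      ((kTorus (mergeExp r i) : U (n + 1)) - ↑(kTorus (mergeExp r i))⁻¹) := by
  rw [mergeExp]
  split_ifs with h
  · rw [eElt_of_val_eq i ε h, fElt_of_val_eq i ε h, er_mul_fr_sub hn hε, map_mul, kTorus_kExp,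
      kTorus_kExp, mul_inv_rev]
    simp
  · rw [eElt_of_val_ne i ε h, fElt_of_val_ne i ε h, UE_mul_UF_sub_self, kTorus_kExp]
    simp

end MergedRelations

section Existence

variable {n r : ℕ} {ε : ℤ}

/-- The exponent of the Cartan element `l i`. -/
def lExp (n r i : ℕ) : ZMod (n + 1) → Multiplicative ℤ := cumExp r / cumExp (skip r i - 1)

lemma lElt_eq {i : ℕ} (hi : i ≠ 0) : lElt n r i = kTorus (lExp n r i) := by
  obtain ⟨a, rfl⟩ := Nat.exists_eq_succ_of_ne_zero hi
  rw [lElt, lExp, skip]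
  split_ifs with h
  · rw [list_prod_UK, show a + (r + 1 - a.succ) = r by omega, Nat.succ_sub_one]
  · rw [list_prod_UKinv, show r + (a.succ - r) = a.succ by omega, Nat.add_sub_cancel]

lemma linvElt_eq {i : ℕ} (hi : i ≠ 0) : linvElt n r i = ↑(kTorus (lExp n r i))⁻¹ := by
  obtain ⟨a, rfl⟩ := Nat.exists_eq_succ_of_ne_zero hi
  rw [linvElt, lExp, skip, ← map_inv, inv_div]
  split_ifs with h
  · rw [list_prod_UKinv, show a + (r + 1 - a.succ) = r by omega, Nat.succ_sub_one]
  · rw [list_prod_UK, show r + (a.succ - r) = a.succ by omega, Nat.add_sub_cancel]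

lemma rep1_ne_zero (hn : 2 ≤ n) (i : ZMod n) : rep1 i ≠ 0 := by
  unfold rep1
  split_ifs <;> omega

lemma hasWeight_lExp (hn : 2 ≤ n) (hr : r ≤ n - 1) (i : ZMod n) :
    HasWeight (kTorus (lExp n r (rep1 i))) (gap (skipMap r i) - gap ((r : ZMod (n + 1)) + 1)) := by
  have h0 := rep1_ne_zero hn i
  have h1 : skip r (rep1 i) - 1 + 1 = skip r (rep1 i) := by
    unfold skip
    split_ifs <;> omega
  rw [lExp, div_eq_mul_inv, map_mul, map_inv]
  refine ((hasWeight_cumExp r).mul (hasWeight_cumExp _).inv).congr ?_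
  rw [h1, skipMap_rep1 hn hr]
  push_cast
  abel

lemma mergeWt_lExp (hn : 2 ≤ n) (hr : r ≤ n - 1) (i j : ZMod n) :
    mergeWt r (gap (skipMap r i) - gap ((r : ZMod (n + 1)) + 1)) j = gap i j := by
  have hne := ne_add_one (by omega : 2 ≤ n + 1) (r : ZMod (n + 1))
  have hi := skipMap_ne hn hr i
  rw [mergeWt]
  split_ifs with h
  · have h₁ : skipMap r i = r ↔ i = j := by
      rw [← skipMap_of_val_eq h, (skipMap_injective hn r).eq_iff]
    have h₂ : skipMap r i - 1 = (r : ZMod (n + 1)) + 1 ↔ i - 1 = j := by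
      rw [sub_eq_iff_eq_add, sub_eq_iff_eq_add, ← skipMap_add_one_of_val_eq hn hr h,
        (skipMap_injective hn r).eq_iff]
    have h₃ : skipMap r i - 1 ≠ (r : ZMod (n + 1)) := fun e => hi (sub_eq_iff_eq_add.mp e)
    simp [gap, h₁, h₂, h₃, hi, hne, hne.symm]
    ring
  · have h₁ : skipMap r i - 1 = skipMap r j ↔ i - 1 = j := by
      rw [sub_eq_iff_eq_add, sub_eq_iff_eq_add, eq_comm, skipMap_add_one_eq_iff hn hr h, eq_comm]
    have h₂ := skipMap_ne hn hr j
    have h₃ := skipMap_of_val_ne hn hr h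
    simp [gap, h₁, h₂.symm, h₃.symm, (skipMap_injective hn r).eq_iff]

/-- The Laurent monomials in the images of the `K i`. -/
def kTorus₁ : (ZMod (n + 1) → Multiplicative ℤ) →* (U1 n)ˣ :=
  (Units.map (toU1 n : U (n + 1) →* U1 n)).comp kTorus

lemma prodK_eq : prodK n = ↑(kTorus (cumExp (n + 1) : ZMod (n + 1) → Multiplicative ℤ)) := by
  have := list_prod_UK (m := n + 1) 0 (n + 1)
  simpa [prodK, cumExp, add_comm] using this

lemma kTorus₁_cumExp : kTorus₁ (cumExp (n + 1)) = (1 : (U1 n)ˣ) := by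
  refine Units.ext ?_
  have := RingQuot.mkAlgHom_rel Qv (Rel1.central (n := n))
  rw [prodK_eq, map_one] at this
  exact this

lemma kTorus₁_lExp (hn : 2 ≤ n) (hr : r ≤ n - 1) (i : ZMod n) :
    kTorus₁ (lExp n r (rep1 i)) * (kTorus₁ (lExp n r (rep1 (i + 1))))⁻¹ =
      kTorus₁ (mergeExp r i) := by
  have : NeZero n := ⟨by omega⟩
  have hi := ZMod.val_lt i
  have hrep : rep1 (i + 1) = i.val + 1 := by
    have e : i + 1 = ((i.val + 1 : ℕ) : ZMod n) := by simp
    rw [rep1, e]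
    rcases (by omega : i.val + 1 < n ∨ i.val + 1 = n) with h | h
    · rw [ZMod.val_natCast_of_lt h, if_neg (by omega)]
    · rw [h, ZMod.natCast_self, ZMod.val_zero, if_pos rfl]
  rw [← map_inv, ← map_mul, lExp, lExp, inv_div, div_mul_div_comm, mul_comm,
      mul_div_mul_right_eq_div,
    hrep]
  by_cases h0 : i.val = 0
  · have hP := kTorus₁_cumExp (n := n)
    rw [cumExp_succ, map_mul, Nat.cast_add_one, ← Nat.cast_add_one, ZMod.natCast_self] at hP
    have hskip : skip r (rep1 i) - 1 = n := by
      rw [rep1, if_pos h0, skip, if_neg (by omega), Nat.add_sub_cancel]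
    rw [hskip, map_div, eq_inv_of_mul_eq_one_left hP, div_inv_eq_mul, mergeExp, h0]
    split_ifs with h
    · subst h
      rw [← map_mul, mul_comm]
      simp [skip, cumExp]
    · rw [skip, if_pos (by omega)]
      simp [cumExp, skipMap, skip, h0]
  · rw [rep1, if_neg h0]
    congr 1
    rw [div_eq_iff_eq_mul', mergeExp]
    obtain ⟨a, ha⟩ := Nat.exists_eq_succ_of_ne_zero h0
    simp only [skipMap, ha]
    split_ifs with h
    · rw [skip, skip, if_neg (by omega), if_pos (by omega), ← h]
      simp [cumExp_succ, mul_assoc]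
    · rcases lt_or_gt_of_ne h with h | h
      · rw [skip, skip, if_pos (by omega), if_pos (by omega)]
        simp [cumExp_succ]
      · rw [skip, skip, if_neg (by omega), if_neg (by omega)]
        simp [cumExp_succ]

end Existence

section Homomorphism

variable {n r : ℕ} {ε : ℤ}

/-- The images of the generators of `U(ĝl_n)`. -/
def genImage (n r : ℕ) (ε : ℤ) : GenGl n → U1 n
  | .E i => toU1 n (eElt n r ε i)
  | .F i => toU1 n (fElt n r ε i)
  | .L i => toU1 n (lElt n r (rep1 i))
  | .Linv i => toU1 n (linvElt n r (rep1 i))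

/-- The homomorphism from the free algebra determined by `genImage`. -/
def freeHom (n r : ℕ) (ε : ℤ) : FAgl n →ₐ[Qv] U1 n := FreeAlgebra.lift Qv (genImage n r ε)

@[simp] lemma freeHom_gE (i : ZMod n) : freeHom n r ε (gE i) = toU1 n (eElt n r ε i) :=
  FreeAlgebra.lift_ι_apply _ _

@[simp] lemma freeHom_gF (i : ZMod n) : freeHom n r ε (gF i) = toU1 n (fElt n r ε i) :=
  FreeAlgebra.lift_ι_apply _ _

lemma freeHom_gL (hn : 2 ≤ n) (i : ZMod n) :
    freeHom n r ε (gL i) = kTorus₁ (lExp n r (rep1 i)) :=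
  (FreeAlgebra.lift_ι_apply _ _).trans (congrArg (toU1 n) (lElt_eq (rep1_ne_zero hn i)))

lemma freeHom_gLinv (hn : 2 ≤ n) (i : ZMod n) :
    freeHom n r ε (gLinv i) = ↑(kTorus₁ (lExp n r (rep1 i)))⁻¹ :=
  (FreeAlgebra.lift_ι_apply _ _).trans (congrArg (toU1 n) (linvElt_eq (rep1_ne_zero hn i)))

lemma freeHom_rel (hn : 2 ≤ n) (hr : r ≤ n - 1) (hε : ε = 1 ∨ ε = -1) {x y : FAgl n}
    (h : RelGl n x y) : freeHom n r ε x = freeHom n r ε y := by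
  cases h with
  | LL i j =>
    rw [map_mul, map_mul, freeHom_gL hn, freeHom_gL hn, ← Units.val_mul, ← Units.val_mul,
      ← map_mul, ← map_mul, mul_comm]
  | LLinv i => rw [map_mul, map_one, freeHom_gL hn, freeHom_gLinv hn, Units.mul_inv]
  | LinvL i => rw [map_mul, map_one, freeHom_gL hn, freeHom_gLinv hn, Units.inv_mul]
  | LE i j =>
    have := congrArg (toU1 n) ((hasWeight_lExp hn hr i).eElt (r := r) (ε := ε) j)
    rw [mergeWt_lExp hn hr, map_smul, map_mul, map_mul] at this
    rw [map_smul, map_mul, map_mul, freeHom_gL hn, freeHom_gE]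
    exact this
  | LF i j =>
    have := congrArg (toU1 n) ((hasWeight_lExp hn hr i).fElt (r := r) (ε := ε) j)
    rw [mergeWt_lExp hn hr, map_smul, map_mul, map_mul] at this
    rw [map_smul, map_mul, map_mul, freeHom_gL hn, freeHom_gF]
    exact this
  | EF i j =>
    rw [map_sub, map_mul, map_mul, freeHom_gE, freeHom_gF]
    split_ifs with h
    · subst h
      have := congrArg (toU1 n) (eElt_mul_fElt_self_sub hn hr hε i)
      rw [map_sub, map_mul, map_mul, map_smul, map_sub] at this
      rw [this, map_smul, map_sub, map_mul, map_mul, freeHom_gL hn, freeHom_gL hn,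
        freeHom_gLinv hn, freeHom_gLinv hn, ← Units.val_mul, ← Units.val_mul]
      have e := kTorus₁_lExp hn hr i
      have e' : (kTorus₁ (lExp n r (rep1 i)))⁻¹ * kTorus₁ (lExp n r (rep1 (i + 1))) =
          (kTorus₁ (mergeExp r i))⁻¹ := by
        rw [← e, mul_inv_rev, inv_inv, ← map_inv, ← map_mul, mul_comm, map_mul]
      rw [e, e']
      rfl
    · rw [← map_mul, ← map_mul, eElt_mul_fElt_of_ne hn hr h, sub_self, map_zero]
  | serreE i j h =>
    rw [map_zero]
    refine (map_serreSum (A := FAgl n) (B := U1 n) (freeHom n r ε) _ _ _).trans ?_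
    rw [freeHom_gE, freeHom_gE, ← map_serreSum, serreFamily_eElt hn hr hε i j h, map_zero]
  | serreF i j h =>
    rw [map_zero]
    refine (map_serreSum (A := FAgl n) (B := U1 n) (freeHom n r ε) _ _ _).trans ?_
    rw [freeHom_gF, freeHom_gF, ← map_serreSum, serreFamily_fElt hn hr hε i j h, map_zero]

/-- The homomorphism `U(ĝl_n) → U(ŝl_{n+1})₁`. -/
def glHom (hn : 2 ≤ n) (hr : r ≤ n - 1) (hε : ε = 1 ∨ ε = -1) : Ugl n →ₐ[Qv] U1 n :=
  RingQuot.liftAlgHom Qv ⟨freeHom n r ε, fun _ _ h => freeHom_rel hn hr hε h⟩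

lemma glHom_mk (hn : 2 ≤ n) (hr : r ≤ n - 1) (hε : ε = 1 ∨ ε = -1) (x : FAgl n) :
    glHom hn hr hε (RingQuot.mkAlgHom Qv (RelGl n) x) = freeHom n r ε x :=
  RingQuot.liftAlgHom_mkAlgHom_apply Qv _ _ _

lemma ugl_algHom_ext {Φ Ψ : Ugl n →ₐ[Qv] U1 n}
    (hE : ∀ i, Φ (GlE i) = Ψ (GlE i)) (hF : ∀ i, Φ (GlF i) = Ψ (GlF i))
    (hL : ∀ i, Φ (GlL i) = Ψ (GlL i)) (hLinv : ∀ i, Φ (GlLinv i) = Ψ (GlLinv i)) : Φ = Ψ := by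
  refine RingQuot.ringQuot_ext' Qv Φ Ψ (FreeAlgebra.hom_ext (funext fun g => ?_))
  cases g with
  | E i => exact hE i
  | F i => exact hF i
  | L i => exact hL i
  | Linv i => exact hLinv i

end Homomorphism

/-- there is a unique ℚ(v)-algebra homomorphism
Φ_{r,ε;1} : U(ĝl_n) → U(ŝl_{n+1})₁ with E_i ↦ e_i, F_i ↦ f_i, L_i^{±1} ↦ l_i^{±1}
(images taken in the quotient), and it is injective. -/
theorem quantum_affine_gl_embedding
    (n r : ℕ) (hn : 2 ≤ n) (hr : r ≤ n - 1) (ε : ℤ) (hε : ε = 1 ∨ ε = -1) :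
    (∃! Φ : Ugl n →ₐ[Qv] U1 n,
      ∀ i : ZMod n,
        Φ (GlE i) = toU1 n (eElt n r ε i) ∧ Φ (GlF i) = toU1 n (fElt n r ε i) ∧
        Φ (GlL i) = toU1 n (lElt n r (rep1 i)) ∧
        Φ (GlLinv i) = toU1 n (linvElt n r (rep1 i))) ∧
    (∀ Φ : Ugl n →ₐ[Qv] U1 n,
      (∀ i : ZMod n,
        Φ (GlE i) = toU1 n (eElt n r ε i) ∧ Φ (GlF i) = toU1 n (fElt n r ε i) ∧
        Φ (GlL i) = toU1 n (lElt n r (rep1 i)) ∧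
        Φ (GlLinv i) = toU1 n (linvElt n r (rep1 i))) →
      Function.Injective Φ) := by
  have hgen (g : GenGl n) : glHom hn hr hε
      (RingQuot.mkAlgHom Qv (RelGl n) (FreeAlgebra.ι Qv g)) = genImage n r ε g :=
    (glHom_mk hn hr hε _).trans (FreeAlgebra.lift_ι_apply _ _)
  refine ⟨⟨glHom hn hr hε, fun i => ⟨hgen (.E i), hgen (.F i), hgen (.L i), hgen (.Linv i)⟩,
    fun Ψ hΨ => ugl_algHom_ext (fun i => ?_) (fun i => ?_) (fun i => ?_) fun i => ?_⟩,
    fun Φ hΦ => injective_of_values hn hr ε Φ hΦ⟩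
  · exact (hΨ i).1.trans (hgen (.E i)).symm
  · exact (hΨ i).2.1.trans (hgen (.F i)).symm
  · exact (hΨ i).2.2.1.trans (hgen (.L i)).symm
  · exact (hΨ i).2.2.2.trans (hgen (.Linv i)).symm

end
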